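/- arXiv:1805.05996 — 2 statements merged into one kernel-verified Lean document; each statement's English description precedes it below -/
import Mathlib

section
/- With the discharging setup below, for each x ∈ X₁^- = {x ∈ X : εΔ ≤ d(x) < q} one has M₂*(x) ≥ (d+2)Δ = M₂(x). -/
open Finset

variable {V : Type*}

/-- `φ` is a proper edge coloring of `G` with colors in `{1, …, k}`, encoded as a symmetric
function on ordered pairs of vertices: every edge receives a color in `[1,k]` and two distinct
edges sharing a vertex receive different colors. -/
def IsEdgeColoring (G : SimpleGraph V) (k : ℕ) (φ : V → V → ℕ) : Prop :=
  (∀ u v, φ u v = φ v u) ∧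
  (∀ ⦃u v⦄, G.Adj u v → φ u v ∈ Finset.Icc 1 k) ∧
  (∀ ⦃v a b⦄, G.Adj v a → G.Adj v b → a ≠ b → φ v a ≠ φ v b)

/-- The chromatic index of `G`: the least `k` such that `G` has a proper edge `k`-coloring. -/
noncomputable def chromIndex (G : SimpleGraph V) : ℕ :=
  sInf {k | ∃ φ : V → V → ℕ, IsEdgeColoring G k φ}

/-- `G` is `Δ`-critical: `G` is connected, `χ'(G) = Δ + 1`, and `χ'(G - e) = Δ` for every
edge `e` of `G`, where `Δ` is the maximum degree of `G`. -/
def IsDeltaCritical [Fintype V] (G : SimpleGraph V) [DecidableRel G.Adj] : Prop :=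
  G.Connected ∧ chromIndex G = G.maxDegree + 1 ∧
    ∀ e ∈ G.edgeSet, chromIndex (G.deleteEdges {e}) = G.maxDegree

/-- The independence number of `G`. -/
noncomputable def indepNum [Fintype V] (G : SimpleGraph V) : ℕ :=
  sSup {n | ∃ s : Finset V, (∀ u ∈ s, ∀ v ∈ s, u ≠ v → ¬ G.Adj u v) ∧ s.card = n}

noncomputable section

open scoped Classical

variable [Fintype V]

/-- `g₁(k) = (d+2)(Δ-k)/k`. -/
def g1 (d : ℕ) (Δ k : ℝ) : ℝ := ((d : ℝ) + 2) * (Δ - k) / k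

/-- The set `X⁺ = {x ∈ X : q ≤ d(x) < Δ}`. -/
def Xp (G : SimpleGraph V) [DecidableRel G.Adj] (q : ℝ) (X : Finset V) : Finset V :=
  X.filter fun x => q ≤ (G.degree x : ℝ) ∧ G.degree x < G.maxDegree

/-- The set `X⁻ = {x ∈ X : d ≤ d(x) < q}`. -/
def Xm (G : SimpleGraph V) [DecidableRel G.Adj] (d : ℕ) (q : ℝ) (X : Finset V) : Finset V :=
  X.filter fun x => d ≤ G.degree x ∧ (G.degree x : ℝ) < q

/-- The charge `M₁*(y)` of a vertex `y ∈ Y` after Step 1 of the discharging rule: starting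
from `M₁(y) = ωΔ`, the vertex `y` gives charge `g₁(d(x))` to each `x ∈ N(y) ∩ X⁺`. -/
def M1star (G : SimpleGraph V) [DecidableRel G.Adj] (d : ℕ) (ω q : ℝ) (X : Finset V)
    (y : V) : ℝ :=
  ω * G.maxDegree -
    ∑ x ∈ G.neighborFinset y ∩ Xp G q X, g1 d (G.maxDegree : ℝ) (G.degree x : ℝ)

/-- The charge that `y ∈ Y` gives to each vertex of `N(y) ∩ X⁻` in Step 2 of the discharging
rule: if `M₁*(y) > 0`, then `y` distributes its remaining charge equally among all vertices
(if any) of `N(y) ∩ X⁻`. -/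
def step2 (G : SimpleGraph V) [DecidableRel G.Adj] (d : ℕ) (ω q : ℝ) (X : Finset V)
    (y : V) : ℝ :=
  if 0 < M1star G d ω q X y ∧ (G.neighborFinset y ∩ Xm G d q X).Nonempty then
    M1star G d ω q X y / ((G.neighborFinset y ∩ Xm G d q X).card : ℝ)
  else 0

/-- The final charge `M₂*(y)` of a vertex `y ∈ Y`. -/
def M2starY (G : SimpleGraph V) [DecidableRel G.Adj] (d : ℕ) (ω q : ℝ) (X : Finset V)
    (y : V) : ℝ :=
  M1star G d ω q X y - ((G.neighborFinset y ∩ Xm G d q X).card : ℝ) * step2 G d ω q X y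

/-- The final charge `M₂*(x)` of a vertex `x ∈ X`: starting from `M₁(x) = (d+2)d(x)`,
`x` receives `g₁(d(x))` from each neighbor `y ∈ Y` in Step 1 if `x ∈ X⁺`, and receives the
Step-2 charge from each neighbor `y ∈ Y` if `x ∈ X⁻`. -/
def M2starX (G : SimpleGraph V) [DecidableRel G.Adj] (d : ℕ) (ω q : ℝ) (X : Finset V)
    (x : V) : ℝ :=
  ((d : ℝ) + 2) * G.degree x +
    (if x ∈ Xp G q X then
      ∑ y ∈ (G.neighborFinset x).filter (· ∉ X), g1 d (G.maxDegree : ℝ) (G.degree x : ℝ)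
    else 0) +
    (if x ∈ Xm G d q X then
      ∑ y ∈ (G.neighborFinset x).filter (· ∉ X), step2 G d ω q X y
    else 0)

/-- `σ_q(x,z) = |{u ∈ N(z) - {x} : d(u) ≥ q}|`. -/
def sigmaq (G : SimpleGraph V) [DecidableRel G.Adj] (q : ℝ) (x z : V) : ℕ :=
  ((G.neighborFinset z).filter fun u => u ≠ x ∧ q ≤ (G.degree u : ℝ)).card

end

variable [Fintype V]

section Aux
set_option linter.unusedSectionVars false
set_option linter.unusedSimpArgs false
open scoped Classical

/-- partial edge coloring of `G` with exactly the edge `xz` uncolored (color `0`). -/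
structure St (G : SimpleGraph V) (K : ℕ) (x z : V) (φ : V → V → ℕ) : Prop where
  adj : G.Adj x z
  symm : ∀ u v, φ u v = φ v u
  le : ∀ u v, φ u v ≤ K
  zero : ∀ u v, φ u v = 0 ↔ ¬ (G.Adj u v ∧ s(u, v) ≠ s(x, z))
  inj : ∀ v a b, φ v a ≠ 0 → φ v a = φ v b → a = b

/-- missing colors at `v` -/
def Ms (K : ℕ) (φ : V → V → ℕ) (v : V) (c : ℕ) : Prop :=
  1 ≤ c ∧ c ≤ K ∧ ∀ w, φ v w ≠ c

/-- two-colored subgraph -/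
def HH (φ : V → V → ℕ) (a b : ℕ) : SimpleGraph V :=
  SimpleGraph.fromRel (fun u v => φ u v = a ∨ φ u v = b)

/-- Kempe swap on `C` -/
noncomputable def ksw (C : V → Prop) (a b : ℕ) (φ : V → V → ℕ) (u v : V) : ℕ :=
  if C u then Equiv.swap a b (φ u v) else φ u v

/-- agreement outside the colors `T` -/
def Ag (T : Finset ℕ) (φ ψ : V → V → ℕ) : Prop :=
  ∀ u v c, c ∉ T → (φ u v = c ↔ ψ u v = c)

lemma St.swap_sym {G : SimpleGraph V} {K : ℕ} {x z : V} {φ : V → V → ℕ}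
    (h : St G K x z φ) : St G K z x φ :=
  ⟨h.adj.symm, h.symm, h.le, by
    intro u v; rw [h.zero, Sym2.eq_swap (a := x)], h.inj⟩

lemma HH_adj {φ : V → V → ℕ} (hs : ∀ u v, φ u v = φ v u) {a b : ℕ} {u v : V} :
    (HH φ a b).Adj u v ↔ u ≠ v ∧ (φ u v = a ∨ φ u v = b) := by
  simp only [HH, SimpleGraph.fromRel_adj, hs v u, or_self]

lemma three {φ : V → V → ℕ} (hs : ∀ u v, φ u v = φ v u)
    (hinj : ∀ v a b, φ v a ≠ 0 → φ v a = φ v b → a = b) {a b : ℕ} (ha : a ≠ 0) (hb : b ≠ 0)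
    {p q r : V} (hpq : p ≠ q) (hpr : p ≠ r) (hqr : q ≠ r)
    (h1 : (HH φ a b).Reachable p q) (h2 : (HH φ a b).Reachable p r)
    (mp : (∀ w, φ p w ≠ a) ∨ (∀ w, φ p w ≠ b))
    (mq : (∀ w, φ q w ≠ a) ∨ (∀ w, φ q w ≠ b))
    (mr : (∀ w, φ r w ≠ a) ∨ (∀ w, φ r w ≠ b)) : False := by
  set H := HH φ a b with hH
  have hdeg2 : ∀ v, H.degree v ≤ 2 := by
    intro v
    have : H.neighborFinset v ⊆ (univ.filter fun w => φ v w = a) ∪ (univ.filter fun w => φ v w = b) := by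
      intro w hw
      rw [SimpleGraph.mem_neighborFinset, hH, HH_adj hs] at hw
      simpa using hw.2
    have c1 : (univ.filter fun w => φ v w = a).card ≤ 1 := by
      rw [card_le_one]; intro i hi j hj
      simp only [mem_filter, mem_univ, true_and] at hi hj
      exact hinj v i j (by omega) (by omega)
    have c2 : (univ.filter fun w => φ v w = b).card ≤ 1 := by
      rw [card_le_one]; intro i hi j hj
      simp only [mem_filter, mem_univ, true_and] at hi hj
      exact hinj v i j (by omega) (by omega)
    calc H.degree v = (H.neighborFinset v).card := rfl
      _ ≤ _ := card_le_card this
      _ ≤ _ := card_union_le _ _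
      _ ≤ 2 := by omega
  have hdeg1 : ∀ v, ((∀ w, φ v w ≠ a) ∨ (∀ w, φ v w ≠ b)) → H.degree v ≤ 1 := by
    intro v hv
    change (H.neighborFinset v).card ≤ 1
    rw [card_le_one]; intro i hi j hj
    rw [SimpleGraph.mem_neighborFinset, hH, HH_adj hs] at hi hj
    rcases hv with hv | hv
    · have e1 := hi.2.resolve_left (hv i)
      have e2 := hj.2.resolve_left (hv j)
      exact hinj v i j (by omega) (by omega)
    · have e1 := hi.2.resolve_right (hv i)
      have e2 := hj.2.resolve_right (hv j)
      exact hinj v i j (by omega) (by omega)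
  let c := H.connectedComponentMk p
  let H' := c.toSimpleGraph
  have hconn : H'.Connected := c.connected_toSimpleGraph
  have hcard := hconn.card_vert_le_card_edgeSet_add_one
  have hsum := H'.sum_degrees_eq_twice_card_edges
  have hd : ∀ v : c, H'.degree v ≤ H.degree v.1 := by
    intro v
    have := SimpleGraph.degree_le_of_le (G := H') (H := H.induce c.supp) (v := v) (le_refl _)
    refine Finset.card_le_card_of_injOn (fun w => w.1) ?_ ?_
    · intro w hw
      simp only [coe_filter, SimpleGraph.mem_neighborFinset, Finset.mem_coe] at hw ⊢
      exact hw
    · intro i _ j _ hij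
      exact Subtype.ext hij
  have hp : p ∈ c.supp := rfl
  have hq : q ∈ c.supp := SimpleGraph.ConnectedComponent.sound h1.symm
  have hr : r ∈ c.supp := SimpleGraph.ConnectedComponent.sound h2.symm
  let P : c := ⟨p, hp⟩
  let Q : c := ⟨q, hq⟩
  let R : c := ⟨r, hr⟩
  have hbound : ∑ v : c, (H'.degree v + if v ∈ ({P, Q, R} : Finset c) then 1 else 0) ≤ ∑ v : c, 2 := by
    apply sum_le_sum
    intro v _
    split_ifs with hv
    · simp only [mem_insert, mem_singleton] at hv
      have : H.degree v.1 ≤ 1 := by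
        rcases hv with rfl | rfl | rfl
        · exact hdeg1 p mp
        · exact hdeg1 q mq
        · exact hdeg1 r mr
      have := hd v
      omega
    · have := hd v
      have := hdeg2 v.1
      omega
  have h3 : ({P, Q, R} : Finset c).card = 3 := by
    rw [card_eq_three]
    exact ⟨P, Q, R, by simpa [P, Q] using hpq, by simpa [P, R] using hpr, by simpa [Q, R] using hqr, rfl⟩
  rw [sum_add_distrib, hsum, Finset.sum_ite_mem, univ_inter, sum_const, sum_const, h3, card_univ] at hbound
  rw [Nat.card_eq_fintype_card, Nat.card_eq_fintype_card, ← SimpleGraph.edgeFinset_card] at hcard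
  simp only [smul_eq_mul] at hbound
  omega

lemma sw_not {C : V → Prop} {a b : ℕ} {φ : V → V → ℕ} {u : V} (h : ¬ C u) (v : V) :
    ksw C a b φ u v = φ u v := by simp [ksw, h]

lemma sw_ag (C : V → Prop) (a b : ℕ) (φ : V → V → ℕ) : Ag {a, b} (ksw C a b φ) φ := by
  intro u v c hc
  simp only [mem_insert, mem_singleton, not_or] at hc
  unfold ksw
  split_ifs with h
  · rw [← Equiv.eq_symm_apply, Equiv.symm_swap, Equiv.swap_apply_of_ne_of_ne hc.1 hc.2]
  · rfl

lemma sw_ms {C : V → Prop} {a b K : ℕ} {φ : V → V → ℕ} {u : V} (h : C u) (hb : 1 ≤ b ∧ b ≤ K)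
    (hm : Ms K φ u a) : Ms K (ksw C a b φ) u b := by
  refine ⟨hb.1, hb.2, fun w hw => hm.2.2 w ?_⟩
  simp only [ksw, h, if_true] at hw
  rw [← Equiv.eq_symm_apply, Equiv.symm_swap, Equiv.swap_apply_right] at hw
  exact hw

lemma Ms_not_sw {C : V → Prop} {a b K c : ℕ} {φ : V → V → ℕ} {u : V} (h : ¬ C u) :
    Ms K (ksw C a b φ) u c ↔ Ms K φ u c := by
  simp [Ms, sw_not h]

lemma St.sw {G : SimpleGraph V} {K : ℕ} {x z : V} {φ : V → V → ℕ} (h : St G K x z φ)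
    {C : V → Prop} {a b : ℕ} (ha : 1 ≤ a ∧ a ≤ K) (hb : 1 ≤ b ∧ b ≤ K)
    (hC : ∀ u v, (HH φ a b).Adj u v → C u → C v) : St G K x z (ksw C a b φ) := by
  have hs : ∀ u v, ksw C a b φ u v = ksw C a b φ v u := by
    intro u v
    by_cases e : φ u v = a ∨ φ u v = b
    · have huv : u ≠ v := by
        rintro rfl
        have : φ u u = 0 := (h.zero u u).2 (by simp)
        omega
      have h1 : (HH φ a b).Adj u v := (HH_adj h.symm).2 ⟨huv, e⟩
      have : C u ↔ C v := ⟨hC _ _ h1, hC _ _ h1.symm⟩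
      unfold ksw
      simp only [this, h.symm u v]
    · push Not at e
      have e' := e
      rw [h.symm u v] at e'
      unfold ksw
      rw [Equiv.swap_apply_of_ne_of_ne e.1 e.2, Equiv.swap_apply_of_ne_of_ne e'.1 e'.2, h.symm u v]
      simp
  have hz : ∀ u v, ksw C a b φ u v = 0 ↔ φ u v = 0 := by
    intro u v
    exact sw_ag C a b φ u v 0 (by simp; omega)
  refine ⟨h.adj, hs, ?_, ?_, ?_⟩
  · intro u v
    unfold ksw
    split_ifs
    · rw [Equiv.swap_apply_def]
      have := h.le u v
      split_ifs <;> omega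
    · exact h.le u v
  · intro u v
    rw [hz, h.zero]
  · intro v i j h0 hij
    rw [Ne, hz] at h0
    apply h.inj v i j h0
    unfold ksw at hij
    split_ifs at hij
    · exact (Equiv.swap a b).injective hij
    · exact hij

lemma Ag.HH {T : Finset ℕ} {φ ψ : V → V → ℕ} (h : Ag T φ ψ) {a b : ℕ} (ha : a ∉ T) (hb : b ∉ T) :
    HH φ a b = HH ψ a b := by
  ext u v
  simp only [_root_.HH, SimpleGraph.fromRel_adj, h u v a ha, h u v b hb, h v u a ha, h v u b hb]

lemma Ag.ms {T : Finset ℕ} {φ ψ : V → V → ℕ} (h : Ag T φ ψ) {K c : ℕ} (hc : c ∉ T) (v : V) :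
    Ms K φ v c ↔ Ms K ψ v c := by
  unfold Ms
  have : ∀ w, φ v w ≠ c ↔ ψ v w ≠ c := fun w => not_congr (h v w c hc)
  simp only [this]

lemma Ag.trans {T T' : Finset ℕ} {φ ψ χ : V → V → ℕ} (h : Ag T φ ψ) (h' : Ag T' ψ χ) :
    Ag (T ∪ T') φ χ := by
  intro u v c hc
  rw [mem_union, not_or] at hc
  rw [h u v c hc.1, h' u v c hc.2]

lemma Ag.symm {T : Finset ℕ} {φ ψ : V → V → ℕ} (h : Ag T φ ψ) : Ag T ψ φ :=
  fun u v c hc => (h u v c hc).symm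

lemma Ag.mono {T T' : Finset ℕ} {φ ψ : V → V → ℕ} (h : Ag T φ ψ) (hT : T ⊆ T') : Ag T' φ ψ :=
  fun u v c hc => h u v c (fun hh => hc (hT hh))

/-- recoloring on the two sides keeps agreement -/
lemma Ag.sw {T : Finset ℕ} {φ ψ : V → V → ℕ} (h : Ag T φ ψ) {a b : ℕ} (ha : a ∉ T) (hb : b ∉ T)
    (C : V → Prop) : Ag T (ksw C a b φ) (ksw C a b ψ) := by
  intro u v c hc
  unfold ksw
  split_ifs
  · rw [← Equiv.eq_symm_apply, ← Equiv.eq_symm_apply, Equiv.symm_swap]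
    apply h
    rw [Equiv.swap_apply_def]
    split_ifs <;> assumption
  · exact h u v c hc

/-- no common missing color at the ends of the uncolored edge -/
lemma St.no_common {G : SimpleGraph V} {K : ℕ} (hno : ¬ ∃ φ, IsEdgeColoring G K φ)
    {x z : V} {φ : V → V → ℕ} (h : St G K x z φ) {c : ℕ} (h1 : Ms K φ x c) (h2 : Ms K φ z c) :
    False := by
  apply hno
  refine ⟨fun u v => if s(u, v) = s(x, z) then c else φ u v, ?_, ?_, ?_⟩
  · intro u v
    simp only [Sym2.eq_swap (a := u) (b := v), h.symm u v]
  · intro u v huv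
    dsimp only
    split_ifs with e
    · simp [h1.1, h1.2.1]
    · have : φ u v ≠ 0 := by
        rw [Ne, h.zero]; simp [huv, e]
      have := h.le u v
      simp; omega
  · intro v a b hva hvb hab
    have key : ∀ w w', s(v, w) = s(x, z) → φ v w' ≠ c := by
      intro w w' e
      rw [Sym2.eq_iff] at e
      rcases e with ⟨rfl, rfl⟩ | ⟨rfl, rfl⟩
      · exact h1.2.2 w'
      · exact h2.2.2 w'
    dsimp only
    split_ifs with e1 e2 e2
    · exfalso
      rw [← e2] at e1
      exact hab (Sym2.congr_right.1 e1)
    · exact (key a b e1).symm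
    · exact key b a e2
    · intro e
      have : φ v a ≠ 0 := by
        rw [Ne, h.zero]; simp [hva, e1]
      exact hab (h.inj v a b this e)

/-- shift of the uncolored edge around `x` -/
lemma St.shift {G : SimpleGraph V} {K : ℕ} {x z w : V} {φ : V → V → ℕ} (h : St G K x z φ)
    {c : ℕ} (hz : Ms K φ z c) (hw : φ x w = c) :
    ∃ ψ, St G K x w ψ ∧ Ag {0, c} ψ φ ∧ (∀ d, Ms K ψ x d ↔ Ms K φ x d) ∧
      (∀ v, v ≠ x → v ≠ z → v ≠ w → ∀ t, ψ v t = φ v t) ∧ Ms K ψ w c ∧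
      (∀ t, t ≠ w → t ≠ z → ψ x t = φ x t) ∧ (∀ d, Ms K φ w d → Ms K ψ w d) := by
  have hc0 : c ≠ 0 := by have := hz.1; omega
  have hwz : w ≠ z := by
    rintro rfl
    exact hc0 (hw ▸ (h.zero x w).2 (by simp))
  have hxz : x ≠ z := h.adj.ne
  have hxw' : G.Adj x w := by
    by_contra hn
    exact hc0 (hw ▸ (h.zero x w).2 (by simp [hn]))
  have hxw : x ≠ w := hxw'.ne
  let ψ : V → V → ℕ := fun u v => if s(u, v) = s(x, z) then c else if s(u, v) = s(x, w) then 0 else φ u v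
  have e1 : ∀ u v, s(u, v) = s(x, z) → ψ u v = c := fun u v e => by simp only [ψ, if_pos e]
  have hne : s(x, w) ≠ s(x, z) := by
    intro e; exact hwz (Sym2.congr_right.1 e)
  have e2 : ∀ u v, s(u, v) = s(x, w) → ψ u v = 0 := fun u v e => by
    simp only [ψ]; rw [if_neg (by rw [e]; exact hne), if_pos e]
  have e3 : ∀ u v, s(u, v) ≠ s(x, z) → s(u, v) ≠ s(x, w) → ψ u v = φ u v := fun u v e e' => by
    simp only [ψ]; rw [if_neg e, if_neg e']
  have f1 : ∀ u v, s(u, v) = s(x, z) → φ u v = 0 := fun u v e => (h.zero u v).2 (by simp [e])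
  have f2 : ∀ u v, s(u, v) = s(x, w) → φ u v = c := fun u v e => by
    rw [Sym2.eq_iff] at e
    rcases e with ⟨rfl, rfl⟩ | ⟨rfl, rfl⟩
    · exact hw
    · rw [h.symm]; exact hw
  have hag : Ag {0, c} ψ φ := by
    intro u v d hd
    simp only [mem_insert, mem_singleton, not_or] at hd
    by_cases p : s(u, v) = s(x, z)
    · rw [e1 _ _ p, f1 _ _ p]; constructor <;> intro <;> omega
    · by_cases p' : s(u, v) = s(x, w)
      · rw [e2 _ _ p', f2 _ _ p']; constructor <;> intro <;> omega
      · rw [e3 _ _ p p']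
  have ex : ∀ t, t ≠ w → t ≠ z → ψ x t = φ x t := by
    intro t h1 h2
    apply e3
    · intro e; exact h2 (Sym2.congr_right.1 e)
    · intro e; exact h1 (Sym2.congr_right.1 e)
  have ev : ∀ v, v ≠ x → v ≠ z → v ≠ w → ∀ t, ψ v t = φ v t := by
    intro v h1 h2 h3 t
    apply e3
    · intro e; rw [Sym2.eq_iff] at e; tauto
    · intro e; rw [Sym2.eq_iff] at e; tauto
  have hwc : ∀ t, ψ w t ≠ c := by
    intro t e
    by_cases p : s(w, t) = s(x, z)
    · rw [Sym2.eq_iff] at p; tauto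
    · by_cases p' : s(w, t) = s(x, w)
      · rw [e2 _ _ p'] at e; omega
      · rw [e3 _ _ p p'] at e
        have : t = x := h.inj w t x (by omega) (by rw [e, h.symm w x, hw])
        apply p'; rw [this, Sym2.eq_swap]
  have hzc : ∀ t, ψ z t = c → t = x := by
    intro t e
    by_contra ht
    by_cases p : s(z, t) = s(x, z)
    · rw [Sym2.eq_iff] at p; tauto
    · by_cases p' : s(z, t) = s(x, w)
      · rw [Sym2.eq_iff] at p'; have := hwz.symm; tauto
      · rw [e3 _ _ p p'] at e
        exact hz.2.2 t e
  have hxc : ∀ t, ψ x t = c → t = z := by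
    intro t e
    by_contra ht
    by_cases p : t = w
    · rw [p, e2 _ _ rfl] at e; omega
    · rw [ex t p ht] at e
      exact p (h.inj x t w (by omega) (by omega))
  have hψs : ∀ u v, ψ u v = ψ v u := by
    intro u v; simp only [ψ, Sym2.eq_swap (a := u) (b := v), h.symm u v]
  refine ⟨ψ, ⟨hxw', hψs, ?_, ?_, ?_⟩, hag, ?_, ev, ⟨hz.1, hz.2.1, hwc⟩, ex, ?_⟩
  · intro u v
    by_cases p : s(u, v) = s(x, z)
    · rw [e1 _ _ p]; exact hz.2.1
    · by_cases p' : s(u, v) = s(x, w)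
      · rw [e2 _ _ p']; omega
      · rw [e3 _ _ p p']; exact h.le u v
  · intro u v
    by_cases p : s(u, v) = s(x, z)
    · rw [e1 _ _ p]
      have : G.Adj u v := by
        rw [← SimpleGraph.mem_edgeSet, p]; exact h.adj
      simp [this, p, hc0, hne.symm]
    · by_cases p' : s(u, v) = s(x, w)
      · rw [e2 _ _ p']; simp [p']
      · rw [e3 _ _ p p', h.zero]; simp [p, p']
  · intro v i j h0 hij
    by_cases hd : ψ v i = c
    · by_cases p : v = x
      · subst p; rw [hxc i hd, hxc j (by omega)]
      by_cases p' : v = z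
      · subst p'; rw [hzc i hd, hzc j (by omega)]
      by_cases p'' : v = w
      · subst p''; exact absurd hd (hwc i)
      rw [ev v p p' p'' i] at h0 hij
      rw [ev v p p' p'' j] at hij
      exact h.inj v i j h0 hij
    · have a1 := (hag v i (ψ v i) (by simp; tauto)).1 rfl
      have a2 := (hag v j (ψ v i) (by simp; tauto)).1 hij.symm
      exact h.inj v i j (by omega) (by omega)
  · intro d
    by_cases hd : d = c
    · subst hd
      constructor
      · intro hh; exact absurd (e1 x z rfl) (hh.2.2 z)
      · intro hh; exact absurd hw (hh.2.2 w)
    · by_cases hd0 : d = 0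
      · subst hd0; simp [Ms]
      · exact hag.ms (by simp; tauto) x
  · intro d hm
    by_cases hd : d = c
    · subst hd; exact ⟨hz.1, hz.2.1, hwc⟩
    · have : d ≠ 0 := by have := hm.1; omega
      exact (hag.ms (by simp; tauto) w).2 hm


/-- fan path centered at `z` -/
def FP (K : ℕ) (φ : V → V → ℕ) (z : V) (s : ℕ → V) (n : ℕ) : Prop :=
  (∀ i < n, Ms K φ (s i) (φ z (s (i + 1)))) ∧ ∀ i j, i ≤ n → j ≤ n → s i = s j → i = j

lemma St.ne_of_col {G : SimpleGraph V} {K : ℕ} {x z : V} {φ : V → V → ℕ} (h : St G K x z φ)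
    {u v : V} (hc : φ u v ≠ 0) : G.Adj u v := by
  by_contra hn
  exact hc ((h.zero u v).2 (by simp [hn]))

lemma FP_no {G : SimpleGraph V} {K : ℕ} (hno : ¬ ∃ φ, IsEdgeColoring G K φ) {z : V} (n : ℕ) :
    ∀ (φ : V → V → ℕ) (s : ℕ → V), St G K z (s 0) φ → FP K φ z s n →
      ∀ β, Ms K φ (s n) β → Ms K φ z β → False := by
  induction n with
  | zero => intro φ s h _ β h1 h2; exact h.no_common hno h2 h1
  | succ n ih =>
    intro φ s h hF β h1 h2
    obtain ⟨ψ, hψ, hag, hx, hv, hw, hxt, hmw⟩ := h.shift (hF.1 0 (by omega)) (w := s (0 + 1)) rfl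
    have hms : ∀ i ≤ n, ∀ c, Ms K φ (s (i + 1)) c → Ms K ψ (s (i + 1)) c := by
      intro i hi c hc
      by_cases hi0 : i = 0
      · subst hi0; exact hmw c hc
      · have a1 : s (i + 1) ≠ z := by
          have := (hF.1 i (by omega)).1
          exact (h.ne_of_col (u := z) (v := s (i + 1)) (by omega)).ne'
        have a2 : s (i + 1) ≠ s 0 := fun e => by
          have := hF.2 _ _ (by omega) (by omega) e; omega
        have a3 : s (i + 1) ≠ s (0 + 1) := fun e => by
          have := hF.2 _ _ (by omega) (by omega) e; omega
        unfold Ms at hc ⊢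
        simp only [hv _ a1 a2 a3]
        exact hc
    refine ih ψ (fun i => s (i + 1)) hψ ⟨?_, ?_⟩ β (hms n le_rfl β h1) ((hx β).2 h2)
    · intro i hi
      have a2 : s (i + 1 + 1) ≠ s 0 := fun e => by
        have := hF.2 _ _ (by omega) (by omega) e; omega
      have a3 : s (i + 1 + 1) ≠ s (0 + 1) := fun e => by
        have := hF.2 _ _ (by omega) (by omega) e; omega
      dsimp only
      rw [hxt _ a3 a2]
      exact hms i (by omega) _ (hF.1 (i + 1) (by omega))
    · intro i j hi hj e
      have := hF.2 _ _ (by omega) (by omega) e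
      omega

lemma fan_link {G : SimpleGraph V} {K : ℕ} (hno : ¬ ∃ φ, IsEdgeColoring G K φ) {z : V} {n : ℕ}
    {φ : V → V → ℕ} {s : ℕ → V} (h : St G K z (s 0) φ) (hF : FP K φ z s n)
    {δ β : ℕ} (hδ : Ms K φ (s n) δ) (hβ : Ms K φ z β) : (HH φ δ β).Reachable z (s n) := by
  by_contra hn
  have hex : ∃ j, j ≤ n ∧ Ms K φ (s j) δ ∧ ¬ (HH φ δ β).Reachable z (s j) := ⟨n, le_rfl, hδ, hn⟩
  obtain ⟨hjn, hjδ, hjr⟩ := Nat.find_spec hex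
  have hmin := fun i (hi : i < Nat.find hex) => Nat.find_min hex hi
  set j := Nat.find hex
  let C : V → Prop := fun v => (HH φ δ β).Reachable (s j) v
  have hCz : ¬ C z := fun hh => hjr hh.symm
  have hS : St G K z (s 0) (ksw C δ β φ) := by
    refine h.sw ⟨hδ.1, hδ.2.1⟩ ⟨hβ.1, hβ.2.1⟩ ?_
    intro u v huv hu
    exact hu.trans huv.reachable
  refine FP_no hno j (ksw C δ β φ) s hS ⟨?_, ?_⟩ β (sw_ms (SimpleGraph.Reachable.refl _) ⟨hβ.1, hβ.2.1⟩ hjδ)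
    ((Ms_not_sw hCz).2 hβ)
  · intro i hi
    rw [sw_not hCz]
    have hm := hF.1 i (by omega)
    have hcβ : φ z (s (i + 1)) ≠ β := hβ.2.2 _
    by_cases hcδ : φ z (s (i + 1)) = δ
    · have := hmin i hi
      rw [hcδ] at hm ⊢
      have hr : (HH φ δ β).Reachable z (s i) := by
        by_contra hr
        exact this ⟨by omega, hm, hr⟩
      have : ¬ C (s i) := fun hh => hCz (hh.trans hr.symm)
      exact (Ms_not_sw this).2 hm
    · exact ((sw_ag C δ β φ).ms (by simp; tauto) _).2 hm
  · intro i k hi hk e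
    exact hF.2 i k (by omega) (by omega) e

lemma fan_elem {G : SimpleGraph V} {K : ℕ} (hno : ¬ ∃ φ, IsEdgeColoring G K φ) {z x : V} {n m : ℕ}
    {φ : V → V → ℕ} {s t : ℕ → V} (h : St G K z x φ) (hs : s 0 = x) (ht : t 0 = x)
    (hF : FP K φ z s n) (hF' : FP K φ z t m) (hne : s n ≠ t m)
    {δ β : ℕ} (hδ : Ms K φ (s n) δ) (hδ' : Ms K φ (t m) δ) (hβ : Ms K φ z β) : False := by
  have key : ∀ (s : ℕ → V) n, s 0 = x → FP K φ z s n → z ≠ s n := by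
    intro s n hs hF
    rcases n with _ | n
    · rw [hs]; exact h.adj.ne
    · have := (hF.1 n (by omega)).1
      exact (h.ne_of_col (u := z) (v := s (n + 1)) (by omega)).ne
  have r1 := fan_link hno (by rw [hs]; exact h) hF hδ hβ
  have r2 := fan_link hno (by rw [ht]; exact h) hF' hδ' hβ
  exact three h.symm h.inj (by have := hδ.1; omega) (by have := hβ.1; omega)
    (key s n hs hF) (key t m ht hF') hne r1 r2 (Or.inr hβ.2.2) (Or.inl hδ.2.2) (Or.inl hδ'.2.2)

/-- finset of missing colors -/
noncomputable def MF (K : ℕ) (φ : V → V → ℕ) (v : V) : Finset ℕ :=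
  (Icc 1 K).filter (fun c => Ms K φ v c)

lemma mem_MF {K : ℕ} {φ : V → V → ℕ} {v : V} {c : ℕ} : c ∈ MF K φ v ↔ Ms K φ v c := by
  unfold MF
  rw [mem_filter]
  constructor
  · exact fun h => h.2
  · intro h; exact ⟨by rw [mem_Icc]; exact ⟨h.1, h.2.1⟩, h⟩

lemma MF_card {K : ℕ} (φ : V → V → ℕ) (v : V) :
    K ≤ (MF K φ v).card + (univ.filter fun w => φ v w ≠ 0).card := by
  have h1 : Icc 1 K ⊆ MF K φ v ∪ ((univ.filter fun w => φ v w ≠ 0).image (φ v)) := by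
    intro c hc
    rw [mem_Icc] at hc
    by_cases hm : Ms K φ v c
    · exact mem_union_left _ (mem_MF.2 hm)
    · apply mem_union_right
      unfold Ms at hm
      push Not at hm
      obtain ⟨w, hw⟩ := hm hc.1 hc.2
      rw [mem_image]
      exact ⟨w, by simp; omega, hw⟩
  have h2 := card_le_card h1
  rw [Nat.card_Icc] at h2
  have h3 := card_union_le (MF K φ v) ((univ.filter fun w => φ v w ≠ 0).image (φ v))
  have h4 : ((univ.filter fun w => φ v w ≠ 0).image (φ v)).card ≤ _ := card_image_le
  omega

lemma St.MF_card {G : SimpleGraph V} [DecidableRel G.Adj] {K : ℕ} {x z : V} {φ : V → V → ℕ} (h : St G K x z φ) (v : V) :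
    K ≤ (MF K φ v).card + G.degree v := by
  have := _root_.MF_card (K := K) φ v
  have h2 : (univ.filter fun w => φ v w ≠ 0).card ≤ G.degree v := by
    apply card_le_card
    intro w hw
    simp only [mem_filter, mem_univ, true_and] at hw
    rw [SimpleGraph.mem_neighborFinset]
    exact h.ne_of_col hw
  omega

lemma St.MF_card' {G : SimpleGraph V} [DecidableRel G.Adj] {K : ℕ} {x z : V} {φ : V → V → ℕ} (h : St G K x z φ) :
    K + 1 ≤ (MF K φ x).card + G.degree x := by
  have := _root_.MF_card (K := K) φ x
  have h2 : (univ.filter fun w => φ x w ≠ 0).card < G.degree x := by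
    apply card_lt_card
    rw [ssubset_iff_of_subset]
    · exact ⟨z, by simpa using h.adj, by simpa using (h.zero x z).2 (by simp)⟩
    · intro w hw
      simp only [mem_filter, mem_univ, true_and] at hw
      rw [SimpleGraph.mem_neighborFinset]
      exact h.ne_of_col hw
  omega

lemma St.ex_miss {G : SimpleGraph V} [DecidableRel G.Adj] {K : ℕ} {x z : V} {φ : V → V → ℕ}
    (h : St G K x z φ) (hK : ∀ v, G.degree v ≤ K) : ∃ c, Ms K φ x c := by
  have := h.MF_card'
  have h2 := hK x
  have : 0 < (MF K φ x).card := by omega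
  obtain ⟨c, hc⟩ := card_pos.1 this
  exact ⟨c, mem_MF.1 hc⟩

/-- Vizing's adjacency lemma. -/
lemma VAL {G : SimpleGraph V} [DecidableRel G.Adj] {K : ℕ} (hno : ¬ ∃ φ, IsEdgeColoring G K φ)
    (hK : ∀ v, G.degree v ≤ K) {z x : V} {φ : V → V → ℕ} (h : St G K z x φ) :
    K + 1 ≤ G.degree x + ((G.neighborFinset z).filter fun u => G.degree u = K).card := by
  obtain ⟨β, hβ⟩ := h.ex_miss hK
  let F : Finset V := univ.filter fun v => ∃ s n, s 0 = x ∧ FP K φ z s n ∧ s n = v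
  have hmF : ∀ v, v ∈ F ↔ ∃ s n, s 0 = x ∧ FP K φ z s n ∧ s n = v := by intro v; simp [F]
  have hxF : x ∈ F := (hmF x).2 ⟨fun _ => x, 0, rfl, ⟨by intro i hi; omega, by intro i j hi hj _; omega⟩, rfl⟩
  have hdisj : ∀ v ∈ F, ∀ w ∈ F, v ≠ w → Disjoint (MF K φ v) (MF K φ w) := by
    intro v hv w hw hvw
    rw [hmF] at hv hw
    obtain ⟨s, n, hs, hF, rfl⟩ := hv
    obtain ⟨t, m, ht, hF', rfl⟩ := hw
    rw [Finset.disjoint_left]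
    intro c hc hc'
    exact fan_elem hno h hs ht hF hF' hvw (mem_MF.1 hc) (mem_MF.1 hc') hβ
  have hsub : F.biUnion (MF K φ) ⊆ (F.erase x).image (φ z) := by
    intro c hc
    rw [mem_biUnion] at hc
    obtain ⟨v, hv, hc⟩ := hc
    rw [mem_MF] at hc
    rw [hmF] at hv
    obtain ⟨s, n, hs, hF, rfl⟩ := hv
    have hzc : ¬ Ms K φ z c := fun hh => FP_no hno n φ s (by rw [hs]; exact h) hF c hc hh
    have : ∃ w, φ z w = c := by
      by_contra hn
      push Not at hn
      exact hzc ⟨hc.1, hc.2.1, hn⟩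
    obtain ⟨w, hw⟩ := this
    have hwx : w ≠ x := by
      rintro rfl
      have := (h.zero z w).2 (by simp)
      have := hc.1
      omega
    rw [mem_image]
    refine ⟨w, mem_erase.2 ⟨hwx, ?_⟩, hw⟩
    rw [hmF]
    by_cases hin : ∃ i ≤ n, s i = w
    · obtain ⟨i, hi, hiw⟩ := hin
      exact ⟨s, i, hs, ⟨fun j hj => hF.1 j (by omega), fun a b ha hb => hF.2 a b (by omega) (by omega)⟩, hiw⟩
    · push Not at hin
      refine ⟨fun i => if i ≤ n then s i else w, n + 1, by simp [hs], ⟨?_, ?_⟩, by simp⟩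
      · intro i hi
        dsimp only
        rw [if_pos (by omega)]
        by_cases hi' : i + 1 ≤ n
        · rw [if_pos hi']; exact hF.1 i (by omega)
        · rw [if_neg hi', hw]
          have : i = n := by omega
          rw [this]; exact hc
      · intro i j hi hj e
        dsimp only at e
        split_ifs at e with p1 p2 p2
        · exact hF.2 i j p1 p2 e
        · exact absurd e (hin i p1)
        · exact absurd e.symm (hin j p2)
        · omega
  have hc1 := card_le_card hsub
  rw [card_biUnion hdisj] at hc1
  have hc2 : ((F.erase x).image (φ z)).card ≤ (F.erase x).card := card_image_le
  rw [← add_sum_erase _ _ hxF] at hc1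
  have hc3 : ((F.erase x).filter fun v => ¬ G.degree v = K).card ≤ ∑ v ∈ F.erase x, (MF K φ v).card := by
    rw [card_filter]
    apply sum_le_sum
    intro v _
    have := h.MF_card v
    have := hK v
    split_ifs <;> omega
  have hc4 := card_filter_add_card_filter_not (s := F.erase x) (fun v => G.degree v = K)
  have hc5 : ((F.erase x).filter fun v => G.degree v = K).card ≤
      ((G.neighborFinset z).filter fun u => G.degree u = K).card := by
    apply card_le_card
    intro v hv
    rw [mem_filter, mem_erase] at hv
    rw [mem_filter, SimpleGraph.mem_neighborFinset]
    refine ⟨?_, hv.2⟩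
    obtain ⟨s, n, hs, hF, rfl⟩ := (hmF v).1 hv.1.2
    rcases n with _ | n
    · exact absurd hs hv.1.1
    · have := (hF.1 n (by omega)).1
      exact h.ne_of_col (by omega)
  have hc6 := h.swap_sym.MF_card'
  omega

lemma St.recolor {G : SimpleGraph V} {K : ℕ} {x z u : V} {φ : V → V → ℕ} (h : St G K x z φ)
    (hu : G.Adj z u) (hux : u ≠ x) {β : ℕ} (hz : Ms K φ z β) (hm : Ms K φ u β) :
    ∃ ψ, St G K x z ψ ∧ Ms K ψ z (φ z u) ∧ (∀ t, ψ x t = φ x t) ∧ Ag {β, φ z u} ψ φ := by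
  have hxz : x ≠ z := h.adj.ne
  have hne : s(z, u) ≠ s(x, z) := by
    intro e; rw [Sym2.eq_iff] at e; tauto
  have hγ0 : φ z u ≠ 0 := by
    rw [Ne, h.zero]; simp [hu, hne]
  let ψ : V → V → ℕ := fun a b => if s(a, b) = s(z, u) then β else φ a b
  have e1 : ∀ a b, s(a, b) = s(z, u) → ψ a b = β := fun a b e => by simp only [ψ, if_pos e]
  have e2 : ∀ a b, s(a, b) ≠ s(z, u) → ψ a b = φ a b := fun a b e => by simp only [ψ, if_neg e]
  have hβ0 : β ≠ 0 := by have := hz.1; omega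
  refine ⟨ψ, ⟨h.adj, ?_, ?_, ?_, ?_⟩, ⟨by omega, h.le _ _, ?_⟩, ?_, ?_⟩
  · intro a b; simp only [ψ, Sym2.eq_swap (a := a) (b := b), h.symm a b]
  · intro a b
    by_cases p : s(a, b) = s(z, u)
    · rw [e1 _ _ p]; exact hz.2.1
    · rw [e2 _ _ p]; exact h.le _ _
  · intro a b
    by_cases p : s(a, b) = s(z, u)
    · rw [e1 _ _ p]
      have : G.Adj a b := by rw [← SimpleGraph.mem_edgeSet, p]; exact hu
      simp [this, p, hβ0, hne]
    · rw [e2 _ _ p]; exact h.zero _ _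
  · intro v i j h0 hij
    have key : ∀ i j, s(v, i) = s(z, u) → φ v j ≠ β := by
      intro i j e
      rw [Sym2.eq_iff] at e
      rcases e with ⟨rfl, _⟩ | ⟨rfl, _⟩
      · exact hz.2.2 j
      · exact hm.2.2 j
    by_cases p : s(v, i) = s(z, u)
    · by_cases p' : s(v, j) = s(z, u)
      · rw [← p'] at p; exact Sym2.congr_right.1 p
      · rw [e1 _ _ p, e2 _ _ p'] at hij
        exact absurd hij.symm (key i j p)
    · by_cases p' : s(v, j) = s(z, u)
      · rw [e1 _ _ p', e2 _ _ p] at hij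
        exact absurd hij (key j i p')
      · rw [e2 _ _ p] at h0 hij
        rw [e2 _ _ p'] at hij
        exact h.inj v i j h0 hij
  · intro w e
    by_cases p : s(z, w) = s(z, u)
    · rw [e1 _ _ p] at e
      exact hz.2.2 u e.symm
    · rw [e2 _ _ p] at e
      apply p
      rw [h.inj z w u (by omega) e]
  · intro t
    apply e2
    intro e; rw [Sym2.eq_iff] at e; tauto
  · intro a b c hc
    simp only [mem_insert, mem_singleton, not_or] at hc
    by_cases p : s(a, b) = s(z, u)
    · rw [e1 _ _ p]
      have : φ a b = φ z u := by
        rw [Sym2.eq_iff] at p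
        rcases p with ⟨rfl, rfl⟩ | ⟨rfl, rfl⟩
        · rfl
        · exact h.symm _ _
      rw [this]
      constructor <;> intro <;> omega
    · rw [e2 _ _ p]

lemma sw_closed {φ : V → V → ℕ} {a b : ℕ} (p : V) : ∀ u v, (HH φ a b).Adj u v →
    (HH φ a b).Reachable p u → (HH φ a b).Reachable p v :=
  fun _ _ huv hu => hu.trans huv.reachable

lemma FP_zero {K : ℕ} {φ : V → V → ℕ} (z x : V) : FP K φ z (fun _ => x) 0 :=
  ⟨by intro i hi; omega, by intro i j hi hj _; omega⟩

lemma St.free {G : SimpleGraph V} {K : ℕ} (hno : ¬ ∃ φ, IsEdgeColoring G K φ)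
    {x z u : V} {φ : V → V → ℕ} (h : St G K x z φ)
    (hu : G.Adj z u) (hux : u ≠ x) {α β : ℕ} (hxα : Ms K φ x α) (huα : Ms K φ u α) (hz : Ms K φ z β) :
    ∃ ψ, St G K x z ψ ∧ Ms K ψ z (φ z u) ∧ (∀ t, ψ x t = φ x t) ∧ Ag {α, β, φ z u} ψ φ := by
  have r1 : (HH φ α β).Reachable z x :=
    fan_link hno (s := fun _ => x) (n := 0) h.swap_sym (FP_zero z x) hxα hz
  have r2 : ¬ (HH φ α β).Reachable z u := fun r2 =>
    three h.symm h.inj (by have := hxα.1; omega) (by have := hz.1; omega) h.adj.ne' hu.ne hux.symm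
      r1 r2 (Or.inr hz.2.2) (Or.inl hxα.2.2) (Or.inl huα.2.2)
  let C : V → Prop := fun v => (HH φ α β).Reachable u v
  have hCz : ¬ C z := fun hh => r2 hh.symm
  have hCx : ¬ C x := fun hh => r2 (r1.trans hh.symm)
  have hS : St G K x z (ksw C α β φ) := h.sw ⟨hxα.1, hxα.2.1⟩ ⟨hz.1, hz.2.1⟩ (sw_closed u)
  obtain ⟨ψ, h1, h2, h3, h4⟩ := hS.recolor hu hux ((Ms_not_sw hCz).2 hz)
    (sw_ms (SimpleGraph.Reachable.refl _) ⟨hz.1, hz.2.1⟩ huα)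
  rw [sw_not hCz] at h2 h4
  refine ⟨ψ, h1, h2, fun t => by rw [h3, sw_not hCx], ?_⟩
  refine (h4.trans (sw_ag C α β φ)).mono ?_
  intro c; simp only [mem_union, mem_insert, mem_singleton]; tauto

lemma St.key {G : SimpleGraph V} {K : ℕ} (hno : ¬ ∃ φ, IsEdgeColoring G K φ)
    {x z u : V} {φ : V → V → ℕ} (h : St G K x z φ)
    (hu : G.Adj z u) (hux : u ≠ x) {α α' β : ℕ} (hne : α ≠ α') (hxα : Ms K φ x α) (huα : Ms K φ u α)
    (hxα' : Ms K φ x α') (huα' : Ms K φ u α') (hz : Ms K φ z β)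
    (hr : ¬ (HH φ α (φ z u)).Reachable x u) : False := by
  have hγ0 : φ z u ≠ 0 := by
    rw [Ne, h.zero]
    have : s(z, u) ≠ s(x, z) := by
      intro e; rw [Sym2.eq_iff] at e; have := h.adj.ne; tauto
    simp [hu, this]
  set γ := φ z u with hγ
  let C : V → Prop := fun v => (HH φ α γ).Reachable u v
  have hCx : ¬ C x := fun hh => hr hh.symm
  have hCu : C u := SimpleGraph.Reachable.refl _
  have hCz : C z := by
    apply SimpleGraph.Adj.reachable
    rw [HH_adj h.symm]
    exact ⟨hu.ne', Or.inr (h.symm _ _)⟩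
  have hS : St G K x z (ksw C α γ φ) := h.sw ⟨hxα.1, hxα.2.1⟩ ⟨Nat.one_le_iff_ne_zero.2 hγ0, h.le _ _⟩ (sw_closed u)
  have hzu : ksw C α γ φ z u = α := by
    simp only [ksw, hCz, if_true, ← hγ, Equiv.swap_apply_right]
  have hγα' : α' ≠ γ := fun e => huα'.2.2 z (by rw [h.symm, ← hγ, e])
  have hux' : Ms K (ksw C α γ φ) u α' := ((sw_ag C α γ φ).ms (by simp; tauto) _).2 huα'
  have hxx' : Ms K (ksw C α γ φ) x α' := (Ms_not_sw hCx).2 hxα'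
  have hxx : Ms K (ksw C α γ φ) x α := (Ms_not_sw hCx).2 hxα
  have hzz : ∃ β, Ms K (ksw C α γ φ) z β := by
    by_cases hb : β = α
    · exact ⟨γ, sw_ms hCz ⟨by omega, h.le _ _⟩ (hb ▸ hz)⟩
    · exact ⟨β, ((sw_ag C α γ φ).ms (by
        simp only [mem_insert, mem_singleton, not_or]
        exact ⟨hb, fun e => hz.2.2 u (by rw [← hγ, e])⟩) _).2 hz⟩
  obtain ⟨β', hβ'⟩ := hzz
  refine fan_elem hno (s := fun _ => x) (t := fun i => if i = 0 then x else u) (n := 0) (m := 1)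
    hS.swap_sym rfl (by simp) (FP_zero z x) ⟨?_, ?_⟩ (by simpa using hux.symm) hxx' (by simpa using hux') hβ'
  · intro i hi
    have : i = 0 := by omega
    subst this
    simp only [if_true, zero_add, one_ne_zero, if_false, hzu]
    exact hxx
  · intro i j hi hj e
    dsimp only at e
    split_ifs at e <;> first | omega | exact absurd e hux | exact absurd e.symm hux

lemma St.move {G : SimpleGraph V} {K : ℕ} (hno : ¬ ∃ φ, IsEdgeColoring G K φ)
    {x y u : V} {φ : V → V → ℕ} (h : St G K x y φ)
    (hu : G.Adj y u) (hux : u ≠ x) {α β δ : ℕ} (hxα : Ms K φ x α) (huδ : Ms K φ u δ) (hy : Ms K φ y β)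
    (hδα : δ ≠ α) (hδβ : δ ≠ β) (hγα : φ y u ≠ α) (hr : ¬ (HH φ δ α).Reachable x u) :
    ∃ w ψ, φ x w = φ y u ∧ St G K x w ψ ∧ Ag {0, α, β, δ, φ y u} ψ φ ∧
      ∀ c, Ms K ψ x c ↔ Ms K φ x c := by
  let C : V → Prop := fun v => (HH φ δ α).Reachable u v
  have hCx : ¬ C x := fun hh => hr hh.symm
  have hCu : C u := SimpleGraph.Reachable.refl _
  have hS : St G K x y (ksw C δ α φ) := h.sw ⟨huδ.1, huδ.2.1⟩ ⟨hxα.1, hxα.2.1⟩ (sw_closed u)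
  have hβα : β ≠ α := fun e => h.no_common hno hxα (e ▸ hy)
  have hag := sw_ag C δ α φ
  have hγδ : φ y u ≠ δ := fun e => huδ.2.2 y (by rw [h.symm, e])
  have hyu : ksw C δ α φ y u = φ y u := (hag y u (φ y u) (by simp; tauto)).2 rfl
  obtain ⟨ψ1, h1, h2, h3, h4⟩ := hS.free hno hu hux ((Ms_not_sw hCx).2 hxα)
    (sw_ms hCu ⟨hxα.1, hxα.2.1⟩ huδ) ((hag.ms (by simp; tauto) _).2 hy)
  rw [hyu] at h2 h4
  have h3' : ∀ t, ψ1 x t = φ x t := fun t => by rw [h3, sw_not hCx]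
  have : ∃ w, φ x w = φ y u := by
    by_contra hn
    push Not at hn
    exact h1.no_common hno (c := φ y u) ⟨h2.1, h2.2.1, fun w => by rw [h3']; exact hn w⟩ h2
  obtain ⟨w, hw⟩ := this
  obtain ⟨ψ, k1, k2, k3, -⟩ := h1.shift h2 (w := w) (by rw [h3', hw])
  refine ⟨w, ψ, hw, k1, ?_, ?_⟩
  · refine (k2.trans (h4.trans hag)).mono ?_
    intro c; simp only [mem_union, mem_insert, mem_singleton]; tauto
  · intro c
    rw [k3]
    simp only [Ms, h3']

lemma fix_pair {G : SimpleGraph V} {K : ℕ} {x z z' u u' : V} {φ φ' : V → V → ℕ} {T : Finset ℕ}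
    (h : St G K x z φ) (h' : St G K x z' φ') (hag : Ag T φ φ') {α δ : ℕ} (hα : α ∉ T) (hδ : δ ∉ T)
    (hxα : Ms K φ x α) (hu : Ms K φ u δ) (hu' : Ms K φ u' δ)
    (hr : ¬ (HH φ δ α).Reachable x u) (hr' : ¬ (HH φ δ α).Reachable x u') :
    ∃ ψ ψ', St G K x z ψ ∧ St G K x z' ψ' ∧ Ag T ψ ψ' ∧ Ag {δ, α} ψ φ ∧ (∀ t, ψ x t = φ x t) ∧
      Ms K ψ u α ∧ Ms K ψ u' α := by
  let C : V → Prop := fun v => (HH φ δ α).Reachable u v ∨ (HH φ δ α).Reachable u' v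
  have hCx : ¬ C x := by
    rintro (hh | hh)
    · exact hr hh.symm
    · exact hr' hh.symm
  have hCl : ∀ a b, (HH φ δ α).Adj a b → C a → C b := by
    rintro a b hab (hh | hh)
    · exact Or.inl (sw_closed u a b hab hh)
    · exact Or.inr (sw_closed u' a b hab hh)
  refine ⟨ksw C δ α φ, ksw C δ α φ', h.sw ⟨hu.1, hu.2.1⟩ ⟨hxα.1, hxα.2.1⟩ hCl,
    h'.sw ⟨hu.1, hu.2.1⟩ ⟨hxα.1, hxα.2.1⟩ ?_, hag.sw hδ hα C, sw_ag C δ α φ, fun t => sw_not hCx t,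
    sw_ms (Or.inl (SimpleGraph.Reachable.refl _)) ⟨hxα.1, hxα.2.1⟩ hu,
    sw_ms (Or.inr (SimpleGraph.Reachable.refl _)) ⟨hxα.1, hxα.2.1⟩ hu'⟩
  rw [← hag.HH hδ hα]
  exact hCl

lemma pair_contra {G : SimpleGraph V} [DecidableRel G.Adj] {K : ℕ}
    (hno : ¬ ∃ φ, IsEdgeColoring G K φ) (hK : ∀ v, G.degree v ≤ K)
    {x z z' u u' : V} {φ φ' : V → V → ℕ} {T : Finset ℕ}
    (h : St G K x z φ) (h' : St G K x z' φ') (hag : Ag T φ φ') (hzz : z ≠ z')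
    {α₁ α₂ δ₁ δ₂ γ : ℕ} (hα₁ : α₁ ∉ T) (hα₂ : α₂ ∉ T) (hδ₁ : δ₁ ∉ T) (hδ₂ : δ₂ ∉ T) (hγ : γ ∉ T)
    (hαα : α₁ ≠ α₂) (hδδ : δ₁ ≠ δ₂) (h11 : δ₁ ≠ α₁) (h12 : δ₁ ≠ α₂) (h21 : δ₂ ≠ α₁) (h22 : δ₂ ≠ α₂)
    (hγ1 : γ ≠ α₁) (hγ2 : γ ≠ α₂)
    (hux : u ≠ x) (hux' : u' ≠ x) (hzu : G.Adj z u) (hzu' : G.Adj z' u')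
    (hc : φ z u = γ) (hc' : φ z' u' = γ) (hx1 : Ms K φ x α₁) (hx2 : Ms K φ x α₂)
    (m1 : Ms K φ u δ₁) (m2 : Ms K φ u δ₂) (m1' : Ms K φ u' δ₁) (m2' : Ms K φ u' δ₂)
    (r1 : ¬ (HH φ δ₁ α₁).Reachable x u) (r2 : ¬ (HH φ δ₂ α₂).Reachable x u)
    (r1' : ¬ (HH φ δ₁ α₁).Reachable x u') (r2' : ¬ (HH φ δ₂ α₂).Reachable x u') : False := by
  obtain ⟨ψ, ψ', a1, a2, a3, a4, a5, a6, a7⟩ := fix_pair h h' hag hα₁ hδ₁ hx1 m1 m1' r1 r1'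
  have n2 : δ₂ ∉ ({δ₁, α₁} : Finset ℕ) := by simp; tauto
  have n2' : α₂ ∉ ({δ₁, α₁} : Finset ℕ) := by simp; exact ⟨h12.symm, hαα.symm⟩
  have eH : HH ψ δ₂ α₂ = HH φ δ₂ α₂ := a4.HH n2 n2'
  have hx2' : Ms K ψ x α₂ := (a4.ms n2' _).2 hx2
  obtain ⟨χ, χ', b1, b2, b3, b4, b5, b6, b7⟩ := fix_pair a1 a2 a3 hα₂ hδ₂ hx2'
    ((a4.ms n2 _).2 m2) ((a4.ms n2 _).2 m2') (by rw [eH]; exact r2) (by rw [eH]; exact r2')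
  have n1 : α₁ ∉ ({δ₂, α₂} : Finset ℕ) := by simp; tauto
  have c1 : Ms K χ u α₁ := (b4.ms n1 _).2 a6
  have c1' : Ms K χ u' α₁ := (b4.ms n1 _).2 a7
  have hγδ1 : γ ≠ δ₁ := fun e => m1.2.2 z (by rw [h.symm, hc, e])
  have hγδ2 : γ ≠ δ₂ := fun e => m2.2.2 z (by rw [h.symm, hc, e])
  have g1 : γ ∉ ({δ₁, α₁} : Finset ℕ) := by simp; tauto
  have g2 : γ ∉ ({δ₂, α₂} : Finset ℕ) := by simp; tauto
  have d1 : χ z u = γ := (b4 _ _ _ g2).2 ((a4 _ _ _ g1).2 hc)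
  have d1' : χ z' u' = γ := (b4 _ _ _ g2).2 ((a4 _ _ _ g1).2 hc')
  have xx : ∀ t, χ x t = φ x t := fun t => by rw [b5, a5]
  have hx1 : Ms K χ x α₁ := by simpa only [Ms, xx] using hx1
  have hx2 : Ms K χ x α₂ := by simpa only [Ms, xx] using hx2
  obtain ⟨β, hβ⟩ := b1.swap_sym.ex_miss hK
  obtain ⟨β', hβ'⟩ := b2.swap_sym.ex_miss hK
  have R1 : (HH χ α₁ γ).Reachable x u := by
    by_contra hn
    exact b1.key hno hzu hux hαα hx1 c1 hx2 b6 hβ (by rw [d1]; exact hn)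
  have R2 : (HH χ α₁ γ).Reachable x u' := by
    by_contra hn
    have e := (b3 _ _ _ hγ).1 d1'
    refine b2.key hno hzu' hux' hαα ((b3.ms hα₁ _).1 hx1) ((b3.ms hα₁ _).1 c1') ((b3.ms hα₂ _).1 hx2)
      ((b3.ms hα₂ _).1 b7) hβ' ?_
    rw [e, ← b3.HH hα₁ hγ]
    exact hn
  have hγ0 : γ ≠ 0 := by
    intro e
    rw [← hc, h.zero] at e
    apply e
    refine ⟨hzu, ?_⟩
    intro e; rw [Sym2.eq_iff] at e; have := h.adj.ne; tauto
  by_cases huu : u = u'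
  · subst huu
    apply hzz
    exact b1.inj u z z' (by rw [b1.symm, d1]; exact hγ0) (by rw [b1.symm u z, b1.symm u z', d1, d1'])
  · exact three b1.symm b1.inj (by have := hx1.1; omega) hγ0 hux.symm hux'.symm huu R1 R2
      (Or.inl hx1.2.2) (Or.inl c1.2.2) (Or.inl c1'.2.2)

/-- pairs `(u, δ)` for which the chain from `x` ends at `u` -/
noncomputable def Bad (K : ℕ) (φ : V → V → ℕ) (x : V) (α : ℕ) : Finset (Σ _ : V, ℕ) :=
  (univ : Finset V).sigma fun u => (MF K φ u).filter fun δ => u ≠ x ∧ (HH φ δ α).Reachable x u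

lemma Bad_card {G : SimpleGraph V} {K : ℕ} {x z : V} {φ : V → V → ℕ} (h : St G K x z φ) {α : ℕ}
    (hα : Ms K φ x α) : (Bad K φ x α).card ≤ K := by
  have : (Bad K φ x α).card ≤ (Icc 1 K).card := by
    apply card_le_card_of_injOn (fun p => p.2)
    · rintro ⟨u, δ⟩ hp
      simp only [Bad, coe_sigma, Set.mem_sigma_iff, mem_coe, mem_filter, mem_MF] at hp
      simp only [coe_Icc, Set.mem_Icc]
      exact ⟨hp.2.1.1, hp.2.1.2.1⟩
    · rintro ⟨u, δ⟩ hp ⟨u', δ'⟩ hp' e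
      simp only [Bad, coe_sigma, Set.mem_sigma_iff, mem_coe, mem_filter, mem_MF] at hp hp' e
      subst e
      by_cases huu : u = u'
      · subst huu; rfl
      · exfalso
        exact three h.symm h.inj (by have := hp.2.1.1; omega) (by have := hα.1; omega)
          hp.2.2.1.symm hp'.2.2.1.symm huu hp.2.2.2 hp'.2.2.2 (Or.inr hα.2.2)
          (Or.inl hp.2.1.2.2) (Or.inl hp'.2.1.2.2)
  simpa using this

lemma bonf {ι β : Type*} [DecidableEq β] (I : Finset ι) (B : ι → Finset β) (m : ℕ)
    (hB : ∀ i ∈ I, ∀ j ∈ I, i ≠ j → (B i ∩ B j).card ≤ m) :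
    ∑ i ∈ I, (B i).card ≤ (I.biUnion B).card + I.card * I.card * m := by
  induction I using Finset.induction_on with
  | empty => simp
  | insert a s ha ih =>
    have h1 := ih (fun i hi j hj => hB i (mem_insert_of_mem hi) j (mem_insert_of_mem hj))
    rw [sum_insert ha, biUnion_insert, card_insert_of_notMem ha]
    have h2 := card_union_add_card_inter (B a) (s.biUnion B)
    have h3 : (B a ∩ s.biUnion B).card ≤ s.card * m := by
      rw [inter_biUnion]
      apply card_biUnion_le_card_mul
      intro j hj
      exact hB a (mem_insert_self _ _) j (mem_insert_of_mem hj) (by rintro rfl; exact ha hj)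
    nlinarith

lemma few_small (S : Finset V) (b : V → ℕ) (D c : ℕ) (hb : ∀ z ∈ S, 1 ≤ b z)
    (hs : ∑ z ∈ S, (1 : ℝ) / (b z : ℝ) < D) : (S.filter fun z => b z ≤ c).card ≤ c * D := by
  rcases Nat.eq_zero_or_pos c with rfl | hc
  · have : (S.filter fun z => b z ≤ 0) = ∅ := by
      apply filter_eq_empty_iff.2
      intro z hz; have := hb z hz; omega
    rw [this]; simp
  have hc' : (0 : ℝ) < c := by exact_mod_cast hc
  have h1 : ∑ z ∈ S.filter (fun z => b z ≤ c), (1 : ℝ) / c ≤ ∑ z ∈ S, (1 : ℝ) / (b z : ℝ) := by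
    calc _ ≤ ∑ z ∈ S.filter (fun z => b z ≤ c), (1 : ℝ) / (b z : ℝ) := by
          apply sum_le_sum
          intro z hz
          rw [mem_filter] at hz
          have : (0 : ℝ) < b z := by exact_mod_cast hb z hz.1
          apply one_div_le_one_div_of_le this
          exact_mod_cast hz.2
      _ ≤ _ := by
          apply sum_le_sum_of_subset_of_nonneg (filter_subset _ _)
          intro i _ _
          positivity
  rw [sum_const, nsmul_eq_mul, mul_one_div] at h1
  have h2 := h1.trans hs.le
  rw [div_le_iff₀ hc'] at h2
  have : (((S.filter fun z => b z ≤ c).card : ℕ) : ℝ) ≤ ((c * D : ℕ) : ℝ) := by push_cast; linarith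
  exact_mod_cast this

/-- pairs of colors seen from `z` -/
noncomputable def BS (G : SimpleGraph V) (K : ℕ) (φ : V → V → ℕ) (L : Finset V) (x : V) (T : Finset ℕ)
    (α₁ α₂ : ℕ) (z : V) : Finset (ℕ × ℕ) :=
  (Icc 1 K ×ˢ Icc 1 K).filter fun p => p.1 ∉ T ∧ p.2 ∉ T ∧ ∃ u ∈ L, u ≠ x ∧ G.Adj z u ∧ φ z u = p.1 ∧
    Ms K φ u p.2 ∧ ¬ (HH φ p.2 α₁).Reachable x u ∧ ¬ (HH φ p.2 α₂).Reachable x u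

lemma BS_card {G : SimpleGraph V} [DecidableRel G.Adj] {K : ℕ} {x y z : V} {φ : V → V → ℕ}
    (h : St G K x y φ) {L : Finset V} {T : Finset ℕ} {α₁ α₂ : ℕ} (hzx : z ≠ x)
    (h1 : Ms K φ x α₁) (h2 : Ms K φ x α₂) (m t s : ℕ) (hm : ∀ u ∈ L, m + t ≤ (MF K φ u).card)
    (hT : T.card ≤ t) (hb : s + 1 + t ≤ (G.neighborFinset z ∩ L).card) :
    s * m ≤ (BS G K φ L x T α₁ α₂ z).card + 2 * K := by
  have hne : ∀ u, G.Adj z u → u ≠ x → φ z u ≠ 0 := by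
    intro u hu hux e
    rw [h.zero] at e
    apply e
    refine ⟨hu, ?_⟩
    intro e; rw [Sym2.eq_iff] at e; tauto
  set P := (G.neighborFinset z ∩ L).filter fun u => u ≠ x ∧ φ z u ∉ T with hP
  set Q := (G.neighborFinset z ∩ L).filter fun u => u ≠ x ∧ φ z u ∈ T with hQ
  have hQc : Q.card ≤ T.card := by
    apply card_le_card_of_injOn (fun u => φ z u)
    · intro u hu
      simp only [hQ, coe_filter, Set.mem_ofPred_eq] at hu
      exact hu.2.2
    · intro u hu u' hu' e
      simp only [hQ, coe_filter, mem_inter, SimpleGraph.mem_neighborFinset, Set.mem_ofPred_eq] at hu hu'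
      exact h.inj z u u' (hne u hu.1.1 hu.2.1) e
  have hPc : s ≤ P.card := by
    have : G.neighborFinset z ∩ L ⊆ (P ∪ Q) ∪ {x} := by
      intro u hu
      simp only [hP, hQ, mem_union, mem_filter, mem_singleton, hu, true_and]
      tauto
    have e1 := card_le_card this
    have e2 := card_union_le (P ∪ Q) {x}
    have e3 := card_union_le P Q
    rw [card_singleton] at e2
    omega
  set W : Finset (Σ _ : V, ℕ) := P.sigma fun u => MF K φ u \ T with hW
  have hWc : s * m ≤ W.card := by
    rw [hW, card_sigma]
    calc s * m ≤ P.card * m := Nat.mul_le_mul_right _ hPc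
      _ = ∑ u ∈ P, m := by rw [sum_const, smul_eq_mul]
      _ ≤ _ := by
        apply sum_le_sum
        intro u hu
        have hu' : u ∈ L := by
          simp only [hP, mem_filter, mem_inter] at hu; exact hu.1.2
        have := hm u hu'
        have := le_card_sdiff T (MF K φ u)
        omega
  set R := W \ (Bad K φ x α₁ ∪ Bad K φ x α₂) with hR
  have hRc : W.card ≤ R.card + 2 * K := by
    have e1 : W.card - (Bad K φ x α₁ ∪ Bad K φ x α₂).card ≤ R.card := by
      rw [hR]; convert le_card_sdiff (Bad K φ x α₁ ∪ Bad K φ x α₂) W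
    have e2 := card_union_le (Bad K φ x α₁) (Bad K φ x α₂)
    have e3 := Bad_card h h1
    have e4 := Bad_card h h2
    omega
  have hRB : R.card ≤ (BS G K φ L x T α₁ α₂ z).card := by
    have key : ∀ p ∈ R, p.1 ∈ L ∧ p.1 ≠ x ∧ G.Adj z p.1 ∧ φ z p.1 ∉ T ∧ p.2 ∉ T ∧ Ms K φ p.1 p.2 ∧
        ¬ (HH φ p.2 α₁).Reachable x p.1 ∧ ¬ (HH φ p.2 α₂).Reachable x p.1 := by
      rintro ⟨u, δ⟩ hp
      simp only [hR, hW, hP, Bad, mem_sdiff, mem_sigma, mem_filter, mem_inter, mem_union, mem_univ,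
        SimpleGraph.mem_neighborFinset, mem_MF] at hp
      simp only
      tauto
    apply card_le_card_of_injOn (fun p => (φ z p.1, p.2))
    · intro p hp
      obtain ⟨a1, a2, a3, a4, a5, a6, a7, a8⟩ := key p hp
      simp only [BS, coe_filter, mem_product, mem_Icc, Set.mem_ofPred_eq]
      have := hne _ a3 a2
      exact ⟨⟨⟨by omega, h.le _ _⟩, a6.1, a6.2.1⟩, a4, a5, p.1, a1, a2, a3, rfl, a6, a7, a8⟩
    · rintro ⟨u, δ⟩ hp ⟨u', δ'⟩ hp' e
      obtain ⟨a1, a2, a3, -⟩ := key _ hp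
      simp only [Prod.mk.injEq] at e
      have := h.inj z u u' (hne _ a3 a2) e.1
      subst this
      rw [e.2]
  omega

lemma BS_inter {G : SimpleGraph V} [DecidableRel G.Adj] {K : ℕ}
    (hno : ¬ ∃ φ, IsEdgeColoring G K φ) (hK : ∀ v, G.degree v ≤ K)
    {x z z' : V} {φ ψ ψ' : V → V → ℕ} {T T2 : Finset ℕ} {L : Finset V}
    (h : St G K x z ψ) (h' : St G K x z' ψ') (hag : Ag T ψ φ) (hag' : Ag T ψ' φ) (hzz : z ≠ z')
    {α₁ α₂ : ℕ} (hα₁ : α₁ ∉ T) (hα₂ : α₂ ∉ T) (hαα : α₁ ≠ α₂)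
    (h1 : Ms K φ x α₁) (h2 : Ms K φ x α₂) (hT : T ⊆ T2) (hT1 : α₁ ∈ T2) (hT2 : α₂ ∈ T2) :
    (BS G K φ L x T2 α₁ α₂ z ∩ BS G K φ L x T2 α₁ α₂ z').card ≤ K := by
  by_contra hcon
  push Not at hcon
  have hmap : ∀ p ∈ BS G K φ L x T2 α₁ α₂ z ∩ BS G K φ L x T2 α₁ α₂ z', p.1 ∈ Icc 1 K := by
    intro p hp
    simp only [BS, mem_inter, mem_filter, mem_product] at hp
    exact hp.1.1.1
  obtain ⟨⟨γ, δ₁⟩, hp, ⟨γ', δ₂⟩, hp', hne, e⟩ :=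
    exists_ne_map_eq_of_card_lt_of_maps_to (by simpa using hcon) hmap
  simp only at e
  subst e
  have hδδ : δ₁ ≠ δ₂ := by rintro rfl; exact hne rfl
  simp only [BS, mem_inter, mem_filter, mem_product] at hp hp'
  obtain ⟨⟨-, a1, a2, u, -, a3, a4, a5, a6, a7, a8⟩, ⟨-, -, -, u', -, b3, b4, b5, b6, b7, b8⟩⟩ := hp
  obtain ⟨⟨hI, c1, c2, v, -, c3, c4, c5, c6, c7, c8⟩, ⟨-, -, -, v', -, d3, d4, d5, d6, d7, d8⟩⟩ := hp'
  have nT : ∀ {c}, c ∉ T2 → c ∉ T := fun hc hh => hc (hT hh)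
  have hγ0 : γ ≠ 0 := by
    have := hI.1; rw [mem_Icc] at this; omega
  have p5 := (hag _ _ _ (nT a1)).2 a5
  have p5' := (hag _ _ _ (nT a1)).2 c5
  have q5 := (hag' _ _ _ (nT a1)).2 b5
  have q5' := (hag' _ _ _ (nT a1)).2 d5
  have euv : u = v := h.inj z u v (by rw [p5]; exact hγ0) (by rw [p5, p5'])
  have euv' : u' = v' := h'.inj z' u' v' (by rw [q5]; exact hγ0) (by rw [q5, q5'])
  subst euv euv'
  have hsym := hag'.symm
  have hag2 : Ag T ψ ψ' := by
    intro p q c hc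
    rw [hag p q c hc, hag' p q c hc]
  have n : ∀ {c α}, c ∉ T2 → α ∈ T2 → c ≠ α := fun hc ha e => hc (e ▸ ha)
  refine pair_contra hno hK h h' hag2 hzz hα₁ hα₂ (nT a2) (nT c2) (nT a1) hαα hδδ (n a2 hT1) (n a2 hT2)
    (n c2 hT1) (n c2 hT2) (n a1 hT1) (n a1 hT2) a3 b3 a4 b4 p5 ((hag _ _ _ (nT a1)).2 b5)
    ((hag.ms hα₁ _).2 h1) ((hag.ms hα₂ _).2 h2) ((hag.ms (nT a2) _).2 a6) ((hag.ms (nT c2) _).2 c6)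
    ((hag.ms (nT a2) _).2 b6) ((hag.ms (nT c2) _).2 d6) ?_ ?_ ?_ ?_
  · rw [hag.HH (nT a2) hα₁]; exact a7
  · rw [hag.HH (nT c2) hα₂]; exact c8
  · rw [hag.HH (nT a2) hα₁]; exact b7
  · rw [hag.HH (nT c2) hα₂]; exact d8

/-- bound on bad neighbors of `y` -/
lemma good_card {G : SimpleGraph V} [DecidableRel G.Adj] {K : ℕ} {x y : V} {φ : V → V → ℕ}
    (h : St G K x y φ) {L : Finset V} {α β : ℕ} (hα : Ms K φ x α) (m r : ℕ)
    (hm : ∀ u ∈ L, m + 2 ≤ (MF K φ u).card) (hr : K < r * m) :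
    (G.neighborFinset y ∩ L).card ≤ ((G.neighborFinset y ∩ L).filter fun u => u ≠ x ∧ φ y u ≠ α ∧
      ∃ δ, Ms K φ u δ ∧ δ ≠ α ∧ δ ≠ β ∧ ¬ (HH φ δ α).Reachable x u).card + 2 + r := by
  set g := fun u => ∃ δ, Ms K φ u δ ∧ δ ≠ α ∧ δ ≠ β ∧ ¬ (HH φ δ α).Reachable x u with hg
  set N := G.neighborFinset y ∩ L with hN
  set P := N.filter fun u => u ≠ x ∧ ¬ g u with hP
  set A := N.filter fun u => φ y u = α with hA
  set Q := N.filter fun u => u ≠ x ∧ φ y u ≠ α ∧ g u with hQ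
  have hAc : A.card ≤ 1 := by
    rw [card_le_one]; intro i hi j hj
    simp only [hA, mem_filter] at hi hj
    exact h.inj y i j (by have := hα.1; omega) (by omega)
  have hPc : P.card ≤ r := by
    by_contra hcon
    push Not at hcon
    have : (P.sigma fun u => MF K φ u \ {α, β}) ⊆ Bad K φ x α := by
      rintro ⟨u, δ⟩ hp
      simp only [hP, hg, mem_sigma, mem_filter, mem_sdiff, mem_MF, mem_insert, mem_singleton, not_exists, not_and, not_not, not_or] at hp
      simp only [Bad, mem_sigma, mem_univ, mem_filter, mem_MF, true_and]
      exact ⟨hp.2.1, hp.1.2.1, hp.1.2.2 δ hp.2.1 hp.2.2.1 hp.2.2.2⟩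
    have e1 := (card_le_card this).trans (Bad_card h hα)
    rw [card_sigma] at e1
    have e2 : P.card * m ≤ ∑ u ∈ P, (MF K φ u \ {α, β}).card := by
      rw [← smul_eq_mul, ← sum_const]
      apply sum_le_sum
      intro u hu
      have hu' : u ∈ L := by
        simp only [hP, hN, mem_filter, mem_inter] at hu; exact hu.1.2
      have := hm u hu'
      have := le_card_sdiff ({α, β} : Finset ℕ) (MF K φ u)
      have : ({α, β} : Finset ℕ).card ≤ 2 := card_le_two
      omega
    have : r * m ≤ P.card * m := Nat.mul_le_mul_right _ hcon.le
    omega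
  have : N ⊆ ((Q ∪ P) ∪ A) ∪ {x} := by
    intro u hu
    simp only [hP, hQ, hA, mem_union, mem_filter, mem_singleton, hu, true_and]
    by_cases h1 : u = x
    · exact Or.inr h1
    by_cases h2 : φ y u = α
    · exact Or.inl (Or.inr h2)
    by_cases h3 : g u
    · exact Or.inl (Or.inl (Or.inl ⟨h1, h2, h3⟩))
    · exact Or.inl (Or.inl (Or.inr ⟨h1, h3⟩))
  have e1 := card_le_card this
  have e2 := card_union_le ((Q ∪ P) ∪ A) {x}
  have e3 := card_union_le (Q ∪ P) A
  have e4 := card_union_le Q P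
  rw [card_singleton] at e2
  change N.card ≤ Q.card + 2 + r
  omega

lemma num_final {D κ K s m : ℕ} (hD : 5 ≤ D) (hκ : D ^ 14 ≤ κ) (hK : K ≤ 2 * (D ^ 10 * κ))
    (hs : D ^ 5 * κ ≤ 2 * s) (hm : D ^ 9 * κ ≤ 2 * m)
    (h : D ^ 9 * (s * m) ≤ K * K + D ^ 9 * D ^ 9 * K + D ^ 9 * (2 * K)) : False := by
  have hD0 : 0 < D := by omega
  have hκ0 : 0 < κ := lt_of_lt_of_le (by positivity) hκ
  have e1 : (D ^ 5 * κ) * (D ^ 9 * κ) ≤ (2 * s) * (2 * m) := Nat.mul_le_mul hs hm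
  have e2 : K * K ≤ (2 * (D ^ 10 * κ)) * (2 * (D ^ 10 * κ)) := Nat.mul_le_mul hK hK
  have e3 : D ^ 9 * D ^ 9 * K ≤ D ^ 9 * D ^ 9 * (2 * (D ^ 10 * κ)) := Nat.mul_le_mul_left _ hK
  have e4 : D ^ 9 * (2 * K) ≤ D ^ 9 * (2 * (2 * (D ^ 10 * κ))) := by gcongr
  have e5 : D ^ 9 * ((D ^ 5 * κ) * (D ^ 9 * κ)) ≤ D ^ 9 * ((2 * s) * (2 * m)) := by gcongr
  have e6 : D ^ 14 * (D ^ 14 * κ) ≤ D ^ 14 * (κ * κ) := by gcongr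
  have e7 : D ^ 5 * (D ^ 14 * κ) ≤ D ^ 5 * (κ * κ) := by gcongr
  have e8 : D ^ 14 * (κ * κ) ≤ D ^ 20 * (κ * κ) := by gcongr <;> omega
  have e9 : D ^ 5 * (κ * κ) ≤ D ^ 20 * (κ * κ) := by gcongr <;> omega
  have e10 : 5 ^ 3 * (D ^ 20 * (κ * κ)) ≤ D ^ 3 * (D ^ 20 * (κ * κ)) := by gcongr
  have e11 : 0 < D ^ 20 * (κ * κ) := by positivity
  have f : D ^ 3 * (D ^ 20 * (κ * κ)) = D ^ 9 * ((D ^ 5 * κ) * (D ^ 9 * κ)) := by ring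
  have f2 : D ^ 9 * ((2 * s) * (2 * m)) = 4 * (D ^ 9 * (s * m)) := by ring
  have f3 : (2 * (D ^ 10 * κ)) * (2 * (D ^ 10 * κ)) = 4 * (D ^ 20 * (κ * κ)) := by ring
  have f4 : D ^ 9 * D ^ 9 * (2 * (D ^ 10 * κ)) = 2 * (D ^ 14 * (D ^ 14 * κ)) := by ring
  have f5 : D ^ 9 * (2 * (2 * (D ^ 10 * κ))) = 4 * (D ^ 5 * (D ^ 14 * κ)) := by ring
  omega

lemma num_kappa {D K : ℕ} (hD : 5 ≤ D) (hK : D ^ 25 ≤ K) :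
    ∃ κ, D ^ 14 ≤ κ ∧ D ^ 10 * κ ≤ K ∧ K < 2 * (D ^ 10 * κ) := by
  have hD0 : 0 < D ^ 10 := by positivity
  refine ⟨K / D ^ 10, ?_, Nat.mul_div_le _ _, ?_⟩
  · rw [Nat.le_div_iff_mul_le hD0]
    calc D ^ 14 * D ^ 10 = D ^ 24 := by ring
      _ ≤ D ^ 25 := Nat.pow_le_pow_right (by omega) (by omega)
      _ ≤ K := hK
  · have h1 := Nat.lt_mul_div_succ K hD0
    have h2 : 1 ≤ K / D ^ 10 := by
      rw [Nat.le_div_iff_mul_le hD0]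
      calc 1 * D ^ 10 = D ^ 10 := by ring
        _ ≤ D ^ 25 := Nat.pow_le_pow_right (by omega) (by omega)
        _ ≤ K := hK
    nlinarith

lemma BS_sub {G : SimpleGraph V} {K : ℕ} {φ : V → V → ℕ} {L : Finset V} {x : V} {T : Finset ℕ}
    {α₁ α₂ : ℕ} {z : V} : BS G K φ L x T α₁ α₂ z ⊆ Icc 1 K ×ˢ Icc 1 K :=
  filter_subset _ _

set_option maxHeartbeats 1000000 in
lemma count {G : SimpleGraph V} [DecidableRel G.Adj] {K : ℕ}
    (hno : ¬ ∃ φ, IsEdgeColoring G K φ) (hK : ∀ v, G.degree v ≤ K) {x : V}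
    (hcrit : ∀ y, G.Adj x y → ∃ φ, St G K x y φ) {D : ℕ} (hD : 5 ≤ D) (hDK : D ^ 25 ≤ K)
    {L : Finset V} (hxL : x ∈ L) (hL : ∀ u ∈ L, K + D * G.degree u ≤ D * K)
    (hx : K ≤ D * G.degree x) :
    (D : ℝ) ≤ ∑ z ∈ G.neighborFinset x, (1 : ℝ) / ((G.neighborFinset z ∩ L).card : ℝ) := by
  by_contra hcon
  push Not at hcon
  have hb : ∀ z ∈ G.neighborFinset x, 1 ≤ (G.neighborFinset z ∩ L).card := by
    intro z hz
    rw [SimpleGraph.mem_neighborFinset] at hz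
    exact card_pos.2 ⟨x, by simp [hz.symm, hxL]⟩
  have few : ∀ c, ((G.neighborFinset x).filter fun z => (G.neighborFinset z ∩ L).card ≤ c).card ≤ c * D :=
    fun c => few_small (G.neighborFinset x) (fun z => (G.neighborFinset z ∩ L).card) D c hb hcon
  obtain ⟨κ, hκ, k1, k2⟩ := num_kappa hD hDK
  have hD0 : 0 < D := by omega
  have hDp : ∀ n, 5 ^ n ≤ D ^ n := fun n => Nat.pow_le_pow_left hD n
  have hκ0 : 5 ^ 14 ≤ κ := (hDp 14).trans hκ
  -- basic power comparisons
  have pw : ∀ n, 5 * (D ^ n * κ) ≤ D ^ (n + 1) * κ := by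
    intro n
    rw [pow_succ]
    nlinarith [Nat.zero_le (D ^ n * κ)]
  have p5 : 5 * (D ^ 5 * κ) ≤ D ^ 6 * κ := pw 5
  have p6 : 5 * (D ^ 6 * κ) ≤ D ^ 7 * κ := pw 6
  have p7 : 5 * (D ^ 7 * κ) ≤ D ^ 8 * κ := pw 7
  have p8 : 5 * (D ^ 8 * κ) ≤ D ^ 9 * κ := pw 8
  have q9 : 5 * D ^ 9 ≤ κ := by
    calc 5 * D ^ 9 ≤ D * D ^ 9 := Nat.mul_le_mul_right _ hD
      _ = D ^ 10 := by ring
      _ ≤ D ^ 14 := Nat.pow_le_pow_right hD0 (by omega)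
      _ ≤ κ := hκ
  have q1 : D ≤ D ^ 9 := by
    calc D = D ^ 1 := by ring
      _ ≤ D ^ 9 := Nat.pow_le_pow_right hD0 (by omega)
  have q5 : 5 ^ 5 * κ ≤ D ^ 5 * κ := Nat.mul_le_mul_right _ (hDp 5)
  have hMF : ∀ {w φ}, St G K x w φ → ∀ u ∈ L, D ^ 9 * κ ≤ (MF K φ u).card := by
    intro w φ h u hu
    have h1 := h.MF_card u
    have h2 := hL u hu
    have h3 : D * (D ^ 9 * κ) ≤ D * (MF K φ u).card := by
      have : D * (D ^ 9 * κ) = D ^ 10 * κ := by ring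
      nlinarith
    exact Nat.le_of_mul_le_mul_left h3 hD0
  have hk : D ^ 9 * κ ≤ G.degree x := by
    have : D * (D ^ 9 * κ) ≤ D * G.degree x := by
      have : D * (D ^ 9 * κ) = D ^ 10 * κ := by ring
      omega
    exact Nat.le_of_mul_le_mul_left this hD0
  -- a neighbor with many low neighbors
  obtain ⟨y, hy, hyb⟩ : ∃ y, G.Adj x y ∧ D ^ 7 * κ < (G.neighborFinset y ∩ L).card := by
    by_contra hall
    push Not at hall
    have h1 := few (D ^ 7 * κ)
    rw [filter_true_of_mem] at h1
    · rw [SimpleGraph.card_neighborFinset_eq_degree] at h1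
      have : D ^ 7 * κ * D = D ^ 8 * κ := by ring
      omega
    · intro z hz
      rw [SimpleGraph.mem_neighborFinset] at hz
      exact hall z hz
  obtain ⟨φ, h0⟩ := hcrit y hy
  obtain ⟨α, hα⟩ := h0.ex_miss hK
  obtain ⟨β, hβ⟩ := h0.swap_sym.ex_miss hK
  obtain ⟨m, hm⟩ : ∃ m, m + 2 = D ^ 9 * κ := ⟨D ^ 9 * κ - 2, by omega⟩
  have hgood := good_card h0 (L := L) (β := β) hα m (4 * D)
    (fun u hu => by rw [hm]; exact hMF h0 u hu) (by
      have : 4 * D * (m + 2) = 4 * (D ^ 10 * κ) := by rw [hm]; ring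
      have : 8 * D ≤ D ^ 10 * κ := by
        have : 5 * (D ^ 9 * κ) ≤ D ^ 10 * κ := pw 9
        omega
      nlinarith)
  set Gd := (G.neighborFinset y ∩ L).filter fun u => u ≠ x ∧ φ y u ≠ α ∧
      ∃ δ, Ms K φ u δ ∧ δ ≠ α ∧ δ ≠ β ∧ ¬ (HH φ δ α).Reachable x u with hGd
  have hmv : ∀ u, ∃ δ w ψ, u ∈ Gd → φ x w = φ y u ∧ φ y u ≠ 0 ∧ St G K x w ψ ∧
      Ag {0, α, β, δ, φ y u} ψ φ := by
    intro u
    by_cases hu : u ∈ Gd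
    · have hu' := hu
      simp only [hGd, mem_filter, mem_inter, SimpleGraph.mem_neighborFinset] at hu'
      obtain ⟨⟨a1, a2⟩, a3, a4, δ, a5, a6, a7, a8⟩ := hu'
      obtain ⟨w, ψ, b1, b2, b3, -⟩ := h0.move hno a1 a3 hα a5 hβ a6 a7 a4 a8
      refine ⟨δ, w, ψ, fun _ => ⟨b1, ?_, b2, b3⟩⟩
      intro e
      rw [h0.zero] at e
      apply e
      refine ⟨a1, ?_⟩
      intro e; rw [Sym2.eq_iff] at e
      have := hy.ne
      tauto
    · exact ⟨0, x, φ, fun h => absurd h hu⟩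
  choose δ w ψ hW using hmv
  have winj : ∀ u ∈ Gd, ∀ v ∈ Gd, w u = w v → u = v := by
    intro u hu v hv e
    have a := hW u hu
    have b := hW v hv
    exact h0.inj y u v a.2.1 (by rw [← a.1, ← b.1, e])
  -- discard those with few low neighbors
  set Sm := Gd.filter fun u => (G.neighborFinset (w u) ∩ L).card ≤ D ^ 5 * κ with hSm
  set Lg := Gd.filter fun u => ¬ (G.neighborFinset (w u) ∩ L).card ≤ D ^ 5 * κ with hLg
  have hSmc : Sm.card ≤ D ^ 5 * κ * D := by
    refine le_trans ?_ (few (D ^ 5 * κ))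
    apply card_le_card_of_injOn w
    · intro u hu
      rw [mem_coe, hSm, mem_filter] at hu
      rw [mem_coe, mem_filter, SimpleGraph.mem_neighborFinset]
      exact ⟨(hW u hu.1).2.2.1.adj, hu.2⟩
    · intro u hu v hv e
      rw [mem_coe, hSm, mem_filter] at hu hv
      exact winj u hu.1 v hv.1 e
  have hsum : Sm.card + Lg.card = Gd.card := card_filter_add_card_filter_not _
  have hLgc : D ^ 9 ≤ Lg.card := by
    have : D ^ 5 * κ * D = D ^ 6 * κ := by ring
    omega
  obtain ⟨I, hIs, hIc⟩ := exists_subset_card_eq hLgc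
  have hI : ∀ u ∈ I, u ∈ Gd ∧ D ^ 5 * κ < (G.neighborFinset (w u) ∩ L).card := by
    intro u hu
    have := hIs hu
    rw [hLg, mem_filter] at this
    exact ⟨this.1, by omega⟩
  set T : Finset ℕ := ({0, α, β} ∪ I.image δ) ∪ I.image (φ y) with hT
  have hTc : T.card ≤ 3 + 2 * D ^ 9 := by
    have c1 : T.card ≤ _ := card_union_le ({0, α, β} ∪ I.image δ) (I.image (φ y))
    have c2 := card_union_le {0, α, β} (I.image δ)
    have c3 : (I.image δ).card ≤ I.card := card_image_le
    have c4 : (I.image (φ y)).card ≤ I.card := card_image_le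
    have c5 : ({0, α, β} : Finset ℕ).card ≤ 3 := card_le_three
    omega
  have hAg : ∀ u ∈ I, Ag T (ψ u) φ := by
    intro u hu
    refine (hW u (hI u hu).1).2.2.2.mono ?_
    intro c hc
    simp only [mem_insert, mem_singleton] at hc
    simp only [hT, mem_union, mem_insert, mem_singleton, mem_image]
    rcases hc with hc | hc | hc | hc | hc
    · exact Or.inl (Or.inl (Or.inl hc))
    · exact Or.inl (Or.inl (Or.inr (Or.inl hc)))
    · exact Or.inl (Or.inl (Or.inr (Or.inr hc)))
    · exact Or.inl (Or.inr ⟨u, hu, hc.symm⟩)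
    · exact Or.inr ⟨u, hu, hc.symm⟩
  have hx2 : 1 < (MF K φ x \ T).card := by
    have c1 := le_card_sdiff T (MF K φ x)
    have c2 := hMF h0 x hxL
    omega
  obtain ⟨α₁, m1, α₂, m2, hαα⟩ := one_lt_card.1 hx2
  rw [mem_sdiff, mem_MF] at m1 m2
  set T2 : Finset ℕ := insert α₁ (insert α₂ T) with hT2
  have hT2c : T2.card ≤ 5 + 2 * D ^ 9 := by
    have c1 : T2.card ≤ _ := card_insert_le α₁ (insert α₂ T)
    have c2 := card_insert_le α₂ T
    omega
  obtain ⟨s, hs⟩ : ∃ s, s + 1 + (5 + 2 * D ^ 9) = D ^ 5 * κ :=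
    ⟨D ^ 5 * κ - 1 - (5 + 2 * D ^ 9), by omega⟩
  obtain ⟨n, hn⟩ : ∃ n, n + (5 + 2 * D ^ 9) = D ^ 9 * κ :=
    ⟨D ^ 9 * κ - (5 + 2 * D ^ 9), by omega⟩
  have hlow : ∀ u ∈ I, s * n ≤ (BS G K φ L x T2 α₁ α₂ (w u)).card + 2 * K := by
    intro u hu
    have hu' := hI u hu
    exact BS_card h0 (hW u hu'.1).2.2.1.adj.ne' m1.1 m2.1 n (5 + 2 * D ^ 9) s
      (fun v hv => by rw [hn]; exact hMF h0 v hv) hT2c (by omega)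
  have hup : ∑ u ∈ I, (BS G K φ L x T2 α₁ α₂ (w u)).card ≤
      (I.biUnion fun u => BS G K φ L x T2 α₁ α₂ (w u)).card + I.card * I.card * K := bonf I (fun u => BS G K φ L x T2 α₁ α₂ (w u)) K (by
    intro u hu v hv huv
    have hu' := hI u hu
    have hv' := hI v hv
    exact BS_inter (T2 := T2) hno hK (hW u hu'.1).2.2.1 (hW v hv'.1).2.2.1 (hAg u hu) (hAg v hv)
      (fun e => huv (winj u hu'.1 v hv'.1 e)) m1.2 m2.2 hαα m1.1 m2.1
      (by rw [hT2]; intro c hc; simp [hc]) (by simp [hT2]) (by simp [hT2]))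
  have hU : (I.biUnion fun u => BS G K φ L x T2 α₁ α₂ (w u)).card ≤ K * K := by
    have : (I.biUnion fun u => BS G K φ L x T2 α₁ α₂ (w u)) ⊆ Icc 1 K ×ˢ Icc 1 K := by
      rw [biUnion_subset]
      intro u _
      exact BS_sub
    have := card_le_card this
    simpa using this
  have hsumlow : I.card * (s * n) ≤ ∑ u ∈ I, (BS G K φ L x T2 α₁ α₂ (w u)).card + I.card * (2 * K) := by
    rw [← smul_eq_mul, ← sum_const, ← smul_eq_mul (a := I.card), ← sum_const, ← sum_add_distrib]
    exact sum_le_sum hlow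
  rw [hIc] at hup hsumlow
  exact num_final (s := s) (m := n) hD hκ k2.le (by omega) (by omega) (by linarith)

lemma crit_state {G : SimpleGraph V} [DecidableRel G.Adj] (hG : IsDeltaCritical G)
    (hpos : 0 < G.maxDegree) {x y : V} (hxy : G.Adj x y) : ∃ φ, St G G.maxDegree x y φ := by
  have h1 := hG.2.2 s(x, y) hxy
  have hne : {k | ∃ φ : V → V → ℕ, IsEdgeColoring (G.deleteEdges {s(x, y)}) k φ}.Nonempty := by
    by_contra hn
    rw [Set.not_nonempty_iff_eq_empty] at hn
    rw [chromIndex, hn, Nat.sInf_empty] at h1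
    omega
  have h2 := Nat.sInf_mem hne
  change ∃ φ : V → V → ℕ, IsEdgeColoring _ (chromIndex (G.deleteEdges {s(x, y)})) φ at h2
  rw [h1] at h2
  obtain ⟨φ, a1, a2, a3⟩ := h2
  have hadj : ∀ u v, (G.deleteEdges {s(x, y)}).Adj u v ↔ G.Adj u v ∧ s(u, v) ≠ s(x, y) := by
    intro u v
    rw [SimpleGraph.deleteEdges_adj]; simp
  have hz : ∀ u v, (if G.Adj u v ∧ s(u, v) ≠ s(x, y) then φ u v else 0) ≠ 0 →
      G.Adj u v ∧ s(u, v) ≠ s(x, y) := by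
    intro u v h
    by_contra hn
    rw [if_neg hn] at h
    exact h rfl
  refine ⟨fun u v => if G.Adj u v ∧ s(u, v) ≠ s(x, y) then φ u v else 0, hxy, ?_, ?_, ?_, ?_⟩
  · intro u v
    simp only [a1 u v, G.adj_comm u v, Sym2.eq_swap (a := u)]
  · intro u v
    split_ifs with h
    · have := a2 ((hadj u v).2 h)
      rw [mem_Icc] at this; omega
    · omega
  · intro u v
    split_ifs with h
    · have := a2 ((hadj u v).2 h)
      rw [mem_Icc] at this
      constructor
      · intro e; omega
      · intro e; exact absurd h e
    · simp only [true_iff]; exact h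
  · intro v a b h e
    have ha := hz v a h
    have hb := hz v b (by rw [← e]; exact h)
    rw [if_pos ha, if_pos hb] at e
    by_contra hab
    exact a3 ((hadj v a).2 ha) ((hadj v b).2 hb) hab e

lemma omega_bd {d : ℕ} {ω : ℝ} (hω : ((d = 3 ∨ d = 4) ∧ ω = 2) ∨
      (19 ≤ d ∧ ω = (((d : ℝ) - 1) * d) ^ ((1 : ℝ) / 3))) : 1 ≤ ω ∧ ω < (d : ℝ) + 2 := by
  rcases hω with ⟨hd, rfl⟩ | ⟨hd, rfl⟩
  · rcases hd with rfl | rfl <;> norm_num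
  · have h : (19 : ℝ) ≤ d := by exact_mod_cast hd
    constructor
    · apply Real.one_le_rpow _ (by norm_num)
      nlinarith
    · have h1 : (((d : ℝ) - 1) * d) ^ ((1 : ℝ) / 3) < (((d : ℝ) + 2) ^ 3) ^ ((1 : ℝ) / 3) := by
        apply Real.rpow_lt_rpow (by nlinarith) (by nlinarith [sq_nonneg (d : ℝ), mul_pos (show (0 : ℝ) < d by linarith) (show (0 : ℝ) < d by linarith), pow_pos (show (0 : ℝ) < d by linarith) 3]) (by norm_num)
      refine h1.trans_eq ?_
      rw [← Real.rpow_natCast, ← Real.rpow_mul (by linarith)]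
      norm_num

/-- The step-2 bound at a neighbor. -/
lemma step2_bd (G : SimpleGraph V) [DecidableRel G.Adj] (d : ℕ) (hG : IsDeltaCritical G)
    (hpos : 0 < G.maxDegree) (X : Finset V) (ω q : ℝ) (h1 : 1 ≤ ω) (h2 : ω < (d : ℝ) + 2)
    (hq : q = (((d : ℝ) + 2 - ω) / ((d : ℝ) + 2)) * G.maxDegree) (x z : V)
    (hxm : x ∈ Xm G d q X) (hxz : G.Adj x z) :
    (ω * (d + 2) / (d + 2 - ω)) * (1 + (q - G.degree x) *
      (1 / ((G.neighborFinset z ∩ Xm G d q X).card : ℝ))) ≤ step2 G d ω q X z := by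
  have hno : ¬ ∃ φ, IsEdgeColoring G G.maxDegree φ := by
    intro h
    have : chromIndex G ≤ G.maxDegree := Nat.sInf_le h
    have := hG.2.1
    omega
  obtain ⟨φ, hφ⟩ := crit_state hG hpos hxz
  have hv := VAL hno (fun v => G.degree_le_maxDegree v) hφ.swap_sym
  have hΔ : (0 : ℝ) < G.maxDegree := by exact_mod_cast hpos
  have hd0 : (0 : ℝ) < (d : ℝ) + 2 := by positivity
  have hd1 : (0 : ℝ) < (d : ℝ) + 2 - ω := by linarith
  have hqpos : 0 < q := by rw [hq]; positivity
  have hqΔ : q < G.maxDegree := by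
    rw [hq]
    have : ((d : ℝ) + 2 - ω) / (d + 2) < 1 := by rw [div_lt_one hd0]; linarith
    nlinarith
  set A := G.neighborFinset z ∩ Xp G q X with hA
  set B := G.neighborFinset z ∩ Xm G d q X with hB
  set F := (G.neighborFinset z).filter fun u => G.degree u = G.maxDegree with hF
  have hAB : Disjoint A B := by
    rw [disjoint_left]; intro u hu hu'
    simp only [hA, hB, Xp, Xm, mem_inter, mem_filter] at hu hu'
    linarith [hu.2.2.1, hu'.2.2.2]
  have hABF : Disjoint (A ∪ B) F := by
    rw [disjoint_left]; intro u hu hu'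
    simp only [hA, hB, hF, Xp, Xm, mem_inter, mem_filter, mem_union] at hu hu'
    rcases hu with hu | hu
    · omega
    · have := hu.2.2.2
      rw [hu'.2] at this
      linarith
  have hsub : (A ∪ B) ∪ F ⊆ G.neighborFinset z := by
    intro u hu
    simp only [hA, hB, hF, mem_inter, mem_filter, mem_union] at hu
    tauto
  have hc := card_le_card hsub
  rw [card_union_of_disjoint hABF, card_union_of_disjoint hAB, SimpleGraph.card_neighborFinset_eq_degree] at hc
  have hzd := G.degree_le_maxDegree z
  have hABc : A.card + B.card + 1 ≤ G.degree x := by omega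
  have hxB : x ∈ B := by
    rw [hB, mem_inter, SimpleGraph.mem_neighborFinset]; exact ⟨hxz.symm, hxm⟩
  have hBpos : 0 < B.card := card_pos.2 ⟨x, hxB⟩
  have hBr : (0 : ℝ) < B.card := by exact_mod_cast hBpos
  have hABr : (A.card : ℝ) + B.card + 1 ≤ G.degree x := by exact_mod_cast hABc
  have hxq : (G.degree x : ℝ) < q := by
    simp only [Xm, mem_filter] at hxm; exact hxm.2.2
  have hqq : q * (d + 2) = (d + 2 - ω) * G.maxDegree := by
    rw [hq]; field_simp
  set r : ℝ := ω * (d + 2) / (d + 2 - ω) with hr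
  have hr0 : 0 < r := by rw [hr]; positivity
  have hrq : r * q = ω * G.maxDegree := by
    rw [hr, div_mul_eq_mul_div, div_eq_iff hd1.ne']
    linear_combination ω * hqq
  have hg : ∀ u ∈ A, g1 d (G.maxDegree : ℝ) (G.degree u : ℝ) ≤ r := by
    intro u hu
    simp only [hA, Xp, mem_inter, mem_filter] at hu
    have hu1 := hu.2.2.1
    have hup : (0 : ℝ) < G.degree u := by linarith
    rw [g1, div_le_iff₀ hup]
    have e1 : r * q ≤ r * G.degree u := by gcongr
    have e2 : ((d : ℝ) + 2) * q ≤ (d + 2) * G.degree u := by gcongr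
    nlinarith
  have hM : r * (q - A.card) ≤ M1star G d ω q X z := by
    have := sum_le_card_nsmul A _ r hg
    rw [nsmul_eq_mul] at this
    rw [M1star, ← hA, mul_sub, hrq]
    linarith
  have hM2 : r * (q - G.degree x + B.card) ≤ M1star G d ω q X z := by
    refine le_trans ?_ hM
    gcongr
    linarith
  have hMpos : 0 < M1star G d ω q X z := lt_of_lt_of_le (mul_pos hr0 (by linarith)) hM2
  rw [step2, ← hB, if_pos ⟨hMpos, ⟨x, hxB⟩⟩, le_div_iff₀ hBr]
  refine le_trans (le_of_eq ?_) hM2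
  field_simp
  ring

end Aux

/-- Discharging setup as in the paper, with `ε = ω/(d+2)`. For each
`x ∈ X₁⁻ = {x ∈ X : εΔ ≤ d(x) < q}` one has `M₂*(x) ≥ (d+2)Δ = M₂(x)`. -/
theorem statement17 (G : SimpleGraph V) [DecidableRel G.Adj]
    (d : ℕ) (hd : d = 3 ∨ d = 4 ∨ 19 ≤ d)
    (hG : IsDeltaCritical G) (hmin : ∀ v : V, d ≤ G.degree v)
    (hmax : (d + 2) ^ (5 * d + 10) ≤ G.maxDegree)
    (X : Finset V) (hXind : ∀ u ∈ X, ∀ v ∈ X, u ≠ v → ¬ G.Adj u v)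
    (hXmax : ∀ s : Finset V, (∀ u ∈ s, ∀ v ∈ s, u ≠ v → ¬ G.Adj u v) → s.card ≤ X.card)
    (ω : ℝ) (hω : ((d = 3 ∨ d = 4) ∧ ω = 2) ∨
      (19 ≤ d ∧ ω = (((d : ℝ) - 1) * d) ^ ((1 : ℝ) / 3)))
    (q : ℝ) (hq : q = (((d : ℝ) + 2 - ω) / ((d : ℝ) + 2)) * G.maxDegree)
    (ε : ℝ) (hε : ε = ω / ((d : ℝ) + 2))
    (x : V) (hx : x ∈ X)
    (hdeg : ε * G.maxDegree ≤ (G.degree x : ℝ) ∧ (G.degree x : ℝ) < q) :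
    ((d : ℝ) + 2) * G.maxDegree ≤ M2starX G d ω q X x := by
  classical
  obtain ⟨h1, h2⟩ := omega_bd hω
  have hd3 : 3 ≤ d := by omega
  have hpos : 0 < G.maxDegree := lt_of_lt_of_le (by positivity) hmax
  have hΔ : (0 : ℝ) < G.maxDegree := by exact_mod_cast hpos
  have hd0 : (0 : ℝ) < (d : ℝ) + 2 := by positivity
  have hd1 : (0 : ℝ) < (d : ℝ) + 2 - ω := by linarith
  have hxm : x ∈ Xm G d q X := by
    simp only [Xm, mem_filter]; exact ⟨hx, hmin x, hdeg.2⟩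
  have hxp : x ∉ Xp G q X := by
    simp only [Xp, mem_filter]; intro h; linarith [h.2.1, hdeg.2]
  have hN : (G.neighborFinset x).filter (· ∉ X) = G.neighborFinset x := by
    rw [filter_true_of_mem]
    intro z hz hzX
    rw [SimpleGraph.mem_neighborFinset] at hz
    exact hXind x hx z hzX hz.ne hz
  have hno : ¬ ∃ φ, IsEdgeColoring G G.maxDegree φ := by
    intro h
    have : chromIndex G ≤ G.maxDegree := Nat.sInf_le h
    have := hG.2.1
    omega
  have hqq : q * (d + 2) = (d + 2 - ω) * G.maxDegree := by
    rw [hq]; field_simp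
  have hS := count hno (fun v => G.degree_le_maxDegree v) (x := x)
    (fun y hy => crit_state hG hpos hy) (D := d + 2) (by omega)
    (le_trans (Nat.pow_le_pow_right (by omega) (by omega)) hmax) hxm
    (by
      intro u hu
      simp only [Xm, mem_filter] at hu
      have hu2 := hu.2.2
      have : ((G.maxDegree + (d + 2) * G.degree u : ℕ) : ℝ) ≤ (((d + 2) * G.maxDegree : ℕ) : ℝ) := by
        push_cast
        nlinarith
      exact_mod_cast this)
    (by
      have h3 := hdeg.1
      have e : ε * (d + 2) = ω := by rw [hε]; field_simp
      have : ((G.maxDegree : ℕ) : ℝ) ≤ (((d + 2) * G.degree x : ℕ) : ℝ) := by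
        push_cast
        nlinarith
      exact_mod_cast this)
  push_cast at hS
  set r : ℝ := ω * (d + 2) / (d + 2 - ω) with hr
  have hr0 : 0 < r := by rw [hr]; positivity
  set S := ∑ z ∈ G.neighborFinset x, (1 : ℝ) / ((G.neighborFinset z ∩ Xm G d q X).card : ℝ) with hSd
  have hsum : r * (G.degree x + (q - G.degree x) * S) ≤ ∑ y ∈ G.neighborFinset x, step2 G d ω q X y := by
    have : ∑ z ∈ G.neighborFinset x, r * (1 + (q - G.degree x) *
        (1 / ((G.neighborFinset z ∩ Xm G d q X).card : ℝ))) ≤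
        ∑ y ∈ G.neighborFinset x, step2 G d ω q X y := by
      apply sum_le_sum
      intro z hz
      rw [SimpleGraph.mem_neighborFinset] at hz
      exact step2_bd G d hG hpos X ω q h1 h2 hq x z hxm hz
    rw [← mul_sum, sum_add_distrib, ← mul_sum, sum_const, nsmul_one,
      SimpleGraph.card_neighborFinset_eq_degree] at this
    exact this
  rw [M2starX, if_neg hxp, if_pos hxm, hN]
  have hS2 : ((d : ℝ) + 2) / ω ≤ S := by
    refine le_trans ?_ hS
    rw [div_le_iff₀ (by linarith)]
    nlinarith
  have hkey : r * (G.degree x + (q - G.degree x) * ((d + 2) / ω)) = (d + 2) * (G.maxDegree - G.degree x) := by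
    have hω0 : ω ≠ 0 := by linarith
    rw [hr, hq]
    field_simp
    ring
  have hle : r * (G.degree x + (q - G.degree x) * ((d + 2) / ω)) ≤ r * (G.degree x + (q - G.degree x) * S) := by
    have : 0 ≤ q - G.degree x := by linarith [hdeg.2]
    gcongr
  linarith
end

section
/- With the discharging setup below, for each x ∈ X₂^- one has M₂*(x) ≥ (d+2)Δ = M₂(x), where X₂^- = {x ∈ X : d ≤ d(x) < εΔ} if d ≥ 19 and X₂^- = {x ∈ X : 3d−3 ≤ d(x) < εΔ} if d ∈ {3,4}. -/
open Finset

variable {V : Type*}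

variable [Fintype V]

set_option linter.unusedSectionVars false
set_option linter.unusedVariables false

/-- Partial edge coloring of `G` with colors `1..D`, the edge `xy` being uncolored (`0`). -/
structure PC (G : SimpleGraph V) (D : ℕ) (x y : V) (f : V → V → ℕ) : Prop where
  symm : ∀ u v, f u v = f v u
  range : ∀ u v, f u v ≤ D
  adj : ∀ u v, f u v ≠ 0 ↔ (G.Adj u v ∧ ¬ (u = x ∧ v = y) ∧ ¬ (u = y ∧ v = x))
  proper : ∀ v a b, f v a = f v b → f v a ≠ 0 → a = b

/-- color `c` is missing at `v`. -/
def Miss (D : ℕ) (f : V → V → ℕ) (v : V) (c : ℕ) : Prop := 1 ≤ c ∧ c ≤ D ∧ ∀ w, f v w ≠ c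

/-- Kempe component. -/
def Kemp (f : V → V → ℕ) (α β : ℕ) (u : V) : Set V :=
  {w | Relation.ReflTransGen (fun a b => f a b = α ∨ f a b = β) u w}

open Classical in
/-- Kempe swap on a set. -/
noncomputable def swp (f : V → V → ℕ) (α β : ℕ) (K : Set V) (a b : V) : ℕ :=
  if a ∈ K then Equiv.swap α β (f a b) else f a b

lemma PC.flip {G : SimpleGraph V} {D : ℕ} {x y : V} {f : V → V → ℕ} (h : PC G D x y f) :
    PC G D y x f :=
  ⟨h.symm, h.range, fun u v => by rw [h.adj]; tauto, h.proper⟩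

lemma PC.complete {G : SimpleGraph V} {D : ℕ} (hno : ∀ φ, ¬ IsEdgeColoring G D φ)
    {x y : V} {f : V → V → ℕ} (h : PC G D x y f) (hxy : G.Adj x y) {c : ℕ}
    (hx : Miss D f x c) (hy : Miss D f y c) : False := by
  classical
  have hne := hxy.ne
  obtain ⟨h1, h2, hx⟩ := hx
  obtain ⟨-, -, hy⟩ := hy
  apply hno (fun u v => if (u = x ∧ v = y) ∨ (u = y ∧ v = x) then c else f u v)
  refine ⟨?_, ?_, ?_⟩
  · intro u v
    have := h.symm u v
    by_cases h1 : (u = x ∧ v = y) ∨ (u = y ∧ v = x)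
    · simp only [if_pos h1, if_pos (show (v = x ∧ u = y) ∨ (v = y ∧ u = x) by tauto)]
    · simp only [if_neg h1, if_neg (show ¬ ((v = x ∧ u = y) ∨ (v = y ∧ u = x)) by tauto)]
      exact this
  · intro u v huv
    rw [Finset.mem_Icc]
    by_cases h1 : (u = x ∧ v = y) ∨ (u = y ∧ v = x)
    · simp only [if_pos h1]; omega
    · simp only [if_neg h1]
      have := (h.adj u v).2 (by tauto)
      have := h.range u v
      omega
  · intro v a b hva hvb hab
    by_cases ha : (v = x ∧ a = y) ∨ (v = y ∧ a = x) <;>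
    by_cases hb : (v = x ∧ b = y) ∨ (v = y ∧ b = x)
    · exfalso; grind
    · simp only [if_pos ha, if_neg hb]
      rcases ha with ⟨rfl, rfl⟩ | ⟨rfl, rfl⟩
      · exact (hx b).symm
      · exact (hy b).symm
    · simp only [if_neg ha, if_pos hb]
      rcases hb with ⟨rfl, rfl⟩ | ⟨rfl, rfl⟩
      · exact (hx a)
      · exact (hy a)
    · simp only [if_neg ha, if_neg hb]
      intro he
      exact hab (h.proper v a b he ((h.adj v a).2 (by tauto)))

lemma kemp_closed {f : V → V → ℕ} (hs : ∀ u v, f u v = f v u) {α β : ℕ} {u a b : V}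
    (hab : f a b = α ∨ f a b = β) : a ∈ Kemp f α β u ↔ b ∈ Kemp f α β u := by
  constructor
  · intro h; exact Relation.ReflTransGen.tail h hab
  · intro h; exact Relation.ReflTransGen.tail h (by rw [hs b a]; exact hab)

lemma mem_kemp_self {f : V → V → ℕ} {α β : ℕ} {u : V} : u ∈ Kemp f α β u :=
  Relation.ReflTransGen.refl

lemma kemp_symm {f : V → V → ℕ} (hs : ∀ u v, f u v = f v u) {α β : ℕ} {u v : V}
    (h : v ∈ Kemp f α β u) : u ∈ Kemp f α β v := by
  have : Std.Symm (fun a b => f a b = α ∨ f a b = β) := ⟨fun a b hab => by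
    rw [hs b a]; exact hab⟩
  exact Relation.ReflTransGen.stdSymm.symm _ _ h

lemma swap_ne_zero {α β c : ℕ} (ha : α ≠ 0) (hb : β ≠ 0) : Equiv.swap α β c ≠ 0 ↔ c ≠ 0 := by
  rw [Equiv.swap_apply_def]; grind

lemma PC.swp {G : SimpleGraph V} {D : ℕ} {x y : V} {f : V → V → ℕ} (h : PC G D x y f)
    {α β : ℕ} (ha : α ≠ 0) (hb : β ≠ 0) (ha' : α ≤ D) (hb' : β ≤ D) (u : V) :
    PC G D x y (swp f α β (Kemp f α β u)) := by
  classical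
  refine ⟨?_, ?_, ?_, ?_⟩
  · intro a b
    have hs := h.symm a b
    unfold _root_.swp
    by_cases hc : f a b = α ∨ f a b = β
    · have := kemp_closed (u := u) h.symm hc
      simp only [this, hs]
    · have h1 : Equiv.swap α β (f a b) = f a b :=
        Equiv.swap_apply_of_ne_of_ne (by tauto) (by tauto)
      have h2 : Equiv.swap α β (f b a) = f b a := by rw [← hs]; exact h1
      simp only [h2, ite_self, hs]
  · intro a b
    have := h.range a b
    unfold _root_.swp
    split_ifs
    · rw [Equiv.swap_apply_def]; grind
    · exact this
  · intro a b
    rw [← h.adj]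
    unfold _root_.swp
    split_ifs
    · exact swap_ne_zero ha hb
    · rfl
  · intro v a b
    unfold _root_.swp
    split_ifs
    · intro h1 h2
      rw [swap_ne_zero ha hb] at h2
      exact h.proper v a b (by simpa using h1) h2
    · exact h.proper v a b

lemma miss_swp_notMem {D : ℕ} {f : V → V → ℕ} {α β : ℕ} {K : Set V} {v : V} (hv : v ∉ K) {c : ℕ} :
    Miss D (swp f α β K) v c ↔ Miss D f v c := by
  unfold Miss swp; simp [hv]

lemma swp_notMem {f : V → V → ℕ} {α β : ℕ} {K : Set V} {v : V} (hv : v ∉ K) (w : V) :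
    swp f α β K v w = f v w := by
  unfold swp; simp [hv]

lemma miss_swp_mem_left {D : ℕ} {f : V → V → ℕ} {α β : ℕ} {K : Set V} {v : V} (hv : v ∈ K)
    (hb : Miss D f v β) (ha : 1 ≤ α) (ha' : α ≤ D) : Miss D (swp f α β K) v α := by
  refine ⟨ha, ha', fun w hw => hb.2.2 w ?_⟩
  unfold swp at hw; rw [if_pos hv] at hw
  rw [Equiv.swap_apply_def] at hw; grind

lemma miss_swp_mem_right {D : ℕ} {f : V → V → ℕ} {α β : ℕ} {K : Set V} {v : V} (hv : v ∈ K)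
    (hb : Miss D f v α) (ha : 1 ≤ β) (ha' : β ≤ D) : Miss D (swp f α β K) v β := by
  refine ⟨ha, ha', fun w hw => hb.2.2 w ?_⟩
  unfold swp at hw; rw [if_pos hv] at hw
  rw [Equiv.swap_apply_def] at hw; grind

lemma swp_eq_iff {f : V → V → ℕ} {α β c : ℕ} {K : Set V} {a b : V} (h1 : c ≠ α) (h2 : c ≠ β) :
    swp f α β K a b = c ↔ f a b = c := by
  unfold swp
  split_ifs
  · rw [Equiv.swap_apply_def]; grind
  · rfl

/-- A Kempe component has at most two ends. -/
lemma three_ends {G : SimpleGraph V} {D : ℕ} {x y : V} {f : V → V → ℕ} (h : PC G D x y f)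
    {α β : ℕ} (ha : α ≠ 0) (hb : β ≠ 0) {u v w : V} (huv : u ≠ v) (huw : u ≠ w) (hvw : v ≠ w)
    (hu : (∀ t, f u t ≠ α) ∨ (∀ t, f u t ≠ β)) (hv : (∀ t, f v t ≠ α) ∨ (∀ t, f v t ≠ β))
    (hw : (∀ t, f w t ≠ α) ∨ (∀ t, f w t ≠ β))
    (h1 : v ∈ Kemp f α β u) (h2 : w ∈ Kemp f α β u) : False := by
  classical
  let H : SimpleGraph V :=
    { Adj := fun a b => f a b = α ∨ f a b = β
      symm := ⟨fun a b hab => by rw [h.symm b a]; exact hab⟩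
      loopless := ⟨fun a haa => by
        have : f a a ≠ 0 := by grind
        exact G.loopless.irrefl a ((h.adj a a).1 this).1⟩ }
  have hdeg : ∀ a, H.degree a ≤ 2 := by
    intro a
    rw [← SimpleGraph.card_neighborFinset_eq_degree]
    have : (H.neighborFinset a).card ≤ ({α, β} : Finset ℕ).card := by
      apply Finset.card_le_card_of_injOn (f a)
      · intro b hb
        have : f a b = α ∨ f a b = β := by simpa using hb
        simpa using this
      · intro b hb c hc hbc
        have : f a b = α ∨ f a b = β := by simpa using hb
        exact h.proper a b c hbc (by grind)
    exact this.trans Finset.card_le_two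
  have hdeg1 : ∀ a, ((∀ t, f a t ≠ α) ∨ (∀ t, f a t ≠ β)) → H.degree a ≤ 1 := by
    intro a haa
    rw [← SimpleGraph.card_neighborFinset_eq_degree, Finset.card_le_one]
    intro b hb c hc
    have hb : f a b = α ∨ f a b = β := by simpa using hb
    have hc : f a c = α ∨ f a c = β := by simpa using hc
    exact h.proper a b c (by grind) (by grind)
  let C := H.connectedComponentMk u
  have hr : ∀ t, t ∈ Kemp f α β u → t ∈ C := by
    intro t ht
    have : H.Reachable u t := (SimpleGraph.reachable_iff_reflTransGen u t).2 ht
    exact SimpleGraph.ConnectedComponent.sound this.symm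
  have huC : u ∈ C := hr u mem_kemp_self
  have hvC := hr v h1
  have hwC := hr w h2
  have hdle : ∀ t : C, C.toSimpleGraph.degree t ≤ H.degree t.1 := by
    intro t
    rw [← SimpleGraph.card_neighborFinset_eq_degree, ← SimpleGraph.card_neighborFinset_eq_degree]
    apply Finset.card_le_card_of_injOn (fun s : C => s.1)
    · intro s hs
      have : C.toSimpleGraph.Adj t s := by simpa using hs
      have h3 : H.Adj t.1 s.1 := this
      simpa using h3
    · intro s _ s' _ hss
      exact Subtype.ext hss
  have hconn := C.connected_toSimpleGraph
  have hcard := hconn.card_vert_le_card_edgeSet_add_one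
  have hsum := C.toSimpleGraph.sum_degrees_eq_twice_card_edges
  rw [Nat.card_eq_fintype_card, Nat.card_eq_fintype_card, ← SimpleGraph.edgeFinset_card] at hcard
  let T : Finset C := {⟨u, huC⟩, ⟨v, hvC⟩, ⟨w, hwC⟩}
  have hT : T.card = 3 := by
    apply Finset.card_eq_three.2
    exact ⟨_, _, _, by simpa using huv, by simpa using huw, by simpa using hvw, rfl⟩
  have hbound : ∑ t : C, C.toSimpleGraph.degree t ≤ ∑ t : C, (if t ∈ T then 1 else 2) := by
    apply Finset.sum_le_sum
    intro t _
    split_ifs with htT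
    · refine (hdle t).trans (hdeg1 _ ?_)
      simp only [T, Finset.mem_insert, Finset.mem_singleton] at htT
      rcases htT with rfl | rfl | rfl
      · exact hu
      · exact hv
      · exact hw
    · exact (hdle t).trans (hdeg _)
  have hval : ∑ t : C, (if t ∈ T then 1 else 2) + 3 = 2 * Fintype.card C := by
    rw [← hT, Finset.card_eq_sum_ones, ← Finset.sum_filter_add_sum_filter_not univ (· ∈ T)]
    have e1 : univ.filter (· ∈ T) = T := by ext; simp
    have : ∑ t : C, (if t ∈ T then 1 else 2) + ∑ t : C, (if t ∈ T then 1 else 0) = ∑ t : C, 2 := by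
      rw [← Finset.sum_add_distrib]
      apply Finset.sum_congr rfl
      intro t _; split_ifs <;> rfl
    rw [Finset.sum_filter_add_sum_filter_not]
    have e2 : ∑ t : C, (if t ∈ T then 1 else 0) = ∑ t ∈ T, 1 := by
      rw [← Finset.sum_filter, e1]
    rw [← e2, this]; simp [mul_comm]
  omega

open Classical in
/-- recolor one edge -/
noncomputable def setE (f : V → V → ℕ) (a b : V) (c : ℕ) (u v : V) : ℕ :=
  if (u = a ∧ v = b) ∨ (u = b ∧ v = a) then c else f u v

lemma setE_same {f : V → V → ℕ} {a b : V} {c : ℕ} : setE f a b c a b = c := by simp [setE]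

lemma setE_same' {f : V → V → ℕ} {a b : V} {c : ℕ} : setE f a b c b a = c := by simp [setE]

lemma setE_other {f : V → V → ℕ} {a b : V} {c : ℕ} {u v : V} (h1 : ¬ (u = a ∧ v = b))
    (h2 : ¬ (u = b ∧ v = a)) : setE f a b c u v = f u v := by
  simp only [setE]; rw [if_neg (by tauto)]

lemma PC.ne_zero_ne {G : SimpleGraph V} {D : ℕ} {x y : V} {f : V → V → ℕ} (h : PC G D x y f)
    {a b : V} (hab : f a b ≠ 0) : a ≠ b := ((h.adj a b).1 hab).1.ne

lemma PC.zero {G : SimpleGraph V} {D : ℕ} {x y : V} {f : V → V → ℕ} (h : PC G D x y f) :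
    f x y = 0 := by
  by_contra hc
  have := (h.adj x y).1 hc
  tauto

lemma PC.recolor {G : SimpleGraph V} {D : ℕ} {x y : V} {f : V → V → ℕ} (h : PC G D x y f)
    {a b : V} {c : ℕ} (hab : f a b ≠ 0) (ha : Miss D f a c) (hb : Miss D f b c) :
    PC G D x y (setE f a b c) := by
  classical
  have hne := h.ne_zero_ne hab
  obtain ⟨h1, h2, ha⟩ := ha
  obtain ⟨-, -, hb⟩ := hb
  have hba : f b a ≠ 0 := by rw [h.symm]; exact hab
  refine ⟨?_, ?_, ?_, ?_⟩
  · intro u v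
    have := h.symm u v
    unfold setE; grind
  · intro u v
    have := h.range u v
    unfold setE; grind
  · intro u v
    rw [← h.adj]
    unfold setE; grind
  · intro v s t
    have := h.proper v s t
    unfold setE
    by_cases hs : (v = a ∧ s = b) ∨ (v = b ∧ s = a) <;>
    by_cases ht : (v = a ∧ t = b) ∨ (v = b ∧ t = a)
    · grind
    · simp only [if_pos hs, if_neg ht]; grind
    · simp only [if_neg hs, if_pos ht]; grind
    · simp only [if_neg hs, if_neg ht]; exact this

lemma PC.shift {G : SimpleGraph V} {D : ℕ} {x y : V} {f : V → V → ℕ} (h : PC G D x y f)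
    (hxy : G.Adj x y) {z : V} {c : ℕ} (hc : f x z = c) (hc0 : c ≠ 0) (hy : Miss D f y c) :
    PC G D x z (setE (setE f x z 0) x y c) := by
  classical
  have hxz := h.ne_zero_ne (hc ▸ hc0)
  have hxy' := hxy.ne
  have h0 := h.zero
  have h0' := h.flip.zero
  have hzy : z ≠ y := by rintro rfl; exact hc0 (hc ▸ h0)
  obtain ⟨h1, h2, hy⟩ := hy
  refine ⟨?_, ?_, ?_, ?_⟩
  · intro u v
    have := h.symm u v
    unfold setE; grind
  · intro u v
    have := h.range u v
    unfold setE; grind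
  · intro u v
    have e1 := h.adj u v
    have e2 := hxy.symm
    unfold setE
    by_cases h1 : (u = x ∧ v = y) ∨ (u = y ∧ v = x)
    · rw [if_pos h1]
      have : G.Adj u v := by rcases h1 with ⟨rfl, rfl⟩ | ⟨rfl, rfl⟩ <;> assumption
      grind
    · rw [if_neg h1]
      by_cases h3 : (u = x ∧ v = z) ∨ (u = z ∧ v = x)
      · rw [if_pos h3]; grind
      · rw [if_neg h3]; grind
  · intro v s t
    have e1 := h.proper v s t
    have e2 := h.proper x s z
    have e3 := h.proper x z t
    by_cases hs : (v = x ∧ s = y) ∨ (v = y ∧ s = x) <;>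
    by_cases ht : (v = x ∧ t = y) ∨ (v = y ∧ t = x)
    · grind
    · simp only [setE, if_pos hs, if_neg ht]; grind
    · simp only [setE, if_neg hs, if_pos ht]; grind
    · simp only [setE, if_neg hs, if_neg ht]; grind

/-- Kempe swap at a vertex `u` other than `x,y`. -/
lemma PC.kswap {G : SimpleGraph V} {D : ℕ} (hno : ∀ φ, ¬ IsEdgeColoring G D φ)
    {x y : V} {f : V → V → ℕ} (h : PC G D x y f) (hxy : G.Adj x y) {α β : ℕ}
    (hy : Miss D f y α) (hx : Miss D f x β) {u : V} (hux : u ≠ x) (huy : u ≠ y)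
    (hu : Miss D f u β) :
    ∃ f', PC G D x y f' ∧ (∀ w, f' x w = f x w) ∧ (∀ w, f' y w = f y w) ∧
      (∀ c, c ≠ α → c ≠ β → ∀ a b, f' a b = c ↔ f a b = c) ∧
      (∀ w, f u w = α → f' u w = β) ∧ Miss D f' u α := by
  classical
  have hab : α ≠ β := by rintro rfl; exact h.complete hno hxy hx hy
  have ha0 : α ≠ 0 := by have := hy.1; omega
  have hb0 : β ≠ 0 := by have := hx.1; omega
  set K := Kemp f α β u with hK
  have hPC := h.swp ha0 hb0 hy.2.1 hx.2.1 u
  have huK : u ∈ K := mem_kemp_self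
  have hnot : x ∉ K ∧ y ∉ K := by
    by_cases h1 : x ∈ K <;> by_cases h2 : y ∈ K
    · exact (three_ends h ha0 hb0 hux huy hxy.ne (Or.inr hu.2.2) (Or.inr hx.2.2)
        (Or.inl hy.2.2) h1 h2).elim
    · exact (hPC.complete hno hxy (miss_swp_mem_left h1 hx hy.1 hy.2.1)
        ((miss_swp_notMem h2).2 hy)).elim
    · exact (hPC.complete hno hxy ((miss_swp_notMem h1).2 hx)
        (miss_swp_mem_right h2 hy hx.1 hx.2.1)).elim
    · exact ⟨h1, h2⟩
  refine ⟨_, hPC, swp_notMem hnot.1, swp_notMem hnot.2, ?_, ?_, ?_⟩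
  · intro c h1 h2 a b
    exact swp_eq_iff h1 h2
  · intro w hw
    unfold _root_.swp
    rw [if_pos huK, hw, Equiv.swap_apply_left]
  · exact miss_swp_mem_left huK hu hy.1 hy.2.1

/-- Free the color `c = f y v` at `y`. -/
lemma PC.free {G : SimpleGraph V} {D : ℕ} (hno : ∀ φ, ¬ IsEdgeColoring G D φ)
    {x y : V} {f : V → V → ℕ} (h : PC G D x y f) (hxy : G.Adj x y) {γ γ' c : ℕ}
    (hy : Miss D f y γ) (hx : Miss D f x γ') {v : V} (hvx : v ≠ x) (hv : Miss D f v γ')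
    (hc : f y v = c) (hc0 : c ≠ 0) :
    ∃ f', PC G D x y f' ∧ (∀ w, f' x w = f x w) ∧ f' y v = γ ∧
      (∀ w, w ≠ v → f' y w = f y w) ∧ Miss D f' y c ∧
      (∀ e, e ≠ γ → e ≠ γ' → ∀ a b, ¬ (a = y ∧ b = v) → ¬ (a = v ∧ b = y) →
        (f' a b = e ↔ f a b = e)) := by
  have hyv : y ≠ v := h.ne_zero_ne (hc ▸ hc0)
  obtain ⟨g, hg, g1, g2, g3, g4, g5⟩ := h.kswap hno hxy hy hx hvx hyv.symm hv
  have hgy : Miss D g y γ := ⟨hy.1, hy.2.1, fun w => by rw [g2]; exact hy.2.2 w⟩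
  have hgc : g y v ≠ 0 := by rw [g2, hc]; exact hc0
  have hrow : ∀ w, w ≠ v → setE g y v γ y w = f y w := by
    intro w hw
    rw [setE_other (by tauto) (by tauto), g2]
  refine ⟨setE g y v γ, hg.recolor hgc hgy g5, ?_, setE_same, hrow, ?_, ?_⟩
  · intro w
    rw [setE_other (by rintro ⟨rfl, -⟩; exact hxy.ne rfl) (by rintro ⟨rfl, -⟩; exact hvx rfl), g1]
  · refine ⟨by omega, by rw [← hc]; exact h.range _ _, fun w hw => ?_⟩
    by_cases hwv : w = v
    · subst hwv
      rw [setE_same] at hw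
      exact hy.2.2 w (by rw [hw, hc])
    · rw [hrow w hwv] at hw
      exact hwv (h.proper y w v (by rw [hw, hc]) (by rw [hw]; exact hc0))
  · intro e h1 h2 a b h3 h4
    rw [setE_other h3 h4]
    exact g3 e h1 h2 a b

section helpers

variable (G : SimpleGraph V) [DecidableRel G.Adj]

open Classical in
lemma card_image_row {D : ℕ} {x y : V} {f : V → V → ℕ} (h : PC G D x y f) (hxy : G.Adj x y) :
    (((G.neighborFinset x).erase y).image (f x)).card + 1 = G.degree x := by
  rw [Finset.card_image_of_injOn]
  · rw [← SimpleGraph.card_neighborFinset_eq_degree]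
    exact Finset.card_erase_add_one (by simpa using hxy)
  · intro a ha b hb hab
    have : G.Adj x a ∧ a ≠ y := by simpa using ha
    exact h.proper x a b hab ((h.adj x a).2 (by have := hxy.ne; tauto))

open Classical in
lemma mem_image_row {D : ℕ} {x y : V} {f : V → V → ℕ} (h : PC G D x y f)
    {c : ℕ} (hc : 1 ≤ c) (hcD : c ≤ D) (hn : c ∉ ((G.neighborFinset x).erase y).image (f x)) :
    Miss D f x c := by
  refine ⟨hc, hcD, fun w hw => hn ?_⟩
  rw [Finset.mem_image]
  have := (h.adj x w).1 (by omega)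
  exact ⟨w, by simp; tauto, hw⟩

open Classical in
lemma mem_image_row' {D : ℕ} {x y v : V} {f : V → V → ℕ} (h : PC G D x y f)
    {c : ℕ} (hc : 1 ≤ c) (hcD : c ≤ D) (hn : c ∉ (G.neighborFinset v).image (f v)) :
    Miss D f v c := by
  refine ⟨hc, hcD, fun w hw => hn ?_⟩
  rw [Finset.mem_image]
  have := (h.adj v w).1 (by omega)
  exact ⟨w, by simp; tauto, hw⟩

lemma exists_miss_end {D : ℕ} {x y : V} {f : V → V → ℕ} (h : PC G D x y f) (hxy : G.Adj x y)
    (hD : G.degree x ≤ D) : ∃ c, Miss D f x c := by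
  classical
  by_contra hcon
  push Not at hcon
  have hsub : Finset.Icc 1 D ⊆ ((G.neighborFinset x).erase y).image (f x) := by
    intro c hc
    rw [Finset.mem_Icc] at hc
    by_contra hn
    exact hcon c (mem_image_row G h hc.1 hc.2 hn)
  have := Finset.card_le_card hsub
  have h2 := card_image_row G h hxy
  rw [Nat.card_Icc] at this
  omega

lemma exists_common {D : ℕ} {x y v : V} {f : V → V → ℕ} (h : PC G D x y f) (hxy : G.Adj x y)
    (hv : G.degree v + G.degree x < D) (δ : ℕ) :
    ∃ c, c ≠ δ ∧ Miss D f x c ∧ Miss D f v c := by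
  classical
  by_contra hcon
  push Not at hcon
  have hsub : Finset.Icc 1 D ⊆ ((G.neighborFinset x).erase y).image (f x) ∪
      ((G.neighborFinset v).image (f v) ∪ {δ}) := by
    intro c hc
    rw [Finset.mem_Icc] at hc
    by_contra hn
    simp only [Finset.mem_union, not_or, Finset.mem_singleton] at hn
    exact hcon c hn.2.2 (mem_image_row G h hc.1 hc.2 hn.1) (mem_image_row' G h hc.1 hc.2 hn.2.1)
  have h1 := Finset.card_le_card hsub
  have h2 := card_image_row G h hxy
  have h3 : ((G.neighborFinset v).image (f v)).card ≤ G.degree v := by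
    rw [← SimpleGraph.card_neighborFinset_eq_degree]; exact Finset.card_image_le
  have h4 := Finset.card_union_le (((G.neighborFinset x).erase y).image (f x))
    ((G.neighborFinset v).image (f v) ∪ {δ})
  have h5 := Finset.card_union_le ((G.neighborFinset v).image (f v)) {δ}
  rw [Nat.card_Icc] at h1
  rw [Finset.card_singleton] at h5
  omega

/-- `c` is missing at `y` or is the color of an edge from `y` to `S`. -/
def Ahat (D : ℕ) (S : Set V) (f : V → V → ℕ) (y : V) (c : ℕ) : Prop :=
  Miss D f y c ∨ ∃ v ∈ S, f y v = c

/-- standing assumptions on the set of small vertices -/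
def SmallSet (D : ℕ) (x : V) (S : Set V) : Prop :=
  ∀ v ∈ S, v ≠ x ∧ ¬ G.Adj x v ∧ G.degree v + G.degree x < D

section E
variable {G} {D : ℕ} {x : V} {S : Set V}

lemma E0 (hno : ∀ φ, ¬ IsEdgeColoring G D φ)
    (hdeg : ∀ v, G.degree v ≤ D) (hS : SmallSet G D x S) {y : V} {f : V → V → ℕ} (h : PC G D x y f) (hxy : G.Adj x y) {v : V} (hv : v ∈ S)
    {c : ℕ} (hc : f y v = c) (hx : Miss D f x c) : False := by
  obtain ⟨γ, hγ⟩ := exists_miss_end G h.flip hxy.symm (hdeg y)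
  obtain ⟨γ', -, h1, h2⟩ := exists_common G h hxy (hS v hv).2.2 0
  obtain ⟨f', p1, p2, p3, p4, p5, p6⟩ := h.free hno hxy hγ h1 (hS v hv).1 h2 hc
    (by have := hx.1; omega)
  exact p1.complete hno hxy ⟨hx.1, hx.2.1, fun w => by rw [p2]; exact hx.2.2 w⟩ p5

lemma E1a (hno : ∀ φ, ¬ IsEdgeColoring G D φ)
    (hdeg : ∀ v, G.degree v ≤ D) (hS : SmallSet G D x S) {y : V} {f : V → V → ℕ} (h : PC G D x y f) (hxy : G.Adj x y) {z : V}
    (hxz : G.Adj x z) (hzy : z ≠ y) {c : ℕ} (hc : f x z = c) (hcy : Miss D f y c)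
    {u : V} (hu : u ∈ S) {δ : ℕ} (hδ : f z u = δ) (hx : Miss D f x δ) : False := by
  have hc0 : c ≠ 0 := by have := hcy.1; omega
  have hux := (hS u hu).1
  have hzx := hxz.ne
  have hyx := hxy.ne
  have h' := h.shift hxy hc hc0 hcy
  refine E0 hno hdeg hS h' hxz hu (c := δ) ?_ ⟨hx.1, hx.2.1, fun w => ?_⟩
  · rw [setE_other (by tauto) (by tauto), setE_other (by tauto) (by tauto), hδ]
  · by_cases hwy : w = y
    · subst hwy
      rw [setE_same]
      rintro rfl
      exact hx.2.2 z hc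
    · rw [setE_other (by tauto) (by tauto)]
      by_cases hwz : w = z
      · subst hwz
        rw [setE_same]; have := hx.1; omega
      · rw [setE_other (by tauto) (by tauto)]; exact hx.2.2 w

/-- Free `c` at `y`, keeping everything relevant. -/
lemma FR (hno : ∀ φ, ¬ IsEdgeColoring G D φ)
    (hdeg : ∀ v, G.degree v ≤ D) (hS : SmallSet G D x S) {y : V} {f : V → V → ℕ} (h : PC G D x y f) (hxy : G.Adj x y) {v : V} (hv : v ∈ S)
    {c : ℕ} (hc : f y v = c) (hc0 : c ≠ 0) {γ : ℕ} (hγ : Miss D f y γ) (δ : ℕ) :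
    ∃ f' γ', PC G D x y f' ∧ γ' ≠ δ ∧ Miss D f x γ' ∧ (∀ w, f' x w = f x w) ∧
      f' y v = γ ∧ Miss D f' y c ∧ (∀ e, Ahat D S f y e → Ahat D S f' y e) ∧
      (∀ z e, G.Adj x z → z ≠ y → e ≠ γ → e ≠ γ' → ∀ w, f' z w = e ↔ f z w = e) := by
  obtain ⟨hvx, hvn, hvd⟩ := hS v hv
  obtain ⟨γ', h0, h1, h2⟩ := exists_common G h hxy hvd δ
  obtain ⟨f', p1, p2, p3, p4, p5, p6⟩ := h.free hno hxy hγ h1 hvx h2 hc hc0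
  refine ⟨f', γ', p1, h0, h1, p2, p3, p5, ?_, ?_⟩
  · rintro e (he | ⟨u, hu, he⟩)
    · by_cases heγ : e = γ
      · exact Or.inr ⟨v, hv, by rw [p3, heγ]⟩
      · refine Or.inl ⟨he.1, he.2.1, fun w => ?_⟩
        by_cases hw : w = v
        · rw [hw, p3]; exact fun h => heγ h.symm
        · rw [p4 w hw]; exact he.2.2 w
    · by_cases huv : u = v
      · left; rw [← he, huv, hc]; exact p5
      · exact Or.inr ⟨u, hu, by rw [p4 u huv, he]⟩
  · intro z e hz hzy he he' w
    refine p6 e he he' z w (by tauto) ?_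
    rintro ⟨rfl, -⟩
    exact hvn hz

lemma E1 (hno : ∀ φ, ¬ IsEdgeColoring G D φ)
    (hdeg : ∀ v, G.degree v ≤ D) (hS : SmallSet G D x S) {y : V} {f : V → V → ℕ} (h : PC G D x y f) (hxy : G.Adj x y) {z : V}
    (hxz : G.Adj x z) (hzy : z ≠ y) (hcy : Ahat D S f y (f x z))
    {u : V} (hu : u ∈ S) {δ : ℕ} (hδ : f z u = δ) (hx : Miss D f x δ) : False := by
  have hc0 : f x z ≠ 0 := (h.adj x z).2 (by have := hxy.ne; tauto)
  rcases hcy with hcy | ⟨v, hv, hcy⟩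
  · exact E1a hno hdeg hS h hxy hxz hzy rfl hcy hu hδ hx
  · obtain ⟨γ, hγ⟩ := exists_miss_end G h.flip hxy.symm (hdeg y)
    obtain ⟨f', γ', q1, q2, q3, q4, q5, q6, q7, q8⟩ := FR hno hdeg hS h hxy hv hcy hc0 hγ δ
    have hγδ : δ ≠ γ := by rintro rfl; exact h.complete hno hxy hx hγ
    exact E1a hno hdeg hS q1 hxy hxz hzy (q4 z) q6 hu ((q8 z δ hxz hzy hγδ q2.symm u).2 hδ)
      ⟨hx.1, hx.2.1, fun w => by rw [q4]; exact hx.2.2 w⟩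

lemma E2a (hno : ∀ φ, ¬ IsEdgeColoring G D φ)
    (hdeg : ∀ v, G.degree v ≤ D) (hS : SmallSet G D x S) {y : V} {f : V → V → ℕ} (h : PC G D x y f) (hxy : G.Adj x y) {z : V}
    (hxz : G.Adj x z) (hzy : z ≠ y) (hcy : Ahat D S f y (f x z))
    {u : V} (hu : u ∈ S) {e : ℕ} (he : f z u = e) (hey : Miss D f y e) : False := by
  obtain ⟨hux, hun, hud⟩ := hS u hu
  obtain ⟨δ, -, h1, h2⟩ := exists_common G h hxy hud 0
  have huy : u ≠ y := by rintro rfl; exact hun hxy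
  obtain ⟨f', p1, p2, p3, p4, p5, p6⟩ := h.kswap hno hxy hey h1 hux huy h2
  refine E1 hno hdeg hS p1 hxy hxz hzy ?_ hu (δ := δ) ?_ ?_
  · rw [p2]
    rcases hcy with hcy | ⟨v, hv, hcy⟩
    · exact Or.inl ⟨hcy.1, hcy.2.1, fun w => by rw [p3]; exact hcy.2.2 w⟩
    · exact Or.inr ⟨v, hv, by rw [p3]; exact hcy⟩
  · rw [p1.symm, p5 z (by rw [h.symm]; exact he)]
  · exact ⟨h1.1, h1.2.1, fun w => by rw [p2]; exact h1.2.2 w⟩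

lemma E2 (hno : ∀ φ, ¬ IsEdgeColoring G D φ)
    (hdeg : ∀ v, G.degree v ≤ D) (hS : SmallSet G D x S) {y : V} {f : V → V → ℕ} (h : PC G D x y f) (hxy : G.Adj x y) {z : V}
    (hxz : G.Adj x z) (hzy : z ≠ y) (hcy : Ahat D S f y (f x z))
    {u : V} (hu : u ∈ S) {e : ℕ} (he0 : e ≠ 0) (he : f z u = e) (hey : Ahat D S f y e) :
    False := by
  rcases hey with hey | ⟨v, hv, hey⟩
  · exact E2a hno hdeg hS h hxy hxz hzy hcy hu he hey
  · obtain ⟨γ, hγ⟩ := exists_miss_end G h.flip hxy.symm (hdeg y)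
    obtain ⟨f', γ', q1, q2, q3, q4, q5, q6, q7, q8⟩ := FR hno hdeg hS h hxy hv hey he0 hγ 0
    refine E2a hno hdeg hS q1 hxy hxz hzy (by rw [q4]; exact q7 _ hcy) hu
      ((q8 z e hxz hzy ?_ ?_ u).2 he) q6
    · rintro rfl; exact hγ.2.2 v hey
    · rintro rfl; exact E0 hno hdeg hS h hxy hv hey q3

lemma E3a (hno : ∀ φ, ¬ IsEdgeColoring G D φ)
    (hdeg : ∀ v, G.degree v ≤ D) (hS : SmallSet G D x S) {y : V} {f : V → V → ℕ} (h : PC G D x y f) (hxy : G.Adj x y) {z₁ z₂ : V}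
    (hxz₁ : G.Adj x z₁) (hzy₁ : z₁ ≠ y) (hcy₁ : Miss D f y (f x z₁))
    (hxz₂ : G.Adj x z₂) (hzy₂ : z₂ ≠ y) (hcy₂ : Ahat D S f y (f x z₂)) (hzz : z₁ ≠ z₂)
    {u₁ u₂ : V} (hu₁ : u₁ ∈ S) (hu₂ : u₂ ∈ S) {e : ℕ} (he0 : e ≠ 0) (he₁ : f z₁ u₁ = e)
    (he₂ : f z₂ u₂ = e) : False := by
  have hxe : ¬ Miss D f x e := fun hx =>
    E1 hno hdeg hS h hxy hxz₂ hzy₂ hcy₂ hu₂ he₂ hx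
  obtain ⟨hux₁, hun₁, hud₁⟩ := hS u₁ hu₁
  obtain ⟨hux₂, hun₂, hud₂⟩ := hS u₂ hu₂
  have hyx := hxy.ne
  have hzx₁ := hxz₁.ne
  have hzx₂ := hxz₂.ne
  obtain ⟨c₁, hc₁⟩ : ∃ c, f x z₁ = c := ⟨_, rfl⟩
  obtain ⟨c₂, hc₂⟩ : ∃ c, f x z₂ = c := ⟨_, rfl⟩
  rw [hc₁] at hcy₁
  rw [hc₂] at hcy₂
  have hc₁0 : c₁ ≠ 0 := by have := hcy₁.1; omega
  have hc₂0 : c₂ ≠ 0 := by rw [← hc₂]; exact (h.adj x z₂).2 (by tauto)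
  have hcc : c₁ ≠ c₂ := by
    rintro rfl
    exact hzz (h.proper x z₁ z₂ (by rw [hc₁, hc₂]) (by rw [hc₁]; exact hc₁0))
  have hec₁ : e ≠ c₁ := by
    rintro rfl
    exact hux₁ (h.proper z₁ u₁ x (by rw [he₁, h.symm, hc₁]) (by rw [he₁]; exact he0))
  have hec₂ : e ≠ c₂ := by
    rintro rfl
    exact hux₂ (h.proper z₂ u₂ x (by rw [he₂, h.symm, hc₂]) (by rw [he₂]; exact he0))
  -- move to z₁
  have h2 := h.shift hxy hc₁ hc₁0 hcy₁
  generalize hf2 : setE (setE f x z₁ 0) x y c₁ = f2 at h2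
  have f2xy : f2 x y = c₁ := by rw [← hf2, setE_same]
  have f2x0 : f2 x z₁ = 0 := h2.zero
  have f2x : ∀ w, w ≠ y → w ≠ z₁ → f2 x w = f x w := by
    intro w h1 h3
    rw [← hf2, setE_other (by tauto) (by tauto), setE_other (by tauto) (by tauto)]
  have f2o : ∀ a w, a ≠ x → w ≠ x → f2 a w = f a w := by
    intro a w h1 h3
    rw [← hf2, setE_other (by tauto) (by tauto), setE_other (by tauto) (by tauto)]
  have m2 : Miss D f2 z₁ c₁ := by
    refine ⟨hcy₁.1, hcy₁.2.1, fun w hw => ?_⟩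
    by_cases hwx : w = x
    · rw [hwx, h2.symm, f2x0] at hw; exact hc₁0 hw.symm
    · rw [f2o z₁ w hzx₁.symm hwx] at hw
      exact hwx (h.proper z₁ w x (by rw [hw, h.symm, hc₁]) (by rw [hw]; exact hc₁0))
  have mx2 : ∀ t, Miss D f2 x t → Miss D f x t := by
    intro t ht
    refine ⟨ht.1, ht.2.1, fun w hw => ?_⟩
    have ht0 : t ≠ 0 := by have := ht.1; omega
    by_cases hwy : w = y
    · rw [hwy, h.zero] at hw; exact ht0 hw.symm
    by_cases hwz : w = z₁
    · rw [hwz, hc₁] at hw; exact ht.2.2 y (by rw [f2xy, hw])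
    · exact ht.2.2 w (by rw [f2x w hwy hwz, hw])
  have a2 : Ahat D S f2 y c₂ := by
    rcases hcy₂ with hh | ⟨v, hv, hh⟩
    · refine Or.inl ⟨hh.1, hh.2.1, fun w hw => ?_⟩
      by_cases hwx : w = x
      · rw [hwx, h2.symm, f2xy] at hw; exact hcc hw
      · rw [f2o y w hyx.symm hwx] at hw; exact hh.2.2 w hw
    · exact Or.inr ⟨v, hv, by rw [f2o y v hyx.symm (hS v hv).1, hh]⟩
  have e21 : f2 z₁ u₁ = e := by rw [f2o z₁ u₁ hzx₁.symm hux₁, he₁]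
  have e22 : f2 z₂ u₂ = e := by rw [f2o z₂ u₂ hzx₂.symm hux₂, he₂]
  have x2 : f2 x z₂ = c₂ := by rw [f2x z₂ hzy₂ hzz.symm, hc₂]
  -- transfer of `Ahat`
  have trans : ∀ (F F' : V → V → ℕ), (∀ w, F' y w = c₂ ↔ F y w = c₂) →
      Ahat D S F y c₂ → Ahat D S F' y c₂ := by
    rintro F F' hF (hh | ⟨v, hv, hh⟩)
    · exact Or.inl ⟨hh.1, hh.2.1, fun w hw => hh.2.2 w ((hF w).1 hw)⟩
    · exact Or.inr ⟨v, hv, (hF v).2 hh⟩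
  -- free e at z₁
  obtain ⟨f3, γ3, h3, -, q3, r3, s3, t3, -, o3⟩ := FR hno hdeg hS h2 hxz₁ hu₁ e21 he0 m2 0
  have c2γ3 : c₂ ≠ γ3 := by rintro rfl; exact q3.2.2 z₂ x2
  have a3 : Ahat D S f3 y c₂ :=
    trans f2 f3 (o3 y c₂ hxy hzy₁.symm hcc.symm c2γ3) a2
  have e3 : f3 z₂ u₂ = e := (o3 z₂ e hxz₂ hzz.symm hec₁
    (by rintro rfl; exact hxe (mx2 _ q3)) u₂).2 e22
  -- swap at u₂
  obtain ⟨δ, -, d1, d2⟩ := exists_common G h3 hxz₁ hud₂ 0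
  have huz : u₂ ≠ z₁ := by rintro rfl; exact hun₂ hxz₁
  obtain ⟨f4, h4, r4, r4', o4, s4, -⟩ := h3.kswap hno hxz₁ t3 d1 hux₂ huz d2
  have hδe : δ ≠ e := by
    rintro rfl; exact h3.complete hno hxz₁ d1 t3
  have x3 : f3 x z₂ = c₂ := by rw [r3, x2]
  have c2δ : c₂ ≠ δ := by rintro rfl; exact d1.2.2 z₂ x3
  have a4 : Ahat D S f4 y c₂ := trans f3 f4 (o4 c₂ hec₂.symm c2δ y) a3
  have e4 : f4 z₂ u₂ = δ := by rw [h4.symm, s4 z₂ (by rw [h3.symm]; exact e3)]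
  have g4 : f4 z₁ u₁ = c₁ := by rw [r4', s3]
  have t4 : Miss D f4 z₁ e := ⟨t3.1, t3.2.1, fun w => by rw [r4']; exact t3.2.2 w⟩
  have d4 : Miss D f4 x δ := ⟨d1.1, d1.2.1, fun w => by rw [r4]; exact d1.2.2 w⟩
  have x4 : f4 x z₂ = c₂ := by rw [r4, x3]
  -- free c₁ at z₁
  obtain ⟨f5, γ5, h5, n5, q5, r5, s5, t5, -, o5⟩ := FR hno hdeg hS h4 hxz₁ hu₁ g4 hc₁0 t4 δ
  have c2γ5 : c₂ ≠ γ5 := by rintro rfl; exact q5.2.2 z₂ x4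
  have a5 : Ahat D S f5 y c₂ := trans f4 f5 (o5 y c₂ hxy hzy₁.symm hec₂.symm c2γ5) a4
  have e5 : f5 z₂ u₂ = δ := (o5 z₂ δ hxz₂ hzz.symm hδe n5.symm u₂).2 e4
  have y5 : f5 x y = c₁ := by rw [r5, r4, r3, f2xy]
  have d5 : Miss D f5 x δ := ⟨d4.1, d4.2.1, fun w => by rw [r5]; exact d4.2.2 w⟩
  have x5 : f5 x z₂ = c₂ := by rw [r5, x4]
  -- shift back
  have h6 := h5.shift hxz₁ y5 hc₁0 t5
  generalize hf6 : setE (setE f5 x y 0) x z₁ c₁ = f6 at h6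
  have f6x : ∀ w, w ≠ y → w ≠ z₁ → f6 x w = f5 x w := by
    intro w h1 h3
    rw [← hf6, setE_other (by tauto) (by tauto), setE_other (by tauto) (by tauto)]
  have f6o : ∀ a w, a ≠ x → w ≠ x → f6 a w = f5 a w := by
    intro a w h1 h3
    rw [← hf6, setE_other (by tauto) (by tauto), setE_other (by tauto) (by tauto)]
  have x6 : f6 x z₂ = c₂ := by rw [f6x z₂ hzy₂ hzz.symm, x5]
  have a6 : Ahat D S f6 y c₂ := by
    refine trans f5 f6 (fun w => ?_) a5
    by_cases hwx : w = x
    · rw [hwx, h6.symm, h6.zero, h5.symm, y5]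
      constructor
      · intro hh; exact absurd hh.symm hc₂0
      · intro hh; exact absurd hh hcc
    · rw [f6o y w hyx.symm hwx]
  have e6 : f6 z₂ u₂ = δ := by rw [f6o z₂ u₂ hzx₂.symm hux₂, e5]
  refine E1 hno hdeg hS h6 hxy hxz₂ hzy₂ (by rw [x6]; exact a6) hu₂ e6
    ⟨d5.1, d5.2.1, fun w hw => ?_⟩
  have hδ0 : δ ≠ 0 := by have := d5.1; omega
  by_cases hwy : w = y
  · rw [hwy, h6.zero] at hw; exact hδ0 hw.symm
  by_cases hwz : w = z₁
  · rw [hwz, ← hf6, setE_same] at hw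
    exact d5.2.2 y (by rw [y5, hw])
  · rw [f6x w hwy hwz] at hw; exact d5.2.2 w hw

lemma E3 (hno : ∀ φ, ¬ IsEdgeColoring G D φ)
    (hdeg : ∀ v, G.degree v ≤ D) (hS : SmallSet G D x S) {y : V} {f : V → V → ℕ} (h : PC G D x y f) (hxy : G.Adj x y) {z₁ z₂ : V}
    (hxz₁ : G.Adj x z₁) (hzy₁ : z₁ ≠ y) (hcy₁ : Ahat D S f y (f x z₁))
    (hxz₂ : G.Adj x z₂) (hzy₂ : z₂ ≠ y) (hcy₂ : Ahat D S f y (f x z₂)) (hzz : z₁ ≠ z₂)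
    {u₁ u₂ : V} (hu₁ : u₁ ∈ S) (hu₂ : u₂ ∈ S) {e : ℕ} (he0 : e ≠ 0) (he₁ : f z₁ u₁ = e)
    (he₂ : f z₂ u₂ = e) : False := by
  have hc0 : f x z₁ ≠ 0 := (h.adj x z₁).2 (by have := hxy.ne; tauto)
  rcases hcy₁ with hcy | ⟨v, hv, hcy⟩
  · exact E3a hno hdeg hS h hxy hxz₁ hzy₁ hcy hxz₂ hzy₂ hcy₂ hzz hu₁ hu₂ he0 he₁ he₂
  · obtain ⟨γ, hγ⟩ := exists_miss_end G h.flip hxy.symm (hdeg y)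
    obtain ⟨f', γ', q1, q2, q3, q4, q5, q6, q7, q8⟩ := FR hno hdeg hS h hxy hv hcy hc0 hγ 0
    have hγe : e ≠ γ := by
      rintro rfl
      exact E2 hno hdeg hS h hxy hxz₂ hzy₂ hcy₂ hu₂ he0 he₂ (Or.inl hγ)
    have hγe' : e ≠ γ' := by
      rintro rfl
      exact E1 hno hdeg hS h hxy hxz₂ hzy₂ hcy₂ hu₂ he₂ q3
    exact E3a hno hdeg hS q1 hxy hxz₁ hzy₁ (by rw [q4]; exact q6) hxz₂ hzy₂
      (by rw [q4]; exact q7 _ hcy₂) hzz hu₁ hu₂ he0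
      ((q8 z₁ e hxz₁ hzy₁ hγe hγe' u₁).2 he₁) ((q8 z₂ e hxz₂ hzy₂ hγe hγe' u₂).2 he₂)

open Classical in
/-- Counting consequence. -/
lemma count_main (hno : ∀ φ, ¬ IsEdgeColoring G D φ)
    (hdeg : ∀ v, G.degree v ≤ D) (hS : SmallSet G D x S) {y : V} {f : V → V → ℕ} (h : PC G D x y f) (hxy : G.Adj x y)
    (S' : Finset V) (hS' : ∀ v, v ∈ S' ↔ v ∈ S) :
    ∃ Z ⊆ (G.neighborFinset x).erase y, Z.card = (G.neighborFinset y ∩ S').card + 1 ∧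
      ∑ z ∈ Z, ((G.neighborFinset z ∩ S').card + 1) + 1 ≤ G.degree x := by
  obtain ⟨γ, hγ⟩ := exists_miss_end G h.flip hxy.symm (hdeg y)
  set P := ((G.neighborFinset x).erase y).image (f x) with hP
  have hPc : P.card + 1 = G.degree x := card_image_row G h hxy
  let AF : V → Finset ℕ := fun z => (G.neighborFinset z ∩ S').image (f z)
  have hnz : ∀ z v, G.Adj x z → G.Adj z v → v ∈ S' → f z v ≠ 0 := by
    intro z v hz hzv hv
    refine (h.adj z v).2 ⟨hzv, ?_, ?_⟩
    · rintro ⟨rfl, -⟩; exact hz.ne rfl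
    · rintro ⟨-, rfl⟩; exact (hS v ((hS' v).1 hv)).1 rfl
  have hAFc : ∀ z, G.Adj x z → (AF z).card = (G.neighborFinset z ∩ S').card := by
    intro z hz
    apply Finset.card_image_of_injOn
    intro a ha b hb hab
    have ha : G.Adj z a ∧ a ∈ S' := by simpa using ha
    exact h.proper z a b hab (hnz z a hz ha.1 ha.2)
  have hAFm : ∀ z c, G.Adj x z → c ∈ AF z → c ≠ 0 ∧ ∃ v ∈ S, f z v = c := by
    intro z c hz hc
    simp only [AF, Finset.mem_image, Finset.mem_inter, SimpleGraph.mem_neighborFinset] at hc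
    obtain ⟨v, ⟨h1, h2⟩, rfl⟩ := hc
    exact ⟨hnz z v hz h1 h2, v, (hS' v).1 h2, rfl⟩
  set A := insert γ (AF y) with hA
  have hγA : γ ∉ AF y := by
    intro hc
    obtain ⟨-, v, -, hv⟩ := hAFm y γ hxy hc
    exact hγ.2.2 v hv
  have hAc : A.card = (G.neighborFinset y ∩ S').card + 1 := by
    rw [hA, Finset.card_insert_of_notMem hγA, hAFc y hxy]
  have hAhat : ∀ c ∈ A, Ahat D S f y c := by
    intro c hc
    rcases Finset.mem_insert.1 hc with rfl | hc
    · exact Or.inl hγ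
    · exact Or.inr (hAFm y c hxy hc).2
  have hPm : ∀ c, 1 ≤ c → c ≤ D → ¬ Miss D f x c → c ∈ P := by
    intro c h1 h2 h3
    by_contra hn
    exact h3 (mem_image_row G h h1 h2 hn)
  have hAP : A ⊆ P := by
    intro c hc
    rcases Finset.mem_insert.1 hc with rfl | hc
    · exact hPm _ hγ.1 hγ.2.1 (fun hx => h.complete hno hxy hx hγ)
    · obtain ⟨h0, v, hv, hvc⟩ := hAFm y c hxy hc
      refine hPm c (by omega) (by rw [← hvc]; exact h.range _ _) (fun hx => ?_)
      exact E0 hno hdeg hS h hxy hv hvc hx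
  let Z := ((G.neighborFinset x).erase y).filter (fun z => f x z ∈ A)
  have hZm : ∀ z ∈ Z, G.Adj x z ∧ z ≠ y ∧ Ahat D S f y (f x z) := by
    intro z hz
    simp only [Z, Finset.mem_filter, Finset.mem_erase, SimpleGraph.mem_neighborFinset] at hz
    exact ⟨hz.1.2, hz.1.1, hAhat _ hz.2⟩
  have hZA : Z.image (f x) = A := by
    ext c
    constructor
    · intro hc
      obtain ⟨z, hz, rfl⟩ := Finset.mem_image.1 hc
      exact (Finset.mem_filter.1 hz).2
    · intro hc
      obtain ⟨z, hz, rfl⟩ := Finset.mem_image.1 (hAP hc)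
      exact Finset.mem_image.2 ⟨z, Finset.mem_filter.2 ⟨hz, hc⟩, rfl⟩
  have hZc : Z.card = A.card := by
    rw [← hZA, Finset.card_image_of_injOn]
    intro a ha b hb hab
    have := hZm a ha
    exact h.proper x a b hab ((h.adj x a).2 (by have := hxy.ne; tauto))
  refine ⟨Z, Finset.filter_subset _ _, by rw [hZc, hAc], ?_⟩
  have hdisj : (Z : Set V).PairwiseDisjoint AF := by
    intro z₁ hz₁ z₂ hz₂ hne
    rw [Function.onFun, Finset.disjoint_left]
    intro e he₁ he₂
    obtain ⟨a1, a2, a3⟩ := hZm z₁ hz₁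
    obtain ⟨b1, b2, b3⟩ := hZm z₂ hz₂
    obtain ⟨h0, u₁, hu₁, e1⟩ := hAFm z₁ e a1 he₁
    obtain ⟨-, u₂, hu₂, e2⟩ := hAFm z₂ e b1 he₂
    exact E3 hno hdeg hS h hxy a1 a2 a3 b1 b2 b3 hne hu₁ hu₂ h0 e1 e2
  have hU : Z.biUnion AF ⊆ P \ A := by
    intro e he
    obtain ⟨z, hz, he⟩ := Finset.mem_biUnion.1 he
    obtain ⟨a1, a2, a3⟩ := hZm z hz
    obtain ⟨h0, u, hu, e1⟩ := hAFm z e a1 he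
    rw [Finset.mem_sdiff]
    refine ⟨hPm e (by omega) (by rw [← e1]; exact h.range _ _) (fun hx => ?_), fun hc => ?_⟩
    · exact E1 hno hdeg hS h hxy a1 a2 a3 hu e1 hx
    · exact E2 hno hdeg hS h hxy a1 a2 a3 hu h0 e1 (hAhat e hc)
  have hc1 := Finset.card_le_card hU
  rw [Finset.card_biUnion hdisj, Finset.card_sdiff_of_subset hAP] at hc1
  have hc2 := Finset.card_le_card hAP
  have hs : ∑ z ∈ Z, (AF z).card = ∑ z ∈ Z, (G.neighborFinset z ∩ S').card :=
    Finset.sum_congr rfl (fun z hz => hAFc z (hZm z hz).1)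
  rw [Finset.sum_add_distrib, ← hs]
  simp only [Finset.sum_const, smul_eq_mul, mul_one]
  omega

end E

/-- Vizing fan vertices at `z` starting with the uncolored edge `zx`. -/
inductive Fan (D : ℕ) (f : V → V → ℕ) (z x : V) : ℕ → V → Prop
  | zero : Fan D f z x 0 x
  | succ {n : ℕ} {v v' : V} : Fan D f z x n v → f z v' ≠ 0 → Miss D f v (f z v') →
      Fan D f z x (n + 1) v'

section VAL
variable {G}

lemma Fan.ne {D : ℕ} {f : V → V → ℕ} {z x : V} (h : PC G D z x f) (hzx : G.Adj z x)
    {n : ℕ} {v : V} (hv : Fan D f z x n v) : v ≠ z := by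
  cases hv with
  | zero => exact hzx.ne.symm
  | succ h1 h2 h3 => exact (h.ne_zero_ne h2).symm

lemma fan1 {D : ℕ} (hno : ∀ φ, ¬ IsEdgeColoring G D φ) {z x : V} (hzx : G.Adj z x) :
    ∀ (n : ℕ) (f : V → V → ℕ), PC G D z x f → ∀ v α, Fan D f z x n v → Miss D f v α →
      Miss D f z α → False := by
  intro n
  induction n using Nat.strong_induction_on with
  | _ n ih =>
  intro f h v α hv hva hza
  cases hv with
  | zero => exact h.complete hno hzx hza hva
  | @succ m v0 _ h1 h2 h3 =>
    have hzv := h.ne_zero_ne h2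
    have hf' := h.recolor h2 hza hva
    have key : ∀ j w, Fan D f z x j w → j ≤ m → Fan D (setE f z v α) z x j w := by
      intro j w hw
      induction hw with
      | zero => intro _; exact Fan.zero
      | @succ j w0 w g1 g2 g3 ihj =>
        intro hj
        have hwv : w ≠ v := by
          rintro rfl
          exact ih (j + 1) (by omega) f h w α (Fan.succ g1 g2 g3) hva hza
        have hw0v : w0 ≠ v := by
          rintro rfl
          exact ih j (by omega) f h w0 α g1 hva hza
        have hw0z := g1.ne h hzx
        have e1 : setE f z v α z w = f z w := setE_other (by tauto) (by tauto)
        refine Fan.succ (ihj (by omega)) (by rw [e1]; exact g2) ?_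
        rw [e1]
        refine ⟨g3.1, g3.2.1, fun t => ?_⟩
        rw [setE_other (by tauto) (by tauto)]
        exact g3.2.2 t
    have hv0v : v0 ≠ v := by
      rintro rfl
      exact ih m (by omega) f h v0 α h1 hva hza
    have hv0z := h1.ne h hzx
    refine ih m (by omega) _ hf' v0 (f z v) (key m v0 h1 le_rfl) ⟨h3.1, h3.2.1, fun t => ?_⟩
      ⟨h3.1, h3.2.1, fun t => ?_⟩
    · rw [setE_other (by tauto) (by tauto)]
      exact h3.2.2 t
    · by_cases ht : t = v
      · subst ht
        rw [setE_same]
        exact (hza.2.2 t).symm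
      · rw [setE_other (by tauto) (by tauto)]
        intro he
        exact ht (h.proper z t v he (by rw [he]; exact h2))

lemma fan2a {D : ℕ} (hno : ∀ φ, ¬ IsEdgeColoring G D φ) {z x : V} (hzx : G.Adj z x)
    {f : V → V → ℕ} (h : PC G D z x f) {w : V} {α β n : ℕ} (hw : Fan D f z x n w)
    (hα : Miss D f z α) (hβ : Miss D f w β) (hK : w ∉ Kemp f α β z) : False := by
  have hz : z ∉ Kemp f α β w := fun hc => hK (kemp_symm h.symm hc)
  have hα0 : α ≠ 0 := by have := hα.1; omega
  have hβ0 : β ≠ 0 := by have := hβ.1; omega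
  have hf' := h.swp hα0 hβ0 hα.2.1 hβ.2.1 w
  have hza : Miss D (swp f α β (Kemp f α β w)) z α := (miss_swp_notMem hz).2 hα
  have hwa : Miss D (swp f α β (Kemp f α β w)) w α :=
    miss_swp_mem_left mem_kemp_self hβ hα.1 hα.2.1
  have key : ∀ j u, Fan D f z x j u →
      (∃ i, Fan D (swp f α β (Kemp f α β w)) z x i u) ∨
      ∃ i u', Fan D (swp f α β (Kemp f α β w)) z x i u' ∧
        Miss D (swp f α β (Kemp f α β w)) u' α := by
    intro j u hu
    induction hu with
    | zero => exact Or.inl ⟨0, Fan.zero⟩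
    | @succ j u0 u g1 g2 g3 ihj =>
      rcases ihj with ⟨i, hi⟩ | hr
      · have e1 : swp f α β (Kemp f α β w) z u = f z u := swp_notMem hz u
        have hcα : f z u ≠ α := hα.2.2 u
        by_cases hcβ : f z u = β
        · by_cases hu0 : u0 ∈ Kemp f α β w
          · right
            exact ⟨i, u0, hi, miss_swp_mem_left hu0 (hcβ ▸ g3) hα.1 hα.2.1⟩
          · left
            refine ⟨i + 1, Fan.succ hi (by rw [e1]; exact g2) ?_⟩
            rw [e1, miss_swp_notMem hu0]; exact g3
        · left
          refine ⟨i + 1, Fan.succ hi (by rw [e1]; exact g2) ?_⟩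
          rw [e1]
          refine ⟨g3.1, g3.2.1, fun t ht => g3.2.2 t ?_⟩
          exact (swp_eq_iff hcα hcβ).1 ht
      · exact Or.inr hr
  rcases key n w hw with ⟨i, hi⟩ | ⟨i, u', hi, hm⟩
  · exact fan1 hno hzx i _ hf' w α hi hwa hza
  · exact fan1 hno hzx i _ hf' u' α hi hm hza

lemma fan2 {D : ℕ} (hno : ∀ φ, ¬ IsEdgeColoring G D φ) {z x : V} (hzx : G.Adj z x)
    (hdeg : G.degree z ≤ D)
    {f : V → V → ℕ} (h : PC G D z x f) {v w : V} {β n m : ℕ} (hv : Fan D f z x n v)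
    (hw : Fan D f z x m w) (hvw : v ≠ w)
    (hvβ : Miss D f v β) (hwβ : Miss D f w β) : False := by
  obtain ⟨α, hα⟩ := exists_miss_end G h hzx hdeg
  have hα0 : α ≠ 0 := by have := hα.1; omega
  have hβ0 : β ≠ 0 := by have := hvβ.1; omega
  by_cases h1 : v ∈ Kemp f α β z
  · by_cases h2 : w ∈ Kemp f α β z
    · exact three_ends h hα0 hβ0 (hv.ne h hzx).symm (hw.ne h hzx).symm hvw
        (Or.inl hα.2.2) (Or.inr hvβ.2.2) (Or.inr hwβ.2.2) h1 h2
    · exact fan2a hno hzx h hw hα hwβ h2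
  · exact fan2a hno hzx h hv hα hvβ h1

open Classical in
/-- Vizing's adjacency lemma, in counting form. -/
lemma val {D : ℕ} (hno : ∀ φ, ¬ IsEdgeColoring G D φ) {z x : V} (hzx : G.Adj z x)
    (hdeg : ∀ v, G.degree v ≤ D) {f : V → V → ℕ} (h : PC G D z x f) :
    ((G.neighborFinset z).filter (fun v => G.degree v < D)).card + 1 ≤ G.degree x := by
  set F := Finset.univ.filter (fun v => ∃ n, Fan D f z x n v) with hF
  let MS : V → Finset ℕ := fun v => (Finset.Icc 1 D).filter (Miss D f v)
  have hMS : ∀ v c, c ∈ MS v ↔ Miss D f v c := by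
    intro v c
    simp only [MS, Finset.mem_filter, Finset.mem_Icc, Miss]; tauto
  have hFm : ∀ v, v ∈ F ↔ ∃ n, Fan D f z x n v := by intro v; simp [F]
  have hxF : x ∈ F := (hFm x).2 ⟨0, Fan.zero⟩
  have hdisj : (F : Set V).PairwiseDisjoint MS := by
    intro v hv w hw hne
    rw [Function.onFun, Finset.disjoint_left]
    intro c hc hc'
    obtain ⟨n, hn⟩ := (hFm v).1 hv
    obtain ⟨m, hm⟩ := (hFm w).1 hw
    exact fan2 hno hzx (hdeg z) h hn hm hne ((hMS _ _).1 hc) ((hMS _ _).1 hc')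
  have hsub : F.biUnion MS ⊆ (F.erase x).image (f z) := by
    intro c hc
    obtain ⟨v, hv, hvc⟩ := Finset.mem_biUnion.1 hc
    obtain ⟨n, hn⟩ := (hFm v).1 hv
    have hvc := (hMS _ _).1 hvc
    by_contra hcon
    refine fan1 hno hzx n f h v c hn hvc ⟨hvc.1, hvc.2.1, fun t ht => hcon ?_⟩
    have ht0 : f z t ≠ 0 := by have := hvc.1; omega
    refine Finset.mem_image.2 ⟨t, Finset.mem_erase.2 ⟨?_, (hFm t).2 ⟨n + 1, ?_⟩⟩, ht⟩
    · rintro rfl; exact ht0 h.zero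
    · exact Fan.succ hn ht0 (ht ▸ hvc)
  have hc1 : ∑ v ∈ F, (MS v).card ≤ (F.erase x).card := by
    rw [← Finset.card_biUnion hdisj]
    exact (Finset.card_le_card hsub).trans Finset.card_image_le
  have hMx : D + 1 ≤ (MS x).card + G.degree x := by
    have hs : Finset.Icc 1 D ⊆ MS x ∪ ((G.neighborFinset x).erase z).image (f x) := by
      intro c hc
      rw [Finset.mem_Icc] at hc
      by_contra hn
      rw [Finset.mem_union, not_or] at hn
      exact hn.1 ((hMS _ _).2 (mem_image_row G h.flip hc.1 hc.2 hn.2))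
    have h1 := (Finset.card_le_card hs).trans (Finset.card_union_le _ _)
    have h2 := card_image_row G h.flip hzx.symm
    rw [Nat.card_Icc] at h1
    omega
  have hMv : ∀ v, G.degree v < D → 1 ≤ (MS v).card := by
    intro v hv
    have hs : Finset.Icc 1 D ⊆ MS v ∪ (G.neighborFinset v).image (f v) := by
      intro c hc
      rw [Finset.mem_Icc] at hc
      by_contra hn
      rw [Finset.mem_union, not_or] at hn
      exact hn.1 ((hMS _ _).2 (mem_image_row' G h hc.1 hc.2 hn.2))
    have h1 := (Finset.card_le_card hs).trans (Finset.card_union_le _ _)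
    have h2 : ((G.neighborFinset v).image (f v)).card ≤ (G.neighborFinset v).card :=
      Finset.card_image_le
    rw [SimpleGraph.card_neighborFinset_eq_degree] at h2
    rw [Nat.card_Icc] at h1
    omega
  have hc2 : ((F.erase x).filter (fun v => G.degree v < D)).card ≤ ∑ v ∈ F.erase x, (MS v).card := by
    rw [Finset.card_filter]
    apply Finset.sum_le_sum
    intro v _
    split_ifs with hv
    · exact hMv v hv
    · omega
  have hc3 := Finset.add_sum_erase F (fun v => (MS v).card) hxF
  have hc4 := Finset.card_filter_add_card_filter_not (s := F.erase x) (fun v => G.degree v < D)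
  have hc5 := Finset.card_filter_add_card_filter_not (s := G.neighborFinset z)
    (fun v => G.degree v < D)
  rw [SimpleGraph.card_neighborFinset_eq_degree] at hc5
  have hc6 : ((F.erase x).filter (fun v => ¬ G.degree v < D)).card ≤
      ((G.neighborFinset z).filter (fun v => ¬ G.degree v < D)).card := by
    apply Finset.card_le_card
    apply Finset.filter_subset_filter
    intro v hv
    obtain ⟨h1, h2⟩ := Finset.mem_erase.1 hv
    obtain ⟨n, hn⟩ := (hFm v).1 h2
    cases hn with
    | zero => exact absurd rfl h1
    | succ a b c => simpa using ((h.adj z v).1 b).1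
  have := hdeg z
  omega

lemma exists_pc {D : ℕ} {x y : V} (hxy : G.Adj x y)
    {φ : V → V → ℕ} (hφ : IsEdgeColoring (G.deleteEdges {s(x, y)}) D φ) :
    ∃ f, PC G D x y f := by
  classical
  obtain ⟨h1, h2, h3⟩ := hφ
  have hadj : ∀ u v, (G.deleteEdges {s(x, y)}).Adj u v ↔
      (G.Adj u v ∧ ¬ (u = x ∧ v = y) ∧ ¬ (u = y ∧ v = x)) := by
    intro u v
    rw [SimpleGraph.deleteEdges_adj]
    simp only [Set.mem_singleton_iff, Sym2.eq_iff]
    tauto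
  have hr : ∀ u v, (G.deleteEdges {s(x, y)}).Adj u v → 1 ≤ φ u v ∧ φ u v ≤ D := by
    intro u v h
    exact Finset.mem_Icc.1 (h2 h)
  refine ⟨fun u v => if (G.deleteEdges {s(x, y)}).Adj u v then φ u v else 0, ?_, ?_, ?_, ?_⟩
  · intro u v
    simp only [(G.deleteEdges {s(x, y)}).adj_comm u v, h1 u v]
  · intro u v
    split_ifs with h
    · exact (hr u v h).2
    · omega
  · intro u v
    rw [← hadj]
    split_ifs with h
    · have := hr u v h
      simp only [h, iff_true]; omega
    · exact ⟨fun hc => absurd rfl hc, fun hc => absurd hc h⟩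
  · intro v a b he hn
    by_cases ha : (G.deleteEdges {s(x, y)}).Adj v a
    · by_cases hb : (G.deleteEdges {s(x, y)}).Adj v b
      · by_contra hab
        rw [if_pos ha, if_pos hb] at he
        exact h3 ha hb hab he
      · rw [if_neg hb] at he; exact absurd he hn
    · rw [if_neg ha] at hn; exact absurd rfl hn

lemma crit_no (hG : IsDeltaCritical G) : ∀ φ, ¬ IsEdgeColoring G G.maxDegree φ := by
  intro φ hφ
  have h := hG.2.1
  unfold chromIndex at h
  have : G.maxDegree ∉ {k | ∃ φ : V → V → ℕ, IsEdgeColoring G k φ} :=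
    Nat.notMem_of_lt_sInf (by omega)
  exact this ⟨φ, hφ⟩

lemma crit_pc (hG : IsDeltaCritical G) (hpos : 0 < G.maxDegree) {x y : V} (hxy : G.Adj x y) :
    ∃ f, PC G G.maxDegree x y f := by
  have h := hG.2.2 s(x, y) (by simpa using hxy)
  unfold chromIndex at h
  have hne : {k | ∃ φ : V → V → ℕ, IsEdgeColoring (G.deleteEdges {s(x, y)}) k φ}.Nonempty := by
    by_contra hc
    rw [Set.not_nonempty_iff_eq_empty] at hc
    rw [hc, Nat.sInf_empty] at h
    omega
  have hm := Nat.sInf_mem hne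
  rw [h] at hm
  obtain ⟨φ, hφ⟩ := hm
  exact exists_pc hxy hφ

end VAL

end helpers

lemma amgm_two_one {P Q T : ℝ} (hP : 0 ≤ P) (hQ : 0 ≤ Q) (h : 4 * T ^ 3 ≤ 27 * (P ^ 2 * Q)) :
    T ≤ P + Q := by
  by_contra hc
  push Not at hc
  have h1 : (P + Q) ^ 3 < T ^ 3 := pow_lt_pow_left₀ hc (by positivity) (by norm_num)
  have h2 : 0 ≤ (P - 2 * Q) ^ 2 * (4 * P + Q) := by positivity
  nlinarith

lemma frac_mono {a k : ℝ} (ha : 2 ≤ a) (hk : a ≤ k) : a ^ 2 / (a - 1) ≤ k ^ 2 / (k - 1) := by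
  rw [div_le_div_iff₀ (by linarith) (by linarith)]
  nlinarith [mul_nonneg (sub_nonneg.2 hk) (show 0 ≤ a * k - a - k by nlinarith)]

lemma F_eq {k s : ℝ} (hs : 0 < s) (hk : 1 < k) :
    (k / s) ^ 2 * (s ^ 2 / (k - 1)) = k ^ 2 / (k - 1) := by
  have : k - 1 ≠ 0 := by linarith
  field_simp

lemma F_lower {k s a T : ℝ} (hs : 0 < s) (ha : 2 ≤ a) (hk : a ≤ k)
    (hT : 4 * T ^ 3 ≤ 27 * (a ^ 2 / (a - 1))) : T ≤ k / s + s ^ 2 / (k - 1) := by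
  apply amgm_two_one
  · have : 0 ≤ k := by linarith
    positivity
  · have : 0 ≤ k - 1 := by linarith
    positivity
  · rw [F_eq hs (by linarith)]
    have := frac_mono ha hk
    linarith

lemma arith_big {d k s D ω : ℝ} (hd : 19 ≤ d) (hk : d ≤ k) (hs : 0 < s)
    (hω : ω ^ 3 = d * (d - 1)) (hω0 : 0 < ω) (hω3 : 3 * ω ≤ d + 2)
    (hup : k < ω / (d + 2) * D) :
    (d + 2) * (D - k) ≤ (ω * (D - k / (1 - ω / (d + 2)))) * (k / s - 1 + s ^ 2 / (k - 1)) := by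
  set ε := ω / (d + 2) with hε
  have hε3 : ε ≤ 1 / 3 := by
    rw [hε, div_le_div_iff₀ (by linarith) (by norm_num)]; linarith
  have hε0 : 0 < ε := by rw [hε]; apply div_pos hω0; linarith
  have hD0 : 0 < D := by
    by_contra hc
    push Not at hc
    nlinarith
  have hD : 3 * k ≤ D := by nlinarith
  have hk0 : k / (1 - ε) ≤ 3 / 2 * k := by
    rw [div_le_iff₀ (by linarith)]; nlinarith
  have hPQ : 1.88 * d ≤ ω * (k / s) + ω * (s ^ 2 / (k - 1)) := by
    apply amgm_two_one
    · have : 0 ≤ k := by linarith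
      positivity
    · have : 0 ≤ k - 1 := by linarith
      positivity
    · have e : (ω * (k / s)) ^ 2 * (ω * (s ^ 2 / (k - 1))) =
          ω ^ 3 * ((k / s) ^ 2 * (s ^ 2 / (k - 1))) := by ring
      rw [e, F_eq hs (by linarith), hω]
      have h1 := frac_mono (show 2 ≤ d by linarith) hk
      have h2 : d * (d - 1) * (d ^ 2 / (d - 1)) = d ^ 3 := by
        have : d - 1 ≠ 0 := by linarith
        field_simp
      have h3 : d * (d - 1) * (d ^ 2 / (d - 1)) ≤ d * (d - 1) * (k ^ 2 / (k - 1)) := by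
        apply mul_le_mul_of_nonneg_left h1
        apply mul_nonneg <;> linarith
      have h4 : 0 ≤ d ^ 3 := by positivity
      nlinarith
  have hF : 4 / 3 * (d + 2) ≤ ω * (k / s - 1 + s ^ 2 / (k - 1)) := by
    have : ω * (k / s - 1 + s ^ 2 / (k - 1)) =
      ω * (k / s) + ω * (s ^ 2 / (k - 1)) - ω := by ring
    rw [this]; linarith
  calc (d + 2) * (D - k) ≤ (D - 3 / 2 * k) * (4 / 3 * (d + 2)) := by nlinarith
    _ ≤ (D - k / (1 - ε)) * (ω * (k / s - 1 + s ^ 2 / (k - 1))) := by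
      apply mul_le_mul (by linarith) hF (by nlinarith) (by linarith)
    _ = _ := by ring

lemma arith_three {k s D : ℝ} (hk : 6 ≤ k) (hs : 0 < s) (hup : k < 2 / 5 * D) (hD : 1000 ≤ D) :
    5 * (D - k) ≤ (2 * (D - k / (1 - 2 / 5))) * (k / s - 1 + s ^ 2 / (k - 1)) := by
  have e : k / (1 - 2 / 5) = 5 / 3 * k := by ring
  rw [e]
  by_cases hk' : 27 ≤ k
  · have := F_lower (T := 5.5) hs (by norm_num : (2:ℝ) ≤ 27) hk' (by norm_num)
    nlinarith
  · push Not at hk'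
    have := F_lower (T := 3.6) hs (by norm_num : (2:ℝ) ≤ 6) hk (by norm_num)
    nlinarith

lemma arith_four {k s D : ℝ} (hk : 9 ≤ k) (hs : 0 < s) (hup : k < 2 / 6 * D) (hD : 1000 ≤ D) :
    6 * (D - k) ≤ (2 * (D - k / (1 - 2 / 6))) * (k / s - 1 + s ^ 2 / (k - 1)) := by
  have e : k / (1 - 2 / 6) = 3 / 2 * k := by ring
  rw [e]
  by_cases hk' : 19 ≤ k
  · have := F_lower (T := 5) hs (by norm_num : (2:ℝ) ≤ 19) hk' (by norm_num)
    nlinarith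
  · push Not at hk'
    have := F_lower (T := 4.05) hs (by norm_num : (2:ℝ) ≤ 9) hk (by norm_num)
    nlinarith

lemma sum_inv_lower {W : Type*} [DecidableEq W] (N Z : Finset W) (n : W → ℕ) (s k : ℕ)
    (hN : N.card = k) (hZN : Z ⊆ N) (hZ : Z.card = s) (hs : 1 ≤ s) (hn : ∀ z ∈ N, 1 ≤ n z)
    (hmax : ∀ z ∈ N, n z ≤ s) (hsum : ∑ z ∈ Z, n z + 1 ≤ k) :
    (k : ℝ) / s - 1 + (s : ℝ) ^ 2 / ((k : ℝ) - 1) ≤ ∑ z ∈ N, 1 / (n z : ℝ) := by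
  have hs0 : (0 : ℝ) < s := by exact_mod_cast hs
  rw [← Finset.sum_sdiff hZN]
  apply add_le_add
  · have h1 : ((N \ Z).card : ℝ) = k - s := by
      rw [Finset.cast_card_sdiff hZN, hN, hZ]
    have h2 : ∑ z ∈ N \ Z, 1 / (s : ℝ) ≤ ∑ z ∈ N \ Z, 1 / (n z : ℝ) := by
      apply Finset.sum_le_sum
      intro z hz
      have hz := (Finset.mem_sdiff.1 hz).1
      apply one_div_le_one_div_of_le
      · exact_mod_cast hn z hz
      · exact_mod_cast hmax z hz
    rw [Finset.sum_const, nsmul_eq_mul, h1] at h2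
    refine le_trans (le_of_eq ?_) h2
    field_simp
  · have h1 := Finset.sq_sum_div_le_sum_sq_div Z (fun _ => (1 : ℝ)) (g := fun z => (n z : ℝ))
      (fun z hz => by exact_mod_cast hn z (hZN hz))
    simp only [Finset.sum_const, nsmul_eq_mul, mul_one, one_pow, hZ] at h1
    refine le_trans ?_ h1
    have h2 : ∑ z ∈ Z, (n z : ℝ) ≤ (k : ℝ) - 1 := by
      have : ((∑ z ∈ Z, n z + 1 : ℕ) : ℝ) ≤ k := by exact_mod_cast hsum
      push_cast at this; linarith
    have h3 : 0 < ∑ z ∈ Z, (n z : ℝ) := by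
      apply Finset.sum_pos
      · intro z hz; exact_mod_cast hn z (hZN hz)
      · rw [← Finset.card_pos]; omega
    exact div_le_div_of_nonneg_left (by positivity) h3 h2

lemma m1star_lower (G : SimpleGraph V) [DecidableRel G.Adj] (hG : IsDeltaCritical G)
    (hpos : 0 < G.maxDegree) (d : ℕ) (ω q ε : ℝ) (hω0 : 0 < ω) (hωε : ω = ε * (d + 2))
    (hε2 : ε < 1 / 2) (hq : q = (1 - ε) * G.maxDegree) (X : Finset V) (x z : V)
    (hxz : G.Adj z x) :
    ω * (G.maxDegree - G.degree x / (1 - ε)) ≤ M1star G d ω q X z := by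
  classical
  obtain ⟨f, hf⟩ := crit_pc hG hpos hxz
  have hv := val (crit_no hG) hxz (fun v => G.degree_le_maxDegree v) hf
  have hD : (0 : ℝ) < G.maxDegree := by exact_mod_cast hpos
  have hε1 : 0 < 1 - ε := by linarith
  have hq0 : 0 < q := by rw [hq]; positivity
  unfold M1star
  have hc : (G.neighborFinset z ∩ Xp G q X).card ≤ G.degree x := by
    refine le_trans (Finset.card_le_card ?_) (show _ ≤ _ from (Nat.le_succ _).trans hv)
    intro v hv
    rw [Finset.mem_inter] at hv
    rw [Finset.mem_filter]
    refine ⟨hv.1, ?_⟩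
    have := hv.2
    unfold Xp at this
    exact (Finset.mem_filter.1 this).2.2
  have hs : ∑ v ∈ G.neighborFinset z ∩ Xp G q X, g1 d (G.maxDegree : ℝ) (G.degree v : ℝ) ≤
      ∑ v ∈ G.neighborFinset z ∩ Xp G q X, ω / (1 - ε) := by
    apply Finset.sum_le_sum
    intro v hv
    rw [Finset.mem_inter] at hv
    have h1 := hv.2
    unfold Xp at h1
    have h2 := (Finset.mem_filter.1 h1).2.1
    unfold g1
    rw [div_le_div_iff₀ (by linarith) hε1, hωε]
    have hd : (0 : ℝ) ≤ d + 2 := by positivity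
    have h3 := mul_nonneg hd (sub_nonneg.2 h2)
    rw [hq] at h3
    nlinarith
  rw [Finset.sum_const, nsmul_eq_mul] at hs
  have hc' : ((G.neighborFinset z ∩ Xp G q X).card : ℝ) ≤ G.degree x := by exact_mod_cast hc
  have h5 : ((G.neighborFinset z ∩ Xp G q X).card : ℝ) * (ω / (1 - ε)) ≤
      G.degree x * (ω / (1 - ε)) := mul_le_mul_of_nonneg_right hc' (by positivity)
  have h6 : ω * (G.maxDegree - G.degree x / (1 - ε)) =
      ω * G.maxDegree - G.degree x * (ω / (1 - ε)) := by ring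
  linarith

lemma main_lower (G : SimpleGraph V) [DecidableRel G.Adj] (hG : IsDeltaCritical G)
    (hpos : 0 < G.maxDegree) (d : ℕ) (hd : 1 ≤ d) (hmin : ∀ v : V, d ≤ G.degree v)
    (X : Finset V) (hXind : ∀ u ∈ X, ∀ v ∈ X, u ≠ v → ¬ G.Adj u v)
    (ω q ε : ℝ) (hω0 : 0 < ω) (hωε : ω = ε * (d + 2))
    (hε2 : ε < 1 / 2) (hq : q = (1 - ε) * G.maxDegree) (x : V) (hx : x ∈ X)
    (hup : (G.degree x : ℝ) < ε * G.maxDegree) :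
    ∃ s : ℝ, 0 < s ∧ ((d : ℝ) + 2) * G.degree x +
      ω * (G.maxDegree - G.degree x / (1 - ε)) *
        (G.degree x / s - 1 + s ^ 2 / ((G.degree x : ℝ) - 1)) ≤ M2starX G d ω q X x := by
  classical
  have hD : (0 : ℝ) < G.maxDegree := by exact_mod_cast hpos
  have hε1 : 0 < 1 - ε := by linarith
  have hkq : (G.degree x : ℝ) < q := by rw [hq]; nlinarith
  have hxm : x ∈ Xm G d q X := Finset.mem_filter.2 ⟨hx, hmin x, hkq⟩
  have hxp : x ∉ Xp G q X := fun hc => by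
    have := (Finset.mem_filter.1 hc).2.1
    linarith
  have hm0 : 0 < ω * (G.maxDegree - G.degree x / (1 - ε)) := by
    apply mul_pos hω0
    rw [sub_pos, div_lt_iff₀ hε1]
    nlinarith
  have hfil : (G.neighborFinset x).filter (· ∉ X) = G.neighborFinset x := by
    apply Finset.filter_true_of_mem
    intro y hy hyX
    rw [SimpleGraph.mem_neighborFinset] at hy
    exact hXind x hx y hyX hy.ne hy
  let S' : Finset V := (Xm G d q X).erase x
  have hS : SmallSet G G.maxDegree x (S' : Set V) := by
    intro v hv
    have hv : v ∈ (Xm G d q X).erase x := hv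
    obtain ⟨h1, h2⟩ := Finset.mem_erase.1 hv
    obtain ⟨h3, h4, h5⟩ := Finset.mem_filter.1 h2
    refine ⟨h1, hXind x hx v h3 (Ne.symm h1), ?_⟩
    have : (G.degree v : ℝ) + G.degree x < G.maxDegree := by rw [hq] at h5; linarith
    exact_mod_cast this
  let n : V → ℕ := fun z => (G.neighborFinset z ∩ S').card + 1
  have hn : ∀ z, G.Adj x z → (G.neighborFinset z ∩ Xm G d q X).card = n z := by
    intro z hz
    have : G.neighborFinset z ∩ Xm G d q X = insert x (G.neighborFinset z ∩ S') := by
      ext v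
      simp only [S', Finset.mem_inter, Finset.mem_insert, Finset.mem_erase,
        SimpleGraph.mem_neighborFinset]
      by_cases hv : v = x
      · subst hv; simp [hz.symm, hxm]
      · simp [hv]
    rw [this, Finset.card_insert_of_notMem]
    simp [S']
  have hne : (G.neighborFinset x).Nonempty := by
    rw [← Finset.card_pos, SimpleGraph.card_neighborFinset_eq_degree]
    have := hmin x; omega
  obtain ⟨y, hy, hymax⟩ := Finset.exists_max_image (G.neighborFinset x) n hne
  have hxy : G.Adj x y := by simpa using hy
  obtain ⟨f, hf⟩ := crit_pc hG hpos hxy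
  obtain ⟨Z, hZ1, hZ2, hZ3⟩ := count_main (crit_no hG) (fun v => G.degree_le_maxDegree v) hS hf
    hxy S' (fun v => by simp)
  have hsum := sum_inv_lower (G.neighborFinset x) Z n (n y) (G.degree x)
    (G.card_neighborFinset_eq_degree x) (hZ1.trans (Finset.erase_subset _ _))
    (by rw [hZ2]) (by simp [n]) (by simp [n]) hymax hZ3
  refine ⟨(n y : ℝ), by positivity, ?_⟩
  have hM : M2starX G d ω q X x = ((d : ℝ) + 2) * G.degree x +
      ∑ y ∈ G.neighborFinset x, step2 G d ω q X y := by
    unfold M2starX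
    rw [if_neg hxp, if_pos hxm, add_zero]
    congr 1
    exact Finset.sum_congr (by convert hfil) (fun _ _ => rfl)
  rw [hM]
  refine add_le_add le_rfl ?_
  refine (mul_le_mul_of_nonneg_left hsum hm0.le).trans ?_
  rw [Finset.mul_sum]
  apply Finset.sum_le_sum
  intro z hz
  have hz : G.Adj x z := by simpa using hz
  have hM1 := m1star_lower G hG hpos d ω q ε hω0 hωε hε2 hq X x z hz.symm
  have hnz := hn z hz
  unfold step2
  have hcard : (@Inter.inter _ (@Finset.instInter V (fun a b => Classical.propDecidable (a = b)))
      (G.neighborFinset z) (Xm G d q X)).card = n z := by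
    rw [← hnz]
  rw [if_pos, hcard]
  · rw [mul_one_div]
    exact div_le_div_of_nonneg_right hM1 (by positivity)
  · refine ⟨hm0.trans_le hM1, ?_⟩
    rw [← Finset.card_pos, hcard]
    simp [n]


/-- Discharging setup as in the paper, with `ε = ω/(d+2)`. For each `x ∈ X₂⁻` one has
`M₂*(x) ≥ (d+2)Δ = M₂(x)`, where `X₂⁻ = {x ∈ X : d ≤ d(x) < εΔ}` if `d ≥ 19` and
`X₂⁻ = {x ∈ X : 3d - 3 ≤ d(x) < εΔ}` if `d ∈ {3,4}`. -/
theorem statement18 (G : SimpleGraph V) [DecidableRel G.Adj]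
    (d : ℕ) (hd : d = 3 ∨ d = 4 ∨ 19 ≤ d)
    (hG : IsDeltaCritical G) (hmin : ∀ v : V, d ≤ G.degree v)
    (hmax : (d + 2) ^ (5 * d + 10) ≤ G.maxDegree)
    (X : Finset V) (hXind : ∀ u ∈ X, ∀ v ∈ X, u ≠ v → ¬ G.Adj u v)
    (hXmax : ∀ s : Finset V, (∀ u ∈ s, ∀ v ∈ s, u ≠ v → ¬ G.Adj u v) → s.card ≤ X.card)
    (ω : ℝ) (hω : ((d = 3 ∨ d = 4) ∧ ω = 2) ∨
      (19 ≤ d ∧ ω = (((d : ℝ) - 1) * d) ^ ((1 : ℝ) / 3)))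
    (q : ℝ) (hq : q = (((d : ℝ) + 2 - ω) / ((d : ℝ) + 2)) * G.maxDegree)
    (ε : ℝ) (hε : ε = ω / ((d : ℝ) + 2))
    (x : V) (hx : x ∈ X)
    (hlow : (19 ≤ d → d ≤ G.degree x) ∧ ((d = 3 ∨ d = 4) → 3 * d - 3 ≤ G.degree x))
    (hup : (G.degree x : ℝ) < ε * G.maxDegree) :
    ((d : ℝ) + 2) * G.maxDegree ≤ M2starX G d ω q X x := by
  have hDbig : 1000 ≤ G.maxDegree := by
    have h1 : 5 ^ 25 ≤ (d + 2) ^ (5 * d + 10) := by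
      calc 5 ^ 25 ≤ (d + 2) ^ 25 := Nat.pow_le_pow_left (by omega) _
        _ ≤ _ := Nat.pow_le_pow_right (by omega) (by omega)
    have h2 : 1000 ≤ 5 ^ 25 := by norm_num
    omega
  have hD : (1000 : ℝ) ≤ G.maxDegree := by exact_mod_cast hDbig
  have hd2 : (0 : ℝ) < d + 2 := by positivity
  have hωε : ω = ε * (d + 2) := by rw [hε]; field_simp
  have hq' : q = (1 - ε) * G.maxDegree := by
    rw [hq, hε]; field_simp
  rcases hω with ⟨hd34, rfl⟩ | ⟨hd19, hω⟩
  · have hk := hlow.2 hd34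
    rcases hd34 with rfl | rfl
    · have hε' : ε = 2 / 5 := by rw [hε]; norm_num
      obtain ⟨s, hs, h⟩ := main_lower G hG (by omega) 3 (by norm_num) hmin X hXind 2 q ε
        (by norm_num) hωε (by rw [hε']; norm_num) hq' x hx hup
      rw [hε'] at h hup
      have hk' : (6 : ℝ) ≤ G.degree x := by exact_mod_cast hk
      have := arith_three hk' hs hup hD
      push_cast at h ⊢
      linarith
    · have hε' : ε = 2 / 6 := by rw [hε]; norm_num
      obtain ⟨s, hs, h⟩ := main_lower G hG (by omega) 4 (by norm_num) hmin X hXind 2 q ε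
        (by norm_num) hωε (by rw [hε']; norm_num) hq' x hx hup
      rw [hε'] at h hup
      have hk' : (9 : ℝ) ≤ G.degree x := by exact_mod_cast hk
      have := arith_four hk' hs hup hD
      push_cast at h ⊢
      linarith
  · have hdr : (19 : ℝ) ≤ d := by exact_mod_cast hd19
    have hpos : 0 < ((d : ℝ) - 1) * d := by nlinarith
    have hω0 : 0 < ω := by rw [hω]; exact Real.rpow_pos_of_pos hpos _
    have hω3 : ω ^ 3 = d * (d - 1) := by
      rw [hω, ← Real.rpow_natCast, ← Real.rpow_mul hpos.le]
      norm_num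
      ring
    have hω3' : 3 * ω ≤ d + 2 := by
      by_contra hc
      push Not at hc
      have h1 : ((d : ℝ) + 2) ^ 3 < (3 * ω) ^ 3 := pow_lt_pow_left₀ hc hd2.le (by norm_num)
      rw [mul_pow, hω3] at h1
      nlinarith [mul_nonneg (show (0 : ℝ) ≤ d by positivity) (sub_nonneg.2 hdr), sq_nonneg ((d : ℝ) - 19), mul_nonneg (show (0 : ℝ) ≤ (d:ℝ) ^ 2 by positivity) (sub_nonneg.2 hdr)]
    have hε3 : ε ≤ 1 / 3 := by
      rw [hε, div_le_div_iff₀ hd2 (by norm_num)]; linarith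
    obtain ⟨s, hs, h⟩ := main_lower G hG (by omega) d (by omega) hmin X hXind ω q ε
      hω0 hωε (by linarith) hq' x hx hup
    rw [hε] at h hup
    have hk' : (d : ℝ) ≤ G.degree x := by exact_mod_cast hmin x
    have := arith_big hdr hk' hs hω3 hω0 hω3' hup
    linarith
end
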